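/- Let A be a commutative ring, U a multiplicative subset of A, and B = U⁻¹A the localization. Let g : Y → Spec(B) be a proper morphism of schemes of finite presentation. Then there exists a proper morphism of schemes f : X → Spec(A) of finite presentation such that X ×_{Spec(A)} Spec(B) is isomorphic to Y as a scheme over Spec(B). -/

import Mathlib

open AlgebraicGeometry CategoryTheory CategoryTheory.Limits

universe u

namespace Ngt

section Abstract

variable {Y : Type u} {O : Y → Type u} [∀ y, CommRing (O y)]

/-- The locus where `s` is a unit. -/
def Dom (s : ∀ y, O y) : Set Y := {y | IsUnit (s y)}

/-- Pointwise inverse. -/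
noncomputable def pinv (s : ∀ y, O y) : ∀ y, O y := fun y => Ring.inverse (s y)

lemma mul_pinv {s : ∀ y, O y} {y : Y} (h : y ∈ Dom s) : s y * pinv s y = 1 :=
  Ring.mul_inverse_cancel _ h

/-- vanishing on `V` -/
def Van (V : Set Y) (x : ∀ y, O y) : Prop := ∀ y ∈ V, x y = 0

lemma Van.mono {V W : Set Y} {x : ∀ y, O y} (h : V ⊆ W) (hx : Van W x) : Van V x :=
  fun y hy => hx y (h hy)

/-- equality on `V` -/
def EqV (V : Set Y) (x z : ∀ y, O y) : Prop := ∀ y ∈ V, x y = z y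

lemma EqV.mono {V W : Set Y} {x z : ∀ y, O y} (h : V ⊆ W) (hx : EqV W x z) : EqV V x z :=
  fun y hy => hx y (h hy)

/-- The ambient data. -/
structure Amb (O : Y → Type u) [∀ y, CommRing (O y)] where
  Aff : Set (Set Y)
  Sec : Set Y → Subring (∀ y, O y)
  inter : ∀ {V W}, V ∈ Aff → W ∈ Aff → V ∩ W ∈ Aff
  basic : ∀ {V s}, V ∈ Aff → s ∈ Sec V → V ∩ Dom s ∈ Aff
  zero_mem : ∀ {V x}, Van V x → x ∈ Sec V
  anti : ∀ {V W}, V ⊆ W → Sec W ≤ Sec V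
  inv_mem : ∀ {V s}, V ∈ Aff → s ∈ Sec V → V ⊆ Dom s → pinv s ∈ Sec V
  L0 : ∀ {V x s}, V ∈ Aff → x ∈ Sec V → s ∈ Sec V → Van (V ∩ Dom s) x →
    ∃ p : ℕ, Van V (s ^ p * x)
  L1 : ∀ {V x s}, V ∈ Aff → s ∈ Sec V → x ∈ Sec (V ∩ Dom s) →
    ∃ p : ℕ, ∃ z ∈ Sec V, EqV (V ∩ Dom s) (s ^ p * x) z
  f : ∀ y, O y
  f_unit : ∀ y, IsUnit (f y)
  base : Subring (∀ y, O y)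
  base_noeth : IsNoetherianRing base
  base_le : ∀ V, base ≤ Sec V
  f_mem : f ∈ base

/-- Charts. -/
structure Chart (AA : Amb O) where
  V : Set Y
  aff : V ∈ AA.Aff
  N : Subring (∀ y, O y)
  le : N ≤ AA.Sec V
  zero : ∀ x, Van V x → x ∈ N
  base_le : AA.base ≤ N

variable {AA : Amb O}

namespace Chart

/-- join of charts -/
def sup (c d : Chart AA) : Chart AA where
  V := c.V ∩ d.V
  aff := AA.inter c.aff d.aff
  N := c.N ⊔ d.N
  le := sup_le (c.le.trans (AA.anti Set.inter_subset_left))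
    (d.le.trans (AA.anti Set.inter_subset_right))
  zero x hx := by
    classical
    have h1 : (fun y => if y ∈ c.V then 0 else x y) ∈ c.N ⊔ d.N :=
      (le_sup_left : c.N ≤ _) (c.zero _ (fun y hy => by simp [hy]))
    have h2 : (fun y => if y ∈ c.V then x y else 0) ∈ c.N ⊔ d.N := by
      refine (le_sup_right : d.N ≤ _) (d.zero _ (fun y hy => ?_))
      by_cases h : y ∈ c.V
      · simp [h, hx y ⟨h, hy⟩]
      · simp [h]
    have := add_mem h1 h2
    convert this using 1
    funext y
    by_cases h : y ∈ c.V <;> simp [h]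
  base_le := c.base_le.trans le_sup_left

/-- refinement -/
def Ref (d c : Chart AA) : Prop := d.V ⊆ c.V ∧ c.N ≤ d.N

lemma Ref.refl (c : Chart AA) : Ref c c := ⟨subset_rfl, le_rfl⟩
lemma Ref.trans {c d e : Chart AA} (h : Ref c d) (h' : Ref d e) : Ref c e :=
  ⟨h.1.trans h'.1, h'.2.trans h.2⟩
lemma sup_left (c d : Chart AA) : Ref (c.sup d) c := ⟨Set.inter_subset_left, le_sup_left⟩
lemma sup_right (c d : Chart AA) : Ref (c.sup d) d := ⟨Set.inter_subset_right, le_sup_right⟩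
lemma Ref.sup {c d e : Chart AA} (h : Ref e c) (h' : Ref e d) : Ref e (c.sup d) :=
  ⟨Set.subset_inter h.1 h'.1, sup_le h.2 h'.2⟩
lemma Ref.sup_sup {c d c' d' : Chart AA} (h : Ref c c') (h' : Ref d d') :
    Ref (c.sup d) (c'.sup d') :=
  Ref.sup ((sup_left c d).trans h) ((sup_right c d).trans h')
lemma sup_comm' (c d : Chart AA) : Ref (c.sup d) (d.sup c) :=
  Ref.sup (sup_right c d) (sup_left c d)

lemma f_mem (c : Chart AA) : AA.f ∈ c.N := c.base_le AA.f_mem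

lemma mem_congr (c : Chart AA) {x z : ∀ y, O y} (h : EqV c.V x z) (hx : x ∈ c.N) : z ∈ c.N := by
  have : z - x ∈ c.N := c.zero _ (fun y hy => by simp [h y hy])
  simpa using add_mem hx this

/-- the localization at `s` -/
def Loc (c : Chart AA) (s : ∀ y, O y) : Subring (∀ y, O y) where
  carrier := {x | s ∈ c.N → ∃ p : ℕ, ∃ z ∈ c.N, EqV (c.V ∩ Dom s) (s ^ p * x) z}
  mul_mem' {a b} ha hb hs := by
    obtain ⟨p, z, hz, h⟩ := ha hs
    obtain ⟨q, w, hw, h'⟩ := hb hs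
    refine ⟨p + q, z * w, mul_mem hz hw, fun y hy => ?_⟩
    have := h y hy; have := h' y hy
    simp only [Pi.mul_apply, Pi.pow_apply] at *
    grind
  one_mem' _ := ⟨0, 1, one_mem _, fun y hy => by simp⟩
  add_mem' {a b} ha hb hs := by
    obtain ⟨p, z, hz, h⟩ := ha hs
    obtain ⟨q, w, hw, h'⟩ := hb hs
    refine ⟨p + q, s ^ q * z + s ^ p * w,
      add_mem (mul_mem (pow_mem hs _) hz) (mul_mem (pow_mem hs _) hw), fun y hy => ?_⟩
    have := h y hy; have := h' y hy
    simp only [Pi.mul_apply, Pi.pow_apply, Pi.add_apply] at *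
    grind
  zero_mem' _ := ⟨0, 0, zero_mem _, fun y hy => by simp⟩
  neg_mem' {a} ha hs := by
    obtain ⟨p, z, hz, h⟩ := ha hs
    exact ⟨p, -z, neg_mem hz, fun y hy => by have := h y hy; simp at *; grind⟩

lemma mem_Loc {c : Chart AA} {s : ∀ y, O y} (hs : s ∈ c.N) {x} :
    x ∈ c.Loc s ↔ ∃ p : ℕ, ∃ z ∈ c.N, EqV (c.V ∩ Dom s) (s ^ p * x) z :=
  ⟨fun h => h hs, fun h _ => h⟩

lemma le_Loc (c : Chart AA) (s : ∀ y, O y) : c.N ≤ c.Loc s :=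
  fun x hx _ => ⟨0, x, hx, fun y hy => by simp⟩

lemma Loc_mono {c d : Chart AA} (h : Ref d c) {s : ∀ y, O y} (hs : s ∈ c.N) :
    c.Loc s ≤ d.Loc s := by
  intro x hx _
  obtain ⟨p, z, hz, e⟩ := hx hs
  exact ⟨p, z, h.2 hz, e.mono (Set.inter_subset_inter_left _ h.1)⟩

lemma van_Loc (c : Chart AA) {s : ∀ y, O y} {x} (hx : Van (c.V ∩ Dom s) x) : x ∈ c.Loc s :=
  fun _ => ⟨0, 0, zero_mem _, fun y hy => by simp [hx y hy]⟩

/-- L0 in chart form: equality on the basic open gives equality after multiplication -/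
lemma L0 (c : Chart AA) {x z s : ∀ y, O y} (hx : x ∈ c.N) (hz : z ∈ c.N) (hs : s ∈ c.N)
    (h : EqV (c.V ∩ Dom s) x z) : ∃ p : ℕ, EqV c.V (s ^ p * x) (s ^ p * z) := by
  obtain ⟨p, hp⟩ := AA.L0 c.aff (c.le (sub_mem hx hz)) (c.le hs)
    (fun y hy => by simp [h y hy])
  exact ⟨p, fun y hy => by have := hp y hy; simp [mul_sub, sub_eq_zero] at *; exact this⟩

end Chart

open Chart

/-- Points (prime ideals) of the ring of functions. -/
structure IsPt (c : Chart AA) (P : Set (∀ y, O y)) : Prop where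
  van : ∀ x, Van c.V x → x ∈ P
  add : ∀ x ∈ c.N, ∀ z ∈ c.N, x ∈ P → z ∈ P → x + z ∈ P
  mul : ∀ x ∈ c.N, ∀ z ∈ c.N, z ∈ P → x * z ∈ P
  one : (1 : ∀ y, O y) ∉ P
  prime : ∀ x ∈ c.N, ∀ z ∈ c.N, x * z ∈ P → x ∈ P ∨ z ∈ P

lemma IsPt.mono {c d : Chart AA} {P} (h : IsPt d P) (hr : Ref d c) : IsPt c P where
  van x hx := h.van x (hx.mono hr.1)
  add x hx z hz := h.add x (hr.2 hx) z (hr.2 hz)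
  mul x hx z hz := h.mul x (hr.2 hx) z (hr.2 hz)
  one := h.one
  prime x hx z hz := h.prime x (hr.2 hx) z (hr.2 hz)

lemma IsPt.congr {c : Chart AA} {P} (h : IsPt c P) {x z} (hx : x ∈ c.N) (e : EqV c.V x z)
    (hxP : x ∈ P) : z ∈ P := by
  have hv : Van c.V (z - x) := fun y hy => by simp [e y hy]
  simpa using h.add x hx _ (c.zero _ hv) hxP (h.van _ hv)

lemma IsPt.pow {c : Chart AA} {P} (h : IsPt c P) {x} (hx : x ∈ c.N) {n : ℕ}
    (hP : x ^ n ∈ P) : x ∈ P := by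
  induction n with
  | zero => exact absurd (by simpa using hP) h.one
  | succ n ih =>
    rw [pow_succ] at hP
    exact (h.prime _ (pow_mem hx n) _ hx hP).elim ih id

lemma IsPt.not_mul {c : Chart AA} {P} (h : IsPt c P) {x z} (hx : x ∈ c.N) (hz : z ∈ c.N)
    (hxP : x ∉ P) (hzP : z ∉ P) : x * z ∉ P := fun hh => (h.prime x hx z hz hh).elim hxP hzP

/-- Separating: a subset that is an ideal containing the vanishing functions and in no point
contains `1`. -/
lemma exists_pt (c : Chart AA) (T : Set (∀ y, O y))
    (van : ∀ x, Van c.V x → x ∈ T)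
    (add : ∀ x ∈ c.N, ∀ z ∈ c.N, x ∈ T → z ∈ T → x + z ∈ T)
    (mul : ∀ x ∈ c.N, ∀ z ∈ c.N, z ∈ T → x * z ∈ T)
    (H : ∀ P, IsPt c P → (∀ x ∈ c.N, x ∈ T → x ∈ P) → False) : (1 : ∀ y, O y) ∈ T := by
  by_contra h1
  let I : Ideal c.N :=
    { carrier := {x | (x : ∀ y, O y) ∈ T}
      add_mem' := fun {a b} ha hb => add _ a.2 _ b.2 ha hb
      zero_mem' := van _ (fun y hy => rfl)
      smul_mem' := fun a b hb => mul _ a.2 _ b.2 hb }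
  have hI : I ≠ ⊤ := by
    rw [Ideal.ne_top_iff_one]; exact h1
  obtain ⟨M, hM, hle⟩ := Ideal.exists_le_maximal I hI
  refine H {x | ∃ h : x ∈ c.N, (⟨x, h⟩ : c.N) ∈ M} ⟨?_, ?_, ?_, ?_, ?_⟩ ?_
  · exact fun x hx => ⟨c.zero x hx, hle (van x hx)⟩
  · rintro x - z - ⟨hx, hx'⟩ ⟨hz, hz'⟩
    exact ⟨add_mem hx hz, M.add_mem hx' hz'⟩
  · rintro x hx z - ⟨hz, hz'⟩
    exact ⟨mul_mem hx hz, M.mul_mem_left ⟨x, hx⟩ hz'⟩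
  · rintro ⟨h, h'⟩
    exact hM.ne_top ((Ideal.eq_top_iff_one _).2 h')
  · rintro x hx z hz ⟨h, h'⟩
    rcases hM.isPrime.mem_or_mem (x := ⟨x, hx⟩) (y := ⟨z, hz⟩) h' with h | h
    · exact Or.inl ⟨hx, h⟩
    · exact Or.inr ⟨hz, h⟩
  · exact fun x hx hT => ⟨hx, hle hT⟩

/-- `c ∩ d` is open in `c`. -/
def Op (c d : Chart AA) : Prop :=
  ∀ P, IsPt (c.sup d) P → ∃ s ∈ c.N, s ∉ P ∧ c.V ∩ Dom s ⊆ d.V ∧ d.N ≤ c.Loc s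

lemma Op.bc {c d x : Chart AA} (h : Op c d) (hx : Ref x c) : Op x d := by
  intro P hP
  obtain ⟨s, hs, hsP, hV, hN⟩ := h P (hP.mono (hx.sup_sup (Ref.refl d)))
  exact ⟨s, hx.2 hs, hsP, (Set.inter_subset_inter_left _ hx.1).trans hV,
    hN.trans (Loc_mono hx hs)⟩

lemma Op.of_ref {c d : Chart AA} (h : Ref c d) : Op c d := fun P hP =>
  ⟨1, one_mem _, hP.one, Set.inter_subset_left.trans h.1, h.2.trans (le_Loc _ _)⟩

lemma Op.comp {c d e : Chart AA} (h : Op c d) (h' : Op (c.sup d) e) (hed : Ref e d) :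
    Op c e := by
  intro P hP
  have hPcd : IsPt (c.sup d) P := hP.mono ((Ref.refl c).sup_sup hed)
  obtain ⟨s, hs, hsP, hsV, hsN⟩ := h P hPcd
  have hPcde : IsPt ((c.sup d).sup e) P :=
    hP.mono (Ref.sup (Ref.sup (sup_left _ _) ((sup_right _ _).trans hed)) (sup_right _ _))
  obtain ⟨σ, hσ, hσP, hσV, hσN⟩ := h' P hPcde
  have hcdL : (c.sup d).N ≤ c.Loc s := sup_le (le_Loc _ _) hsN
  obtain ⟨p, z, hz, hpz⟩ := hcdL hσ hs
  have hs' : s ∈ (c.sup d).N := (sup_left c d).2 hs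
  have hz' : z ∈ (c.sup d).N := (sup_left c d).2 hz
  obtain ⟨m, hm⟩ := (c.sup d).L0 (x := s ^ p * σ) (z := z) (s := s)
    (mul_mem (pow_mem hs' _) hσ) hz' hs'
    (hpz.mono (Set.inter_subset_inter_left _ Set.inter_subset_left))
  refine ⟨s * (s ^ m * z), mul_mem hs (mul_mem (pow_mem hs _) hz), ?_, ?_, ?_⟩
  · refine hPcd.not_mul hs' (mul_mem (pow_mem hs' _) hz') hsP (fun hmem => ?_)
    have h1 : s ^ m * (s ^ p * σ) ∈ P :=
      hPcd.congr (mul_mem (pow_mem hs' _) hz') (fun y hy => (hm y hy).symm) hmem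
    exact hPcd.not_mul (pow_mem hs' _) (mul_mem (pow_mem hs' _) hσ) (fun h => hsP (hPcd.pow hs' h))
      (hPcd.not_mul (pow_mem hs' _) hσ (fun h => hsP (hPcd.pow hs' h)) hσP) h1
  · rintro y ⟨hy, hyD⟩
    simp only [Dom, Set.mem_ofPred_eq, Pi.mul_apply, Pi.pow_apply, IsUnit.mul_iff] at hyD
    have hyd := hsV ⟨hy, hyD.1⟩
    refine hσV ⟨⟨hy, hyd⟩, ?_⟩
    have := hpz y ⟨hy, hyD.1⟩
    have h2 := hyD.2.2
    rw [← this] at h2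
    simp only [Pi.mul_apply, Pi.pow_apply, IsUnit.mul_iff] at h2
    exact h2.2
  · intro x hx _
    obtain ⟨q, w, hw, hqw⟩ := hσN hx hσ
    obtain ⟨r, w', hw', hrw⟩ := hcdL hw hs
    refine ⟨q + r, s ^ (m * (q + r)) * s ^ q * z ^ r * s ^ (p * q) * w', by
      refine mul_mem (mul_mem (mul_mem (mul_mem ?_ ?_) ?_) ?_) hw' <;> apply pow_mem <;> assumption,
      ?_⟩
    rintro y ⟨hy, hyD⟩
    simp only [Dom, Set.mem_ofPred_eq, Pi.mul_apply, Pi.pow_apply, IsUnit.mul_iff] at hyD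
    have hyd := hsV ⟨hy, hyD.1⟩
    have e1 := hpz y ⟨hy, hyD.1⟩
    have hσy : y ∈ Dom σ := by
      have h2 := hyD.2.2
      rw [← e1] at h2
      simp only [Pi.mul_apply, Pi.pow_apply, IsUnit.mul_iff] at h2
      exact h2.2
    have e2 := hqw y ⟨⟨hy, hyd⟩, hσy⟩
    have e3 := hrw y ⟨hy, hyD.1⟩
    simp only [Pi.mul_apply, Pi.pow_apply] at *
    rw [← e3, ← e2, ← e1]
    ring

end Abstract
end Ngt

namespace Ngt

section Abstract

variable {Y : Type u} {O : Y → Type u} [∀ y, CommRing (O y)] {AA : Amb O}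

open Chart

/-- ideal-like span in a chart -/
def sp (c : Chart AA) (J : Set (∀ y, O y)) : Submodule c.N (∀ y, O y) :=
  Submodule.span c.N (J ∪ {x | Van c.V x})

lemma subset_sp (c : Chart AA) (J : Set (∀ y, O y)) : J ⊆ sp c J :=
  fun _ hx => Submodule.subset_span (Or.inl hx)

lemma van_sp (c : Chart AA) (J : Set (∀ y, O y)) {x} (hx : Van c.V x) : x ∈ sp c J :=
  Submodule.subset_span (Or.inr hx)

lemma mul_sp {c : Chart AA} {J : Set (∀ y, O y)} {n x} (hn : n ∈ c.N) (hx : x ∈ sp c J) :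
    n * x ∈ sp c J := (sp c J).smul_mem ⟨n, hn⟩ hx

lemma sp_induction {c : Chart AA} {J : Set (∀ y, O y)} {p : (∀ y, O y) → Prop}
    (mem : ∀ x ∈ J, p x) (van : ∀ x, Van c.V x → p x)
    (add : ∀ x z, p x → p z → p (x + z)) (mul : ∀ n ∈ c.N, ∀ x, p x → p (n * x))
    {x} (hx : x ∈ sp c J) : p x := by
  refine Submodule.span_induction (p := fun x _ => p x) ?_ (van 0 (fun y _ => rfl))
    (fun x z _ _ => add x z) (fun (n : c.N) x _ hx => mul n.1 n.2 x hx) hx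
  rintro x (h | h)
  · exact mem x h
  · exact van x h

lemma sp_mono {c d : Chart AA} {J J' : Set (∀ y, O y)} (h : Ref d c) (hJ : J ⊆ sp d J') {x}
    (hx : x ∈ sp c J) : x ∈ sp d J' :=
  sp_induction (p := fun x => x ∈ sp d J') (fun _ h => hJ h) (fun _ hv => van_sp _ _ (hv.mono h.1))
    (fun _ _ => add_mem) (fun _ hn _ => mul_sp (h.2 hn)) hx

lemma sp_mono' {c d : Chart AA} {J : Set (∀ y, O y)} (h : Ref d c) {x}
    (hx : x ∈ sp c J) : x ∈ sp d J := sp_mono h (subset_sp _ _) hx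

lemma sp_mem {c : Chart AA} {J : Set (∀ y, O y)} (hJ : J ⊆ c.N) {x} (hx : x ∈ sp c J) : x ∈ c.N :=
  sp_induction (p := fun x => x ∈ c.N) (fun _ h => hJ h) c.zero (fun _ _ => add_mem)
    (fun _ hn _ => mul_mem hn) hx

lemma sp_congr {c : Chart AA} {J : Set (∀ y, O y)} {x z} (e : EqV c.V x z) (hx : x ∈ sp c J) :
    z ∈ sp c J := by
  have : z - x ∈ sp c J := van_sp _ _ (fun y hy => by simp [e y hy])
  simpa using add_mem hx this

lemma sp_singleton {c : Chart AA} {a x : ∀ y, O y} :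
    x ∈ sp c {a} ↔ ∃ n ∈ c.N, EqV c.V x (n * a) := by
  constructor
  · intro hx
    refine sp_induction (p := fun x => ∃ n ∈ c.N, EqV c.V x (n * a)) ?_ ?_ ?_ ?_ hx
    · rintro _ rfl
      exact ⟨1, one_mem _, fun y _ => by simp⟩
    · exact fun x hx => ⟨0, zero_mem _, fun y hy => by simp [hx y hy]⟩
    · rintro x z ⟨n, hn, h⟩ ⟨m, hm, h'⟩
      exact ⟨n + m, add_mem hn hm, fun y hy => by simp [add_mul, h y hy, h' y hy]⟩
    · rintro n hn x ⟨m, hm, h⟩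
      exact ⟨n * m, mul_mem hn hm, fun y hy => by simp [mul_assoc, h y hy]⟩
  · rintro ⟨n, hn, h⟩
    exact sp_congr (fun y hy => (h y hy).symm) (mul_sp hn (subset_sp _ _ rfl))

lemma sp_loc {c d : Chart AA} {s : ∀ y, O y} {J : Set (∀ y, O y)} (hs : s ∈ c.N) (hV : c.V ∩ Dom s ⊆ d.V)
    (hN : d.N ≤ c.Loc s) {x} (hx : x ∈ sp d J) :
    ∃ m : ℕ, ∃ z ∈ sp c J, EqV (c.V ∩ Dom s) (s ^ m * x) z := by
  refine sp_induction (p := fun x => ∃ m : ℕ, ∃ z ∈ sp c J, EqV (c.V ∩ Dom s) (s ^ m * x) z)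
    ?_ ?_ ?_ ?_ hx
  · exact fun x hx => ⟨0, x, subset_sp _ _ hx, fun y _ => by simp⟩
  · exact fun x hx => ⟨0, 0, zero_mem _, fun y hy => by simp [hx y (hV hy)]⟩
  · rintro x w ⟨m, z, hz, h⟩ ⟨m', z', hz', h'⟩
    refine ⟨m + m', s ^ m' * z + s ^ m * z', add_mem (mul_sp (pow_mem hs _) hz)
      (mul_sp (pow_mem hs _) hz'), fun y hy => ?_⟩
    have := h y hy; have := h' y hy
    simp only [Pi.mul_apply, Pi.pow_apply, Pi.add_apply] at *
    grind
  · rintro n hn x ⟨m, z, hz, h⟩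
    obtain ⟨p, w, hw, h'⟩ := hN hn hs
    refine ⟨p + m, w * z, mul_sp hw hz, fun y hy => ?_⟩
    have := h y hy; have := h' y hy
    simp only [Pi.mul_apply, Pi.pow_apply, Pi.add_apply] at *
    grind

lemma sp_loc' {c d : Chart AA} {s : ∀ y, O y} {J : Set (∀ y, O y)} (hs : s ∈ c.N) (hV : c.V ∩ Dom s ⊆ d.V)
    (hN : d.N ≤ c.Loc s) (hJ : J ⊆ c.N) {x} (hxc : x ∈ c.N) (hx : x ∈ sp d J) :
    ∃ m : ℕ, s ^ m * x ∈ sp c J := by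
  obtain ⟨m, z, hz, h⟩ := sp_loc hs hV hN hx
  obtain ⟨p, hp⟩ := c.L0 (mul_mem (pow_mem hs m) hxc) (sp_mem hJ hz) hs h
  refine ⟨p + m, sp_congr (x := s ^ p * z) (fun y hy => ?_) (mul_sp (pow_mem hs _) hz)⟩
  rw [← hp y hy, pow_add, mul_assoc]

/-- `S` generates a principal ideal on `c`, with generator `a`. -/
def Prin (c : Chart AA) (S : Set (∀ y, O y)) (a : ∀ y, O y) : Prop :=
  S ⊆ sp c {a} ∧ a ∈ sp c S

lemma Prin.mono {c d : Chart AA} {S a} (h : Prin c S a) (hr : Ref d c) : Prin d S a :=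
  ⟨fun _ hx => sp_mono' hr (h.1 hx), sp_mono' hr h.2⟩

lemma Prin.trans {c : Chart AA} {S S' a} (h : Prin c S a) (h1 : S ⊆ sp c S') (h2 : S' ⊆ sp c S) :
    Prin c S' a :=
  ⟨fun _ hx => sp_mono (Ref.refl c) h.1 (h2 hx), sp_mono (Ref.refl c) h1 h.2⟩

/-- localization of a chart at the equation `f` -/
noncomputable def gen (c : Chart AA) : Chart AA where
  V := c.V
  aff := c.aff
  N :=
    { carrier := {x | ∃ n : ℕ, AA.f ^ n * x ∈ c.N}
      mul_mem' := by
        rintro a b ⟨n, hn⟩ ⟨m, hm⟩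
        exact ⟨n + m, by convert mul_mem hn hm using 1; ring⟩
      one_mem' := ⟨0, by simpa using one_mem _⟩
      add_mem' := by
        rintro a b ⟨n, hn⟩ ⟨m, hm⟩
        refine ⟨n + m, ?_⟩
        convert add_mem (mul_mem (pow_mem c.f_mem m) hn) (mul_mem (pow_mem c.f_mem n) hm) using 1
        ring
      zero_mem' := ⟨0, by simpa using zero_mem _⟩
      neg_mem' := by
        rintro a ⟨n, hn⟩
        exact ⟨n, by simpa using neg_mem hn⟩ }
  le := by
    rintro x ⟨n, hn⟩
    have h1 : pinv AA.f ∈ AA.Sec c.V :=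
      AA.inv_mem c.aff (c.le c.f_mem) (fun y _ => AA.f_unit y)
    have : pinv AA.f ^ n * (AA.f ^ n * x) ∈ AA.Sec c.V := mul_mem (pow_mem h1 n) (c.le hn)
    convert this using 1
    rw [← mul_assoc, ← mul_pow]
    have : pinv AA.f * AA.f = 1 := by
      funext y; rw [mul_comm]; exact mul_pinv (AA.f_unit y)
    simp [this]
  zero x hx := ⟨0, by simpa using c.zero x hx⟩
  base_le := fun x hx => ⟨0, by simpa using c.base_le hx⟩

lemma pinv_f_mul : pinv AA.f * AA.f = 1 := by
  funext y; rw [mul_comm]; exact mul_pinv (AA.f_unit y)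

lemma mem_gen {c : Chart AA} {x} : x ∈ (gen c).N ↔ ∃ n : ℕ, AA.f ^ n * x ∈ c.N := Iff.rfl

lemma gen_V (c : Chart AA) : (gen c).V = c.V := rfl

lemma gen_ref (c : Chart AA) : Ref (gen c) c := ⟨subset_rfl, fun x hx => ⟨0, by simpa using hx⟩⟩

lemma gen_mono {c d : Chart AA} (h : Ref d c) : Ref (gen d) (gen c) :=
  ⟨h.1, fun _ ⟨n, hn⟩ => ⟨n, h.2 hn⟩⟩

lemma pinv_f_mem (c : Chart AA) : pinv AA.f ∈ (gen c).N :=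
  ⟨1, by rw [pow_one, mul_comm, pinv_f_mul]; exact one_mem _⟩

lemma gen_sup_le (c d : Chart AA) : Ref (gen (c.sup d)) ((gen c).sup (gen d)) :=
  Ref.sup (gen_mono (sup_left _ _)) (gen_mono (sup_right _ _))

/-- blow up chart -/
noncomputable def blow (c : Chart AA) (S : Set (∀ y, O y)) (hS : S ⊆ c.N) (a : ∀ y, O y)
    (ha : a ∈ S) : Chart AA where
  V := c.V ∩ Dom a
  aff := AA.basic c.aff (c.le (hS ha))
  N := Subring.closure (c.N ∪ {x | Van (c.V ∩ Dom a) x} ∪ {x | ∃ s ∈ S, x = s * pinv a})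
  le := by
    have hle : c.N ≤ AA.Sec (c.V ∩ Dom a) := c.le.trans (AA.anti Set.inter_subset_left)
    rw [Subring.closure_le]
    rintro x ((h | h) | ⟨s, hs, rfl⟩)
    · exact hle h
    · exact AA.zero_mem h
    · exact mul_mem (hle (hS hs)) (AA.inv_mem (AA.basic c.aff (c.le (hS ha))) (hle (hS ha))
        Set.inter_subset_right)
  zero x hx := Subring.subset_closure (Or.inl (Or.inr hx))
  base_le := fun x hx => Subring.subset_closure (Or.inl (Or.inl (c.base_le hx)))

section blow
variable {c : Chart AA} {S : Set (∀ y, O y)} {hS : S ⊆ c.N} {a : ∀ y, O y} {ha : a ∈ S}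

lemma blow_ref : Ref (blow c S hS a ha) c :=
  ⟨Set.inter_subset_left, fun _ hx => Subring.subset_closure (Or.inl (Or.inl hx))⟩

lemma blow_mem {s} (hs : s ∈ S) : s * pinv a ∈ (blow c S hS a ha).N :=
  Subring.subset_closure (Or.inr ⟨s, hs, rfl⟩)

lemma blow_le {M : Subring (∀ y, O y)} (h1 : c.N ≤ M) (h2 : ∀ x, Van (c.V ∩ Dom a) x → x ∈ M)
    (h3 : ∀ s ∈ S, s * pinv a ∈ M) : (blow c S hS a ha).N ≤ M := by
  refine Subring.closure_le.2 ?_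
  rintro x ((h | h) | ⟨s, hs, rfl⟩)
  exacts [h1 h, h2 _ h, h3 _ hs]

lemma blow_prin : Prin (blow c S hS a ha) S a := by
  refine ⟨fun s hs => sp_singleton.2 ⟨_, blow_mem hs, fun y hy => ?_⟩, subset_sp _ _ ha⟩
  have := mul_pinv hy.2
  simp only [Pi.mul_apply]
  rw [mul_assoc, mul_comm (pinv a y), this, mul_one]

lemma blow_le_Loc {q : Chart AA} (hq : Ref q c) : (blow c S hS a ha).N ≤ q.Loc a := by
  refine blow_le (hq.2.trans (le_Loc _ _)) (fun x hx => van_Loc _ ?_) (fun s hs _ => ?_)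
  · exact hx.mono (Set.inter_subset_inter_left _ hq.1)
  · refine ⟨1, s, hq.2 (hS hs), fun y hy => ?_⟩
    have := mul_pinv hy.2
    simp only [Pi.mul_apply, pow_one]
    rw [mul_comm, mul_assoc, mul_comm (pinv a y), this, mul_one]

end blow

lemma Op.loc {q c : Chart AA} {S : Set (∀ y, O y)} {hS : S ⊆ c.N} {b : ∀ y, O y} {hb : b ∈ S}
    (hq : Ref q c) {L : ℕ} (hL : AA.f ^ L ∈ S) {κ} (hκ : Prin q S κ) :
    Op q (blow c S hS b hb) := by
  intro P hP
  have key : ∀ s ∈ S, ∃ n ∈ q.N, EqV q.V s (n * κ) := fun s hs => sp_singleton.1 (hκ.1 hs)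
  obtain ⟨u, hu, hbu⟩ := key b hb
  have hκu : ∀ y ∈ q.V, IsUnit (κ y) := by
    intro y hy
    obtain ⟨n, hn, h⟩ := key _ hL
    have h1 := (AA.f_unit y).pow L
    have := h y hy
    simp only [Pi.pow_apply, Pi.mul_apply] at this
    rw [this, IsUnit.mul_iff] at h1
    exact h1.2
  have hDb : q.V ∩ Dom u ⊆ Dom b := by
    rintro y ⟨hy, hyu⟩
    have := hbu y hy
    simp only [Dom, Set.mem_ofPred_eq, Pi.mul_apply] at *
    rw [this]; exact hyu.mul (hκu y hy)
  refine ⟨u, hu, ?_, ?_, ?_⟩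
  · have ht : κ * pinv b ∈ (q.sup (blow c S hS b hb)).N := by
      refine sp_induction (p := fun x => x * pinv b ∈ (q.sup (blow c S hS b hb)).N) ?_ ?_ ?_ ?_ hκ.2
      · exact fun x hx => (sup_right _ _).2 (blow_mem hx)
      · exact fun x hx => (sup_left _ _).2 (q.zero _ (fun y hy => by simp [hx y hy]))
      · intro x z hx hz
        rw [add_mul]; exact add_mem hx hz
      · intro n hn x hx
        rw [mul_assoc]; exact mul_mem ((sup_left _ _).2 hn) hx
    intro hmem
    apply hP.one
    refine hP.congr (mul_mem ht ((sup_left _ _).2 hu)) (fun y hy => ?_)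
      (hP.mul _ ht _ ((sup_left _ _).2 hu) hmem)
    have h1 := hbu y hy.1
    have h2 := mul_pinv hy.2.2
    simp only [Pi.mul_apply, Pi.one_apply] at *
    rw [← h2, h1]; ring
  · exact fun y hy => ⟨hq.1 hy.1, hDb hy⟩
  · refine blow_le (hq.2.trans (le_Loc _ _)) (fun x hx => van_Loc _ (hx.mono ?_)) (fun s hs _ => ?_)
    · exact fun y hy => ⟨hq.1 hy.1, hDb hy⟩
    · obtain ⟨n, hn, h⟩ := key s hs
      refine ⟨1, n, hn, fun y hy => ?_⟩
      have h2 := mul_pinv (hDb hy)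
      have h1 := hbu y hy.1
      have h3 := h y hy.1
      simp only [Pi.mul_apply, pow_one] at *
      have e : κ y * (u y * pinv b y) = 1 := by rw [← h2, h1]; ring
      rw [h3]; linear_combination n y * e

/-- generic openness -/
def GOp (c d : Chart AA) : Prop := Op (gen c) (gen d)

lemma GOp.bc {c d x : Chart AA} (h : GOp c d) (hx : Ref x c) : GOp x d := Op.bc h (gen_mono hx)

lemma GOp.blow {c d : Chart AA} (h : GOp c d) {S : Set (∀ y, O y)} {hS : S ⊆ d.N} {b : ∀ y, O y}
    {hb : b ∈ S} {L : ℕ} (hL : AA.f ^ L ∈ S) : GOp c (blow d S hS b hb) := by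
  refine Op.comp h ?_ (gen_mono blow_ref)
  have hq : Ref ((gen c).sup (gen d)) d := (sup_right _ _).trans (gen_ref d)
  have hbq : b ∈ ((gen c).sup (gen d)).N := hq.2 (hS hb)
  intro P hP
  refine ⟨b, hbq, ?_, ?_, ?_⟩
  · intro hmem
    have hfb : AA.f ^ L * pinv b ∈ (((gen c).sup (gen d)).sup (gen (Ngt.blow d S hS b hb))).N :=
      (sup_right _ _).2 ((gen_ref _).2 (blow_mem hL))
    have hpf : pinv AA.f ^ L ∈ (((gen c).sup (gen d)).sup (gen (Ngt.blow d S hS b hb))).N :=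
      (sup_right _ _).2 (pow_mem (pinv_f_mem _) _)
    apply hP.one
    refine hP.congr (mul_mem (mul_mem hpf hfb) ((sup_left _ _).2 hbq)) (fun y hy => ?_)
      (hP.mul _ (mul_mem hpf hfb) _ ((sup_left _ _).2 hbq) hmem)
    have h2 := mul_pinv hy.2.2
    have h3 := congrFun (pinv_f_mul (AA := AA)) y
    have h4 : pinv AA.f y ^ L * AA.f y ^ L = 1 := by
      rw [← mul_pow]; simp only [Pi.mul_apply, Pi.one_apply] at h3; rw [h3, one_pow]
    simp only [Pi.mul_apply, Pi.one_apply, Pi.pow_apply] at *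
    linear_combination h2 + b y * pinv b y * h4
  · exact fun y hy => ⟨hy.1.2, hy.2⟩
  · rintro x ⟨n, hn⟩
    have h1 := blow_le_Loc hq hn
    have h2 : pinv AA.f ^ n ∈ ((gen c).sup (gen d)).Loc b :=
      le_Loc _ _ ((sup_right _ _).2 (pow_mem (pinv_f_mem _) _))
    have := mul_mem h2 h1
    rwa [← mul_assoc, ← mul_pow, pinv_f_mul, one_pow, one_mul] at this

/-- finite generation -/
def FG (c : Chart AA) : Prop := ∃ G : Finset (∀ y, O y),
  (G : Set (∀ y, O y)) ⊆ c.N ∧ ∀ M : Subring (∀ y, O y), AA.base ≤ M → (∀ x ∈ G, x ∈ M) →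
    (∀ x, Van c.V x → x ∈ M) → c.N ≤ M

lemma FG.blow {c : Chart AA} (h : FG c) {S : Set (∀ y, O y)} {hS : S ⊆ c.N} (hfin : S.Finite)
    {a : ∀ y, O y} {ha : a ∈ S} : FG (blow c S hS a ha) := by
  classical
  obtain ⟨G, hG, hM⟩ := h
  refine ⟨G ∪ hfin.toFinset.image (fun s => s * pinv a), ?_, ?_⟩
  · intro x hx
    simp only [Finset.coe_union, Finset.coe_image, Set.Finite.coe_toFinset, Set.mem_union,
      Finset.mem_coe, Set.mem_image] at hx
    rcases hx with hx | ⟨s, hs, rfl⟩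
    · exact blow_ref.2 (hG hx)
    · exact blow_mem hs
  · intro M h1 h2 h3
    refine blow_le (hM M h1 (fun x hx => h2 x (by simp [hx])) (fun x hx => h3 x ?_)) h3 ?_
    · exact hx.mono Set.inter_subset_left
    · exact fun s hs => h2 _ (by
        simp only [Finset.mem_union, Finset.mem_image, Set.Finite.mem_toFinset]
        exact Or.inr ⟨s, hs, rfl⟩)

/-- noetherianity -/
lemma FG.noeth {c : Chart AA} (h : FG c) (K : Set (∀ y, O y)) (hK : K ⊆ c.N) :
    ∃ S : Set (∀ y, O y), S.Finite ∧ S ⊆ K ∧ K ⊆ sp c S := by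
  classical
  obtain ⟨G, hG, hM⟩ := h
  haveI := AA.base_noeth
  let I : Ideal c.N :=
    { carrier := {x | Van c.V (x : ∀ y, O y)}
      add_mem' := fun {a b} ha hb y hy => by simp [ha y hy, hb y hy]
      zero_mem' := fun y hy => rfl
      smul_mem' := fun a b hb y hy => by simp [hb y hy] }
  let φ0 : MvPolynomial G AA.base →+* c.N :=
    MvPolynomial.eval₂Hom (Subring.inclusion c.base_le) (fun g => ⟨g.1, hG g.2⟩)
  let φ := (Ideal.Quotient.mk I).comp φ0
  have hφ : Function.Surjective φ := by
    intro z
    obtain ⟨⟨x, hx⟩, rfl⟩ := Ideal.Quotient.mk_surjective z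
    have : c.N ≤ ((φ.range.comap (Ideal.Quotient.mk I)).map c.N.subtype) := by
      refine hM _ ?_ ?_ ?_
      · intro b hb
        refine ⟨⟨b, c.base_le hb⟩, ⟨MvPolynomial.C ⟨b, hb⟩, ?_⟩, rfl⟩
        simp only [φ, φ0, RingHom.comp_apply, MvPolynomial.coe_eval₂Hom, MvPolynomial.eval₂_C]
        rfl
      · intro g hg
        refine ⟨⟨g, hG hg⟩, ⟨MvPolynomial.X ⟨g, hg⟩, ?_⟩, rfl⟩
        simp only [φ, φ0, RingHom.comp_apply, MvPolynomial.coe_eval₂Hom, MvPolynomial.eval₂_X]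
      · intro g hg
        refine ⟨⟨g, c.zero g hg⟩, ⟨0, ?_⟩, rfl⟩
        rw [map_zero, eq_comm]
        exact Ideal.Quotient.eq_zero_iff_mem.2 hg
    obtain ⟨⟨x', hx'⟩, ⟨p, hp⟩, h⟩ := this hx
    have : x' = x := h
    subst this
    exact ⟨p, hp⟩
  haveI : IsNoetherianRing (c.N ⧸ I) := isNoetherianRing_of_surjective _ _ φ hφ
  let K' : Set (c.N ⧸ I) := (Ideal.Quotient.mk I) '' {x | (x : ∀ y, O y) ∈ K}
  obtain ⟨t, ht, hts⟩ := (Submodule.fg_span_iff_fg_span_finset_subset K').1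
    (IsNoetherian.noetherian (Submodule.span (c.N ⧸ I) K'))
  have hlift : ∀ z ∈ t, ∃ x ∈ K, ∃ h : x ∈ c.N, Ideal.Quotient.mk I ⟨x, h⟩ = z := by
    intro z hz
    obtain ⟨x, hx, rfl⟩ := ht hz
    exact ⟨x, hx, x.2, rfl⟩
  choose! g hg1 hg2 hg3 using hlift
  refine ⟨g '' t, t.finite_toSet.image g, ?_, ?_⟩
  · rintro _ ⟨z, hz, rfl⟩
    exact hg1 z hz
  · intro x hx
    have hx' : Ideal.Quotient.mk I ⟨x, hK hx⟩ ∈ Submodule.span (c.N ⧸ I) (t : Set (c.N ⧸ I)) := by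
      rw [← hts]
      exact Submodule.subset_span ⟨⟨x, hK hx⟩, hx, rfl⟩
    have : ∀ w ∈ Submodule.span (c.N ⧸ I) (t : Set (c.N ⧸ I)), ∀ v : c.N,
        Ideal.Quotient.mk I v = w → (v : ∀ y, O y) ∈ sp c (g '' t) := by
      intro w hw
      refine Submodule.span_induction (p := fun w _ => ∀ v : c.N,
        Ideal.Quotient.mk I v = w → (v : ∀ y, O y) ∈ sp c (g '' t)) ?_ ?_ ?_ ?_ hw
      · intro z hz v hv
        rw [← hg3 z hz, Ideal.Quotient.eq] at hv
        have := add_mem (van_sp c (g '' t) hv) (subset_sp c (g '' t) ⟨z, hz, rfl⟩)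
        simpa using this
      · intro v hv
        exact van_sp _ _ (Ideal.Quotient.eq_zero_iff_mem.1 hv)
      · intro w1 w2 _ _ h1 h2 v hv
        obtain ⟨v1, rfl⟩ := Ideal.Quotient.mk_surjective w1
        obtain ⟨v2, rfl⟩ := Ideal.Quotient.mk_surjective w2
        rw [← map_add, Ideal.Quotient.eq] at hv
        have := add_mem (van_sp c (g '' t) hv) (add_mem (h1 v1 rfl) (h2 v2 rfl))
        simpa using this
      · intro n w1 _ h1 v hv
        obtain ⟨v1, rfl⟩ := Ideal.Quotient.mk_surjective w1
        obtain ⟨n, rfl⟩ := Ideal.Quotient.mk_surjective n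
        rw [smul_eq_mul, ← map_mul, Ideal.Quotient.eq] at hv
        have := add_mem (van_sp c (g '' t) hv) (mul_sp n.2 (h1 v1 rfl))
        simpa using this
    exact this _ hx' _ rfl

end Abstract
end Ngt

namespace Ngt

section Abstract

variable {Y : Type u} {O : Y → Type u} [∀ y, CommRing (O y)] {AA : Amb O}

open Chart

lemma isUnit_of_mul {V : Set Y} {a n : ∀ y, O y} {L : ℕ} (h : EqV V (AA.f ^ L) (n * a)) :
    V ⊆ Dom a := by
  intro y hy
  have h1 := (AA.f_unit y).pow L
  have := h y hy
  simp only [Pi.pow_apply, Pi.mul_apply] at this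
  rw [this, IsUnit.mul_iff] at h1
  exact h1.2

lemma isUnit_of_sp {c : Chart AA} {a : ∀ y, O y} {L : ℕ} (h : AA.f ^ L ∈ sp c {a}) :
    c.V ⊆ Dom a := by
  obtain ⟨n, _, hn⟩ := sp_singleton.1 h
  exact isUnit_of_mul hn

/-- the set of good denominators -/
def Den (c d : Chart AA) (G : Finset (∀ y, O y)) : Set (∀ y, O y) :=
  {b | b ∈ c.N ∧ c.V ∩ Dom b ⊆ d.V ∧ ∀ x ∈ G, ∃ h ∈ c.N, EqV (c.V ∩ d.V) h (b * x)}

lemma exists_uniform {c : Chart AA} {s : ∀ y, O y} (hs : s ∈ c.N) (W : Set Y)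
    (G : Finset (∀ y, O y))
    (H : ∀ x ∈ G, ∃ p : ℕ, ∃ z ∈ c.N, EqV W z (s ^ p * x)) :
    ∃ p : ℕ, ∀ x ∈ G, ∃ z ∈ c.N, EqV W z (s ^ p * x) := by
  classical
  choose! p hp using H
  refine ⟨∑ x ∈ G, p x, fun x hx => ?_⟩
  obtain ⟨z, hz, h⟩ := hp x hx
  have hle : p x ≤ ∑ x ∈ G, p x := Finset.single_le_sum (fun _ _ => Nat.zero_le _) hx
  obtain ⟨k, hk⟩ := Nat.exists_eq_add_of_le hle
  refine ⟨s ^ k * z, mul_mem (pow_mem hs _) hz, fun y hy => ?_⟩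
  rw [hk]
  have := h y hy
  simp only [Pi.mul_apply, Pi.pow_apply] at *
  rw [this, pow_add]; ring

lemma pre1 {c d : Chart AA} (h : GOp c d) (G : Finset (∀ y, O y))
    (hG : (G : Set (∀ y, O y)) ⊆ d.N) :
    (1 : ∀ y, O y) ∈ sp ((gen c).sup (gen d)) (Den c d G) := by
  refine exists_pt ((gen c).sup (gen d)) (sp ((gen c).sup (gen d)) (Den c d G))
    (fun x hx => van_sp _ _ hx) (fun x _ z _ => add_mem) (fun x hx z _ => mul_sp hx) ?_
  intro P hP hle
  obtain ⟨s, hs, hsP, hV, hN⟩ := h P hP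
  have hs' : s ∈ ((gen c).sup (gen d)).N := (sup_left _ _).2 hs
  have H : ∀ x ∈ G, ∃ p : ℕ, ∃ z ∈ (gen c).N, EqV (c.V ∩ d.V) z (s ^ p * x) := by
    intro x hx
    have hxd : x ∈ (gen d).N := (gen_ref d).2 (hG hx)
    obtain ⟨p, z, hz, e⟩ := hN hxd hs
    obtain ⟨q, hq⟩ := ((gen c).sup (gen d)).L0 (x := s ^ p * x) (z := z) (s := s)
      (mul_mem (pow_mem hs' _) ((sup_right _ _).2 hxd)) ((sup_left _ _).2 hz) hs'
      (e.mono (Set.inter_subset_inter_left _ Set.inter_subset_left))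
    refine ⟨q + p, s ^ q * z, mul_mem (pow_mem hs _) hz, fun y hy => ?_⟩
    rw [← hq y hy, pow_add, mul_assoc]
  obtain ⟨p, hp⟩ := exists_uniform hs _ G H
  have H2 : ∀ x ∈ G, ∃ n : ℕ, ∃ z ∈ c.N, EqV (c.V ∩ d.V) z (AA.f ^ n * (s ^ (p + 1) * x)) := by
    intro x hx
    obtain ⟨z, hz, e⟩ := hp x hx
    obtain ⟨n, hn⟩ := mul_mem hs hz
    refine ⟨n, _, hn, fun y hy => ?_⟩
    have := e y hy
    simp only [Pi.mul_apply, Pi.pow_apply] at *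
    rw [this]; ring
  obtain ⟨n, hn⟩ : ∃ n : ℕ, ∀ x ∈ G, ∃ z ∈ c.N,
      EqV (c.V ∩ d.V) z (AA.f ^ n * (s ^ (p + 1) * x)) := by
    classical
    obtain ⟨n, hn⟩ := exists_uniform c.f_mem (c.V ∩ d.V) (G.image (fun x => s ^ (p + 1) * x)) (by
      intro x hx
      obtain ⟨x', hx', rfl⟩ := Finset.mem_image.1 hx
      exact H2 x' hx')
    exact ⟨n, fun x hx => hn _ (Finset.mem_image_of_mem _ hx)⟩
  obtain ⟨m, hm⟩ := pow_mem hs (p + 1)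
  have hb : AA.f ^ (m + n) * s ^ (p + 1) ∈ Den c d G := by
    refine ⟨?_, ?_, ?_⟩
    · rw [add_comm, pow_add, mul_assoc]
      exact mul_mem (pow_mem c.f_mem _) hm
    · rintro y ⟨hy, hyD⟩
      simp only [Dom, Set.mem_ofPred_eq, Pi.mul_apply, Pi.pow_apply, IsUnit.mul_iff] at hyD
      exact hV ⟨hy, (isUnit_pow_iff (by omega)).1 hyD.2⟩
    · intro x hx
      obtain ⟨z, hz, e⟩ := hn x hx
      refine ⟨AA.f ^ m * z, mul_mem (pow_mem c.f_mem _) hz, fun y hy => ?_⟩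
      have := e y hy
      simp only [Pi.mul_apply, Pi.pow_apply] at *
      rw [this, pow_add]; ring
  have hmem : s ^ (p + 1) ∈ sp ((gen c).sup (gen d)) (Den c d G) := by
    have := mul_sp (c := (gen c).sup (gen d)) ((sup_left _ _).2 (pow_mem (pinv_f_mem c) (m + n)))
      (subset_sp ((gen c).sup (gen d)) _ hb)
    rwa [← mul_assoc, ← mul_pow, pinv_f_mul, one_pow, one_mul] at this
  exact hsP (hP.pow hs' (hle _ (pow_mem hs' _) hmem))

lemma sp_finite {c : Chart AA} {J : Set (∀ y, O y)} {x} (hx : x ∈ sp c J) :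
    ∃ J0 ⊆ J, J0.Finite ∧ x ∈ sp c J0 := by
  refine sp_induction (p := fun x => ∃ J0 ⊆ J, J0.Finite ∧ x ∈ sp c J0) ?_ ?_ ?_ ?_ hx
  · exact fun x hx => ⟨{x}, by simpa using hx, Set.finite_singleton x, subset_sp _ _ rfl⟩
  · exact fun x hx => ⟨∅, by simp, Set.finite_empty, van_sp _ _ hx⟩
  · rintro x z ⟨A, hA, hAf, hxA⟩ ⟨B, hB, hBf, hzB⟩
    exact ⟨A ∪ B, Set.union_subset hA hB, hAf.union hBf, add_mem
      (sp_mono (Ref.refl c) (Set.subset_union_left.trans (subset_sp _ _)) hxA)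
      (sp_mono (Ref.refl c) (Set.subset_union_right.trans (subset_sp _ _)) hzB)⟩
  · rintro n hn x ⟨A, hA, hAf, hxA⟩
    exact ⟨A, hA, hAf, mul_sp hn hxA⟩

lemma sp_gen {c d : Chart AA} {J : Set (∀ y, O y)} {x}
    (hx : x ∈ sp ((gen c).sup (gen d)) J) : ∃ n : ℕ, AA.f ^ n * x ∈ sp (c.sup d) J := by
  refine sp_induction (p := fun x => ∃ n : ℕ, AA.f ^ n * x ∈ sp (c.sup d) J) ?_ ?_ ?_ ?_ hx
  · exact fun x hx => ⟨0, by simpa using subset_sp _ _ hx⟩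
  · exact fun x hx => ⟨0, by simpa using van_sp (c.sup d) J hx⟩
  · rintro x z ⟨n, hn⟩ ⟨m, hm⟩
    refine ⟨n + m, ?_⟩
    have := add_mem (mul_sp (pow_mem (c.sup d).f_mem m) hn) (mul_sp (pow_mem (c.sup d).f_mem n) hm)
    convert this using 1; ring
  · rintro n hn x ⟨m, hm⟩
    obtain ⟨k, hk⟩ := (gen_sup_le c d).2 hn
    refine ⟨k + m, ?_⟩
    convert mul_sp hk hm using 1; ring

/-- Preparation: finitely many local centers making `c` open along `d`. -/
lemma pre {c d : Chart AA} (h : GOp c d) (hd : FG d) :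
    ∃ SS : Set (Set (∀ y, O y)), SS.Finite ∧
      (∀ S ∈ SS, S.Finite ∧ S ⊆ c.N ∧ ∃ L : ℕ, AA.f ^ L ∈ S) ∧
      ∀ e, Ref e c → (∀ S ∈ SS, ∃ g ∈ S, S ⊆ sp e {g}) → Op e d := by
  classical
  obtain ⟨G, hG, hM⟩ := hd
  obtain ⟨E, hE, hEf, h1⟩ := sp_finite (pre1 h G hG)
  obtain ⟨n, hn⟩ := sp_gen h1
  rw [mul_one] at hn
  have hh : ∀ b ∈ E, ∀ x ∈ G, ∃ h ∈ c.N, EqV (c.V ∩ d.V) h (b * x) := fun b hb => (hE hb).2.2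
  choose! H hHN hH using hh
  let S : (∀ y, O y) → Set (∀ y, O y) := fun b => {b} ∪ (H b '' G) ∪ {AA.f ^ (n + 1)}
  have hbS : ∀ b, b ∈ S b := fun b => Or.inl (Or.inl rfl)
  have hHS : ∀ b, ∀ x ∈ G, H b x ∈ S b := fun b x hx => Or.inl (Or.inr ⟨x, hx, rfl⟩)
  have hfS : ∀ b, AA.f ^ (n + 1) ∈ S b := fun b => Or.inr rfl
  refine ⟨S '' E, hEf.image _, ?_, ?_⟩
  · rintro _ ⟨b, hb, rfl⟩
    refine ⟨((Set.finite_singleton _).union (G.finite_toSet.image _)).union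
      (Set.finite_singleton _), ?_, n + 1, hfS b⟩
    rintro x ((rfl | ⟨x, hx, rfl⟩) | rfl)
    · exact (hE hb).1
    · exact hHN b hb x hx
    · exact pow_mem c.f_mem _
  · intro e hec hgen
    by_cases hall : ∀ b ∈ E, S b ⊆ sp e {AA.f ^ (n + 1)}
    · intro P hP
      have hfr : ∃ r ∈ (e.sup d).N, EqV (e.sup d).V (AA.f ^ n) (r * AA.f ^ (n + 1)) := by
        refine sp_singleton.1 (sp_mono (hec.sup_sup (Ref.refl d)) (fun b hb => ?_) hn)
        exact sp_mono' (sup_left _ _) (hall b hb (hbS b))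
      obtain ⟨r, hr, hrf⟩ := hfr
      have hfm := (e.sup d).f_mem
      have hfP : AA.f ∉ P := by
        intro hfP
        apply hP.one
        refine hP.congr (mul_mem hr hfm) (fun y hy => ?_) (hP.mul r hr _ hfm hfP)
        have h1 := hrf y hy
        have h2 := (AA.f_unit y).pow n
        simp only [Pi.mul_apply, Pi.pow_apply, Pi.one_apply] at *
        apply h2.mul_left_cancel
        rw [mul_one]
        conv_rhs => rw [h1]
        ring
      have : ∃ b ∈ E, b ∉ P := by
        by_contra! hcon
        refine hfP (hP.pow (n := n) hfm ?_)
        have hn' := sp_mono' (hec.sup_sup (Ref.refl d)) hn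
        have hEN : E ⊆ (e.sup d).N := fun b hb => (sup_left _ _).2 (hec.2 (hE hb).1)
        have : ∀ {x}, x ∈ sp (e.sup d) E → x ∈ (e.sup d).N ∧ x ∈ P := by
          intro x hx
          refine sp_induction (p := fun x => x ∈ (e.sup d).N ∧ x ∈ P) ?_ ?_ ?_ ?_ hx
          · exact fun x hx => ⟨hEN hx, hcon x hx⟩
          · exact fun x hx => ⟨(e.sup d).zero x hx, hP.van x hx⟩
          · exact fun x z h h' => ⟨add_mem h.1 h'.1, hP.add _ h.1 _ h'.1 h.2 h'.2⟩
          · exact fun n hn x h => ⟨mul_mem hn h.1, hP.mul _ hn _ h.1 h.2⟩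
        exact (this hn').2
      obtain ⟨b, hb, hbP⟩ := this
      have hV : e.V ∩ Dom b ⊆ d.V := (Set.inter_subset_inter_left _ hec.1).trans (hE hb).2.1
      refine ⟨b, hec.2 (hE hb).1, hbP, hV, hM _ ?_ ?_ ?_⟩
      · exact e.base_le.trans (le_Loc _ _)
      · intro x hx _
        refine ⟨1, H b x, hec.2 (hHN b hb x hx), fun y hy => ?_⟩
        rw [hH b hb x hx y ⟨hec.1 hy.1, hV hy⟩, pow_one]
      · exact fun x hx => van_Loc _ (hx.mono hV)
    · push Not at hall
      obtain ⟨b, hb, hbn⟩ := hall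
      obtain ⟨g, hg, hgs⟩ := hgen _ ⟨b, hb, rfl⟩
      have hgu : e.V ⊆ Dom g := isUnit_of_sp (hgs (hfS b))
      rcases hg with (rfl | ⟨x, hx, rfl⟩) | rfl
      · have hV : e.V ⊆ d.V := fun y hy => (hE hb).2.1 ⟨hec.1 hy, hgu hy⟩
        refine Op.of_ref ⟨hV, hM _ e.base_le (fun x hx => ?_) (fun x hx => e.zero _ (hx.mono hV))⟩
        obtain ⟨m, hm, hme⟩ := sp_singleton.1 (hgs (hHS g x hx))
        refine e.mem_congr (x := m) (fun y hy => ?_) hm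
        have h1 := hme y hy
        have h2 := hH g hb x hx y ⟨hec.1 hy, hV hy⟩
        rw [h2] at h1
        simp only [Pi.mul_apply] at h1
        rw [mul_comm] at h1
        exact ((hgu hy : IsUnit (g y)).mul_right_cancel h1).symm
      · obtain ⟨m, hm, hme⟩ := sp_singleton.1 (hgs (hbS b))
        have hDb : e.V ∩ Dom m ⊆ Dom b := by
          rintro y ⟨hy, hym⟩
          have := hme y hy
          simp only [Dom, Set.mem_ofPred_eq, Pi.mul_apply] at *
          rw [this]; exact hym.mul (hgu hy)
        have hV : e.V ∩ Dom m ⊆ d.V := fun y hy => (hE hb).2.1 ⟨hec.1 hy.1, hDb hy⟩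
        intro P hP
        refine ⟨m, hm, ?_, hV, hM _ (e.base_le.trans (le_Loc _ _)) ?_ ?_⟩
        · intro hmP
          have hxd : x ∈ (e.sup d).N := (sup_right _ _).2 (hG hx)
          have hmd : m ∈ (e.sup d).N := (sup_left _ _).2 hm
          apply hP.one
          refine hP.congr (mul_mem hxd hmd) (fun y hy => ?_) (hP.mul x hxd _ hmd hmP)
          have h1 := hme y hy.1
          have h2 := hH b hb x hx y ⟨hec.1 hy.1, hy.2⟩
          have h3 : IsUnit (H b x y) := hgu hy.1
          simp only [Pi.mul_apply, Pi.one_apply] at *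
          apply h3.mul_left_cancel
          rw [mul_one]
          linear_combination (-(x y)) * h1 - h2
        · intro x' hx' _
          obtain ⟨m', hm', hme'⟩ := sp_singleton.1 (hgs (hHS b x' hx'))
          refine ⟨1, m', hm', fun y hy => ?_⟩
          have h1 := hme y hy.1
          have h2 := hH b hb x' hx' y ⟨hec.1 hy.1, hV hy⟩
          have h4 := hme' y hy.1
          have h3 : IsUnit (H b x y) := hgu hy.1
          simp only [Pi.mul_apply, pow_one] at *
          apply h3.mul_left_cancel
          linear_combination (-(x' y)) * h1 - h2 + h4
        · exact fun x hx => van_Loc _ (hx.mono hV)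
      · exact absurd hgs hbn

/-- ideal of functions with prescribed restrictions -/
def KK {δ : Type u} (D : δ → Chart AA) (J : δ → Set (∀ y, O y)) (r : δ → Prop) (c : Chart AA) :
    Set (∀ y, O y) := {x | x ∈ c.N ∧ ∀ d, r d → x ∈ sp (c.sup (D d)) (J d)}

lemma ext_claim {δ : Type u} [Finite δ] {D : δ → Chart AA} {J : δ → Set (∀ y, O y)} {r : δ → Prop}
    (hJ : ∀ d, J d ⊆ (D d).N) {c z : Chart AA} (h : Op c z) {x} (hxz : x ∈ z.N)
    (hx : ∀ d, r d → x ∈ sp ((c.sup z).sup (D d)) (J d)) :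
    x ∈ sp (c.sup z) (KK D J r c) := by
  suffices (1 : ∀ y, O y) ∈ {t | t * x ∈ sp (c.sup z) (KK D J r c)} by simpa using this
  refine exists_pt (c.sup z) _ ?_ ?_ ?_ ?_
  · exact fun t ht => van_sp _ _ (fun y hy => by simp [ht y hy])
  · intro t _ t' _ ht ht'
    simp only [Set.mem_ofPred_eq, add_mul] at *
    exact add_mem ht ht'
  · intro t ht t' _ ht'
    simp only [Set.mem_ofPred_eq, mul_assoc] at *
    exact mul_sp ht ht'
  intro P hP hT
  obtain ⟨s, hs, hsP, hV, hN⟩ := h P hP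
  obtain ⟨p, w, hw, hpw⟩ := hN hxz hs
  have hs' : s ∈ (c.sup z).N := (sup_left _ _).2 hs
  have H : ∀ d, r d → ∃ m : ℕ, s ^ m * w ∈ sp (c.sup (D d)) (J d) := by
    intro d hd
    have hsd : s ∈ (c.sup (D d)).N := (sup_left _ _).2 hs
    obtain ⟨m, v, hv, e⟩ := sp_loc (c := c.sup (D d)) (d := (c.sup z).sup (D d)) (s := s)
      hsd (by
        rintro y ⟨⟨hy, hyd⟩, hys⟩
        exact ⟨⟨hy, hV ⟨hy, hys⟩⟩, hyd⟩)
      (sup_le (sup_le ((sup_left c (D d)).2.trans (le_Loc _ _))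
        (hN.trans (Loc_mono (sup_left _ _) hs))) ((sup_right c (D d)).2.trans (le_Loc _ _)))
      (hx d hd)
    have hvN := sp_mem ((hJ d).trans (sup_right c (D d)).2) hv
    obtain ⟨q, hq⟩ := (c.sup (D d)).L0 (x := s ^ m * w) (z := s ^ p * v) (s := s)
      (mul_mem (pow_mem hsd _) ((sup_left _ _).2 hw)) (mul_mem (pow_mem hsd _) hvN) hsd (by
        intro y hy
        have h1 := hpw y ⟨hy.1.1, hy.2⟩
        have h2 := e y hy
        simp only [Pi.mul_apply, Pi.pow_apply] at *
        rw [← h1, ← h2]; ring)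
    refine ⟨q + m, sp_congr (x := s ^ q * (s ^ p * v)) (fun y hy => ?_)
      (mul_sp (pow_mem hsd _) (mul_sp (pow_mem hsd _) hv))⟩
    rw [← hq y hy, pow_add, mul_assoc]
  choose! m hm using H
  cases nonempty_fintype δ
  obtain ⟨M, hM⟩ : ∃ M : ℕ, s ^ M * w ∈ KK D J r c := by
    refine ⟨∑ d, m d, mul_mem (pow_mem hs _) hw, fun d hd => ?_⟩
    have hle : m d ≤ ∑ d, m d := Finset.single_le_sum (fun _ _ => Nat.zero_le _) (Finset.mem_univ d)
    obtain ⟨k, hk⟩ := Nat.exists_eq_add_of_le hle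
    rw [hk, add_comm, pow_add, mul_assoc]
    exact mul_sp ((sup_left _ _).2 (pow_mem hs _)) (hm d hd)
  obtain ⟨q, hq⟩ := (c.sup z).L0 (x := s ^ p * x) (z := w) (s := s)
    (mul_mem (pow_mem hs' _) ((sup_right _ _).2 hxz)) ((sup_left _ _).2 hw) hs'
    (hpw.mono (Set.inter_subset_inter_left _ Set.inter_subset_left))
  refine hsP (hP.pow hs' (n := M + q + p) (hT _ (pow_mem hs' _) ?_))
  refine sp_congr (x := s ^ q * (s ^ M * w)) (fun y hy => ?_)
    (mul_sp (pow_mem hs' _) (subset_sp _ _ hM))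
  have := hq y hy
  simp only [Pi.mul_apply, Pi.pow_apply] at *
  linear_combination (-(s y ^ M)) * this

section Fam

variable {ι : Type u}

/-- Admissible centers on a family of charts. -/
structure Cen (X : ι → Chart AA) (S : ι → Set (∀ y, O y)) : Prop where
  fin : ∀ i, (S i).Finite
  sub : ∀ i, S i ⊆ (X i).N
  pow : ∀ i, ∃ L : ℕ, AA.f ^ L ∈ S i

/-- The blown up family. -/
noncomputable def Bl (X : ι → Chart AA) (S : ι → Set (∀ y, O y)) (h : Cen X S) (e : Σ i, S i) :
    Chart AA :=
  blow (X e.1) (S e.1) (h.sub e.1) e.2.1 e.2.2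

/-- Centers compatible within labels. -/
structure Fam (X : ι → Chart AA) (lab : ι → ℕ) (S : ι → Set (∀ y, O y)) : Prop extends Cen X S where
  comp : ∀ i j, lab i = lab j → S i ⊆ sp ((X i).sup (X j)) (S j)

lemma Bl_ref {X : ι → Chart AA} {S : ι → Set (∀ y, O y)} {h : Cen X S} (e : Σ i, S i) :
    Ref (Bl X S h e) (X e.1) := blow_ref

lemma Bl_prin {X : ι → Chart AA} {S : ι → Set (∀ y, O y)} {h : Cen X S} (e : Σ i, S i) :
    Prin (Bl X S h e) (S e.1) e.2.1 := blow_prin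

lemma Op.Bl {q : Chart AA} {X : ι → Chart AA} {S : ι → Set (∀ y, O y)} {h : Cen X S} (e : Σ i, S i)
    (hq : Op q (X e.1)) {κ} (hκ : Prin (q.sup (X e.1)) (S e.1) κ) : Op q (Bl X S h e) := by
  obtain ⟨L, hL⟩ := h.pow e.1
  exact hq.comp (Op.loc (sup_right _ _) hL hκ) blow_ref

lemma Fam.Bl_op {X : ι → Chart AA} {lab : ι → ℕ} {S : ι → Set (∀ y, O y)} (h : Fam X lab S)
    (hop : ∀ i j, lab i = lab j → Op (X i) (X j)) (e e' : Σ i, S i) (he : lab e.1 = lab e'.1) :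
    Op (Bl X S h.toCen e) (Bl X S h.toCen e') := by
  refine Op.Bl e' ((hop _ _ he).bc (Bl_ref e)) (κ := e.2.1) ?_
  refine ((Bl_prin e).mono (sup_left _ _)).trans ?_ ?_
  · exact fun x hx => sp_mono' ((Bl_ref e).sup_sup (Ref.refl _)) (h.comp _ _ he hx)
  · exact fun x hx => sp_mono' (((Bl_ref e).sup_sup (Ref.refl _)).trans (sup_comm' _ _))
      (h.comp _ _ he.symm hx)

lemma ext_fam [Finite ι] {X : ι → Chart AA} {lab : ι → ℕ} (hX : ∀ i, FG (X i))
    (hop : ∀ i j, lab i = lab j → Op (X i) (X j))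
    {δ : Type u} [Finite δ] {D : δ → Chart AA} {J : δ → Set (∀ y, O y)} (r : ℕ → δ → Prop)
    (hJ : ∀ d, J d ⊆ (D d).N) (hJf : ∀ d, ∃ L : ℕ, AA.f ^ L ∈ J d) :
    ∃ S : ι → Set (∀ y, O y), Fam X lab S ∧
      (∀ i d, r (lab i) d → S i ⊆ sp ((X i).sup (D d)) (J d)) ∧
      (∀ i d, r (lab i) d → Op (X i) (D d) →
        (∀ d', r (lab i) d' → J d ⊆ sp ((D d).sup (D d')) (J d')) →
        J d ⊆ sp ((X i).sup (D d)) (S i)) := by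
  classical
  choose L hL using hJf
  cases nonempty_fintype δ
  have hKf : ∀ i, AA.f ^ (∑ d, L d) ∈ KK D J (r (lab i)) (X i) := by
    refine fun i => ⟨pow_mem (X i).f_mem _, fun d _ => ?_⟩
    have hle : L d ≤ ∑ d, L d := Finset.single_le_sum (fun _ _ => Nat.zero_le _) (Finset.mem_univ d)
    obtain ⟨k, hk⟩ := Nat.exists_eq_add_of_le hle
    rw [hk, add_comm, pow_add]
    exact mul_sp (pow_mem (Chart.f_mem _) _) (subset_sp _ _ (hL d))
  have hN : ∀ i, ∃ S : Set (∀ y, O y), S.Finite ∧ S ⊆ KK D J (r (lab i)) (X i) ∧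
      KK D J (r (lab i)) (X i) ⊆ sp (X i) S := fun i => (hX i).noeth _ (fun x hx => hx.1)
  choose S hSf hSK hKS using hN
  have hK' : ∀ i, ∀ {x}, x ∈ insert (AA.f ^ (∑ d, L d)) (S i) → x ∈ KK D J (r (lab i)) (X i) := by
    rintro i x (rfl | h)
    · exact hKf i
    · exact hSK i h
  have hKS' : ∀ i, KK D J (r (lab i)) (X i) ⊆ sp (X i) (insert (AA.f ^ (∑ d, L d)) (S i)) :=
    fun i x hx => sp_mono (Ref.refl _) ((Set.subset_insert _ _).trans (subset_sp _ _)) (hKS i hx)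
  refine ⟨fun i => insert (AA.f ^ (∑ d, L d)) (S i), ⟨⟨fun i => (hSf i).insert _, ?_,
    fun i => ⟨_, Set.mem_insert _ _⟩⟩, ?_⟩, ?_, ?_⟩
  · exact fun i x hx => (hK' i hx).1
  · intro i j hij x hx
    have hx' := hK' i hx
    have := ext_claim (r := r (lab j)) hJ (hop j i hij.symm) hx'.1 (fun d hd =>
      sp_mono' ((sup_right _ _).sup_sup (Ref.refl _)) (hx'.2 d (hij ▸ hd)))
    refine sp_mono (sup_comm' _ _) (fun x hx => ?_) this
    exact sp_mono' (sup_right _ _) (hKS' j hx)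
  · exact fun i d hd x hx => (hK' i hx).2 d hd
  · intro i d hd hop' hcomp x hx
    have := ext_claim (r := r (lab i)) hJ hop' (hJ d hx) (fun d' hd' =>
      sp_mono' ((sup_right _ _).sup_sup (Ref.refl _)) (hcomp d' hd' hx))
    refine sp_mono (Ref.refl _) (fun x hx => ?_) this
    exact sp_mono' (sup_left _ _) (hKS' i hx)

lemma ext_local [Finite ι] {X : ι → Chart AA} {lab : ι → ℕ} (hX : ∀ i, FG (X i))
    (hop : ∀ i j, lab i = lab j → Op (X i) (X j)) (i0 : ι) (S0 : Set (∀ y, O y))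
    (hf : S0.Finite) (hs : S0 ⊆ (X i0).N) (hp : ∃ L : ℕ, AA.f ^ L ∈ S0) :
    ∃ S : ι → Set (∀ y, O y), Fam X lab S ∧ S i0 = S0 := by
  classical
  obtain ⟨S, hS, h1, h2⟩ := ext_fam hX hop (δ := PUnit) (D := fun _ => X i0) (J := fun _ => S0)
    (fun l _ => l = lab i0) (fun _ => hs) (fun _ => hp)
  refine ⟨Function.update S i0 S0, ⟨⟨?_, ?_, ?_⟩, ?_⟩, by simp⟩
  · intro i
    by_cases hi : i = i0
    · subst hi; simpa using hf
    · simpa [hi] using hS.fin i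
  · intro i
    by_cases hi : i = i0
    · subst hi; simpa using hs
    · simpa [hi] using hS.sub i
  · intro i
    by_cases hi : i = i0
    · subst hi; simpa using hp
    · simpa [hi] using hS.pow i
  · intro i j hij
    by_cases hi : i = i0
    · subst hi
      by_cases hj : j = i
      · subst hj; exact subset_sp _ _
      · simp only [Function.update_self, Function.update_of_ne hj]
        have := h2 j PUnit.unit hij.symm (hop _ _ hij.symm) (fun _ _ => subset_sp _ _)
        exact fun x hx => sp_mono' (sup_comm' _ _) (this hx)
    · by_cases hj : j = i0
      · subst hj
        simp only [Function.update_self, Function.update_of_ne hi]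
        exact h1 i PUnit.unit hij
      · simp only [Function.update_of_ne hj, Function.update_of_ne hi]
        exact hS.comp i j hij

/-- product of families -/
def prodFam (S T : ι → Set (∀ y, O y)) (i : ι) : Set (∀ y, O y) :=
  Set.image2 (fun a b => a * b) (S i) (T i)

lemma Fam.prod {X : ι → Chart AA} {lab : ι → ℕ} {S T : ι → Set (∀ y, O y)} (hS : Fam X lab S)
    (hT : Fam X lab T) : Fam X lab (prodFam S T) := by
  refine ⟨⟨fun i => (hS.fin i).image2 _ (hT.fin i), ?_, ?_⟩, ?_⟩
  · rintro i _ ⟨a, ha, b, hb, rfl⟩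
    exact mul_mem (hS.sub i ha) (hT.sub i hb)
  · intro i
    obtain ⟨L, hL⟩ := hS.pow i
    obtain ⟨M, hM⟩ := hT.pow i
    exact ⟨L + M, ⟨_, hL, _, hM, (pow_add _ _ _).symm⟩⟩
  · rintro i j hij _ ⟨a, ha, b, hb, rfl⟩
    have h1 := hS.comp i j hij ha
    have h2 := hT.comp i j hij hb
    refine sp_induction (p := fun a => a * b ∈ sp ((X i).sup (X j)) (prodFam S T j))
      (fun a ha => ?_) ?_ ?_ ?_ h1
    · refine sp_induction (p := fun b => a * b ∈ sp ((X i).sup (X j)) (prodFam S T j))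
        (fun b hb => ?_) ?_ ?_ ?_ h2
      · exact subset_sp _ _ ⟨a, ha, b, hb, rfl⟩
      · exact fun x hx => van_sp _ _ (fun y hy => by simp [hx y hy])
      · intro x z hx hz; rw [mul_add]; exact add_mem hx hz
      · intro n hn x hx; rw [mul_left_comm]; exact mul_sp hn hx
    · exact fun x hx => van_sp _ _ (fun y hy => by simp [hx y hy])
    · intro x z hx hz; rw [add_mul]; exact add_mem hx hz
    · intro n hn x hx; rw [mul_assoc]; exact mul_sp hn hx

lemma prin_factor {e : Chart AA} {S T : Set (∀ y, O y)} {a b : ∀ y, O y} (ha : a ∈ S) (hb : b ∈ T)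
    {L M : ℕ} (hS : AA.f ^ L ∈ S) (hT : AA.f ^ M ∈ T)
    (h : Set.image2 (fun a b => a * b) S T ⊆ sp e {a * b}) : S ⊆ sp e {a} ∧ T ⊆ sp e {b} := by
  have h0 : e.V ⊆ Dom (a * b) := by
    refine isUnit_of_sp (L := L + M) (h ⟨_, hS, _, hT, (pow_add _ _ _).symm⟩)
  have hu : ∀ y ∈ e.V, IsUnit (a y) ∧ IsUnit (b y) := by
    intro y hy
    have := h0 hy
    simpa only [Dom, Set.mem_ofPred_eq, Pi.mul_apply, IsUnit.mul_iff] using this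
  constructor
  · intro s hs
    obtain ⟨n, hn, hne⟩ := sp_singleton.1 (h ⟨s, hs, b, hb, rfl⟩)
    refine sp_singleton.2 ⟨n, hn, fun y hy => ?_⟩
    have h1 := hne y hy
    apply (hu y hy).2.mul_right_cancel
    simp only [Pi.mul_apply] at *
    rw [h1]; ring
  · intro s hs
    obtain ⟨n, hn, hne⟩ := sp_singleton.1 (h ⟨a, ha, s, hs, rfl⟩)
    refine sp_singleton.2 ⟨n, hn, fun y hy => ?_⟩
    have h1 := hne y hy
    apply (hu y hy).1.mul_left_cancel
    simp only [Pi.mul_apply] at *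
    rw [h1]; ring

lemma exists_fam [Finite ι] {X : ι → Chart AA} {lab : ι → ℕ} (hX : ∀ i, FG (X i))
    (hop : ∀ i j, lab i = lab j → Op (X i) (X j)) (TT0 : Set (ι × Set (∀ y, O y)))
    (hTT0 : TT0.Finite)
    (H : ∀ t ∈ TT0, t.2.Finite ∧ t.2 ⊆ (X t.1).N ∧ ∃ L : ℕ, AA.f ^ L ∈ t.2) :
    ∃ I : ι → Set (∀ y, O y), Fam X lab I ∧ ∀ t ∈ TT0, ∀ e : Chart AA, ∀ a ∈ I t.1,
      I t.1 ⊆ sp e {a} → ∃ g ∈ t.2, t.2 ⊆ sp e {g} := by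
  induction TT0, hTT0 using Set.Finite.induction_on with
  | empty =>
    refine ⟨fun _ => {1}, ⟨⟨fun _ => Set.finite_singleton _, ?_, fun _ => ⟨0, by simp⟩⟩, ?_⟩, ?_⟩
    · rintro i _ rfl; exact one_mem _
    · exact fun i j _ => subset_sp _ _
    · simp
  | @insert t s ht _ ih =>
    obtain ⟨I, hI, hI'⟩ := ih (fun t' ht' => H t' (Or.inr ht'))
    obtain ⟨h1, h2, h3⟩ := H t (Or.inl rfl)
    obtain ⟨S, hS, hSt⟩ := ext_local hX hop t.1 t.2 h1 h2 h3
    refine ⟨prodFam I S, hI.prod hS, ?_⟩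
    rintro t' ht' e _ ⟨a, ha, b, hb, rfl⟩ hprin
    obtain ⟨L, hL⟩ := hI.pow t'.1
    obtain ⟨M, hM⟩ := hS.pow t'.1
    obtain ⟨p1, p2⟩ := prin_factor ha hb hL hM hprin
    rcases ht' with rfl | ht'
    · rw [hSt] at hb p2
      exact ⟨b, hb, p2⟩
    · exact hI' t' ht' e a ha p1

/-- The merging step -/
lemma merge [Finite ι] {X : ι → Chart AA} {lab : ι → ℕ} (hX : ∀ i, FG (X i))
    (hG : ∀ i j, GOp (X i) (X j))
    (hop : ∀ i j, lab i = lab j → Op (X i) (X j)) (p q : ℕ) (hpq : p ≠ q) :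
    ∃ (I : ι → Set (∀ y, O y)) (hI : Cen X I) (K : (Σ i, I i) → Set (∀ y, O y))
      (hK : Cen (Bl X I hI) K), ∀ g g' : Σ e, K e,
      (lab g.1.1 = lab g'.1.1 ∨ (lab g.1.1 = p ∧ lab g'.1.1 = q) ∨
        (lab g.1.1 = q ∧ lab g'.1.1 = p)) →
      Op (Bl (Bl X I hI) K hK g) (Bl (Bl X I hI) K hK g') := by
  have hpre : ∀ i j, ∃ SS : Set (Set (∀ y, O y)), SS.Finite ∧
      (∀ S ∈ SS, S.Finite ∧ S ⊆ (X i).N ∧ ∃ L : ℕ, AA.f ^ L ∈ S) ∧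
      ∀ e, Ref e (X i) → (∀ S ∈ SS, ∃ g ∈ S, S ⊆ sp e {g}) → Op e (X j) :=
    fun i j => pre (hG i j) (hX j)
  choose SS h1 h2 h3 using hpre
  obtain ⟨I, hI, hI'⟩ := exists_fam hX hop (⋃ i, ⋃ j, (fun S => (i, S)) '' SS i j)
    (Set.finite_iUnion (fun i => Set.finite_iUnion (fun j => (h1 i j).image _))) (by
      rintro t ht
      simp only [Set.mem_iUnion, Set.mem_image] at ht
      obtain ⟨i, j, S, hS, rfl⟩ := ht
      exact h2 i j S hS)
  have hIop : ∀ (e : Σ i, I i) j, Op (Bl X I hI.toCen e) (X j) := by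
    intro e j
    refine h3 e.1 j _ (Bl_ref e) (fun S hS => ?_)
    refine hI' (e.1, S) ?_ _ e.2.1 e.2.2 (Bl_prin e).1
    simp only [Set.mem_iUnion, Set.mem_image]
    exact ⟨e.1, j, S, hS, rfl⟩
  have : ∀ i, Finite (I i) := fun i => (hI.fin i).to_subtype
  let r : ℕ → ι → Prop := fun l j => (l = p ∧ lab j = q) ∨ (l = q ∧ lab j = p)
  have hop1 : ∀ e e' : Σ i, I i, lab e.1 = lab e'.1 →
    Op (Bl X I hI.toCen e) (Bl X I hI.toCen e') := hI.Bl_op hop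
  obtain ⟨K, hK, hK1, hK2⟩ := ext_fam (X := Bl X I hI.toCen) (lab := fun e => lab e.1)
    (fun e => (hX e.1).blow (hI.fin e.1)) hop1 (D := X) (J := I) r hI.sub hI.pow
  refine ⟨I, hI.toCen, K, hK.toCen, ?_⟩
  intro g g' hgg
  rcases hgg with hgg | hgg
  · exact hK.Bl_op hop1 g g' hgg
  have hr : ∀ l j j', r l j → r l j' → lab j = lab j' := by
    rintro l j j' (⟨h1, h2⟩ | ⟨h1, h2⟩) (⟨h3, h4⟩ | ⟨h3, h4⟩)
    · rw [h2, h4]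
    · exact absurd (h1.symm.trans h3) hpq
    · exact absurd (h3.symm.trans h1) hpq
    · rw [h2, h4]
  have hK3 : ∀ e j, r (lab e.1) j → I j ⊆ sp ((Bl X I hI.toCen e).sup (X j)) (K e) :=
    fun e j hj => hK2 e j hj (hIop e j) (fun j' hj' => hI.comp _ _ (hr _ _ _ hj hj'))
  have hrg : r (lab g.1.1) g'.1.1 := hgg
  have hrg' : r (lab g'.1.1) g.1.1 := by
    rcases hgg with ⟨h, h'⟩ | ⟨h, h'⟩
    · exact Or.inr ⟨h', h⟩
    · exact Or.inl ⟨h', h⟩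
  have s1 : Op (Bl _ K hK.toCen g) (Bl X I hI.toCen g'.1) := by
    refine Op.Bl g'.1 ((hIop g.1 g'.1.1).bc (Bl_ref g)) (κ := g.2.1) ?_
    refine ((Bl_prin g).mono (sup_left _ _)).trans ?_ ?_
    · exact fun x hx => sp_mono' ((Bl_ref g).sup_sup (Ref.refl _)) (hK1 g.1 g'.1.1 hrg hx)
    · exact fun x hx => sp_mono' ((Bl_ref g).sup_sup (Ref.refl _)) (hK3 g.1 g'.1.1 hrg hx)
  refine Op.Bl g' s1 (κ := g.1.2.1) ?_
  have href : Ref ((Bl _ K hK.toCen g).sup (Bl X I hI.toCen g'.1))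
      ((Bl X I hI.toCen g'.1).sup (X g.1.1)) :=
    Ref.sup (sup_right _ _) ((sup_left _ _).trans ((Bl_ref g).trans (Bl_ref g.1)))
  refine (((Bl_prin g.1).mono ((sup_left _ _).trans (Bl_ref g))).trans ?_ ?_)
  · exact fun x hx => sp_mono' href (hK3 g'.1 g.1.1 hrg' hx)
  · exact fun x hx => sp_mono' href (hK1 g'.1 g.1.1 hrg' hx)

end Fam

end Abstract
end Ngt

namespace Ngt

section Abstract

variable {Y : Type u} {O : Y → Type u} [∀ y, CommRing (O y)] {AA : Amb O}

open Chart

/-- maps killing functions vanishing on `V` -/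
def Kil {N : Subring (∀ y, O y)} (V : Set Y) {R : Type u} [CommRing R] (φ : N →+* R) : Prop :=
  ∀ x : N, Van V (x : ∀ y, O y) → φ x = 0

lemma Kil.eq {N : Subring (∀ y, O y)} {V : Set Y} {R : Type u} [CommRing R] {φ : N →+* R}
    (h : Kil V φ) {x z : N} (e : EqV V (x : ∀ y, O y) z) : φ x = φ z := by
  rw [← sub_eq_zero, ← map_sub]
  exact h _ (fun y hy => by simp [e y hy])

lemma Kil.pow_mul {N : Subring (∀ y, O y)} {V : Set Y} {R : Type u} [CommRing R] {φ : N →+* R}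
    (h : Kil V φ) {a x z : ∀ y, O y} {p : ℕ} (ha : a ∈ N) (hx : x ∈ N) (hz : z ∈ N)
    (e : EqV V (a ^ p * x) z) : φ ⟨a, ha⟩ ^ p * φ ⟨x, hx⟩ = φ ⟨z, hz⟩ := by
  rw [← map_pow, ← map_mul]
  exact h.eq e

lemma exthom (c : Chart AA) {a : ∀ y, O y} (ha : a ∈ c.N) {R : Type u} [CommRing R]
    (φ : c.N →+* R) (hφ : Kil c.V φ) (hu : IsUnit (φ ⟨a, ha⟩)) :
    ∃ ψ : c.Loc a →+* R, (∀ x : c.N, ψ ⟨x, le_Loc _ _ x.2⟩ = φ x) ∧ Kil (c.V ∩ Dom a) ψ := by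
  have cons : ∀ (x : ∀ y, O y) (p q : ℕ) (z w : c.N), EqV (c.V ∩ Dom a) (a ^ p * x) z →
      EqV (c.V ∩ Dom a) (a ^ q * x) w →
      φ ⟨a, ha⟩ ^ q * φ z = φ ⟨a, ha⟩ ^ p * φ w := by
    intro x p q z w h1 h2
    obtain ⟨r, hr⟩ := c.L0 (x := a ^ q * z) (z := a ^ p * w) (s := a)
      (mul_mem (pow_mem ha _) z.2) (mul_mem (pow_mem ha _) w.2) ha (by
        intro y hy
        have := h1 y hy; have := h2 y hy
        simp only [Pi.mul_apply, Pi.pow_apply] at *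
        grind)
    have := hφ.eq (x := ⟨a, ha⟩ ^ r * (⟨a, ha⟩ ^ q * z)) (z := ⟨a, ha⟩ ^ r * (⟨a, ha⟩ ^ p * w)) hr
    simp only [map_mul, map_pow] at this
    exact (hu.pow r).mul_left_cancel this
  have key : ∀ x : c.Loc a, ∃ t : R, ∀ (p : ℕ) (z : c.N),
      EqV (c.V ∩ Dom a) (a ^ p * x.1) z → φ z = φ ⟨a, ha⟩ ^ p * t := by
    intro x
    obtain ⟨q, w, hw, h⟩ := x.2 ha
    obtain ⟨u, hu'⟩ := hu.pow q
    refine ⟨↑u⁻¹ * φ ⟨w, hw⟩, fun p z hz => ?_⟩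
    have := cons x.1 p q z ⟨w, hw⟩ hz h
    rw [← hu'] at this
    have h3 : (↑u⁻¹ : R) * u = 1 := by simp
    calc φ z = ↑u⁻¹ * (u * φ z) := by rw [← mul_assoc, h3, one_mul]
      _ = _ := by rw [this]; ring
  choose ψ hψ using key
  have uniq : ∀ (x : c.Loc a) (p : ℕ) (z : c.N) (t : R), EqV (c.V ∩ Dom a) (a ^ p * x.1) z →
      φ z = φ ⟨a, ha⟩ ^ p * t → ψ x = t := by
    intro x p z t h h'
    have := hψ x p z h
    rw [h'] at this
    exact ((hu.pow p).mul_left_cancel this).symm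
  refine ⟨{ toFun := ψ, map_one' := ?_, map_mul' := ?_, map_zero' := ?_, map_add' := ?_ }, ?_, ?_⟩
  · exact uniq 1 0 1 1 (fun y hy => by simp) (by simp)
  · intro x x'
    obtain ⟨p, z, hz, h⟩ := x.2 ha
    obtain ⟨q, w, hw, h'⟩ := x'.2 ha
    refine uniq _ (p + q) (⟨z, hz⟩ * ⟨w, hw⟩) _ (fun y hy => ?_) ?_
    · have := h y hy; have := h' y hy
      simp only [Pi.mul_apply, Pi.pow_apply, Subring.coe_mul] at *
      grind
    · rw [map_mul, hψ x p ⟨z, hz⟩ h, hψ x' q ⟨w, hw⟩ h']; ring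
  · exact uniq 0 0 0 0 (fun y hy => by simp) (by simp)
  · intro x x'
    obtain ⟨p, z, hz, h⟩ := x.2 ha
    obtain ⟨q, w, hw, h'⟩ := x'.2 ha
    refine uniq _ (p + q) (⟨a, ha⟩ ^ q * ⟨z, hz⟩ + ⟨a, ha⟩ ^ p * ⟨w, hw⟩) _ (fun y hy => ?_) ?_
    · have := h y hy; have := h' y hy
      simp only [Pi.mul_apply, Pi.pow_apply, Subring.coe_mul, Subring.coe_add, Subring.coe_pow,
        Pi.add_apply] at *
      grind
    · rw [map_add, map_mul, map_mul, map_pow, map_pow, hψ x p ⟨z, hz⟩ h, hψ x' q ⟨w, hw⟩ h']; ring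
  · exact fun x => uniq _ 0 x _ (fun y hy => by simp) (by simp)
  · exact fun x hx => uniq _ 0 0 _ (fun y hy => by simp [hx y hy]) (by simp)

lemma Loc_mul {c : Chart AA} {a b : ∀ y, O y} (ha : a ∈ c.N) (hb : b ∈ c.N) :
    c.Loc a ≤ c.Loc (a * b) := by
  intro x hx _
  obtain ⟨p, z, hz, h⟩ := hx ha
  refine ⟨p, b ^ p * z, mul_mem (pow_mem hb _) hz, fun y hy => ?_⟩
  have hD := hy.2
  simp only [Dom, Set.mem_ofPred_eq, Pi.mul_apply, IsUnit.mul_iff] at hD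
  have := h y ⟨hy.1, hD.1⟩
  simp only [Pi.mul_apply, Pi.pow_apply] at *
  rw [← this]; ring

/-- Coverage of generic valued points. -/
def Cov {ι : Type u} (X : ι → Chart AA) : Prop :=
  ∀ (i : ι) (K : Type u) [Field K] (OO : ValuationSubring K) (φ : (X i).N →+* K),
    Kil (X i).V φ → φ ⟨AA.f, (X i).f_mem⟩ ≠ 0 →
    (∀ x (hx : x ∈ AA.base), φ ⟨x, (X i).base_le hx⟩ ∈ OO) →
    ∃ (j : ι) (χ : ((X i).sup (X j)).N →+* K), Kil ((X i).sup (X j)).V χ ∧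
      (∀ x : (X i).N, χ ⟨x, (sup_left _ _).2 x.2⟩ = φ x) ∧
      (∀ x : (X j).N, χ ⟨x, (sup_right _ _).2 x.2⟩ ∈ OO)

lemma blow_ne {c : Chart AA} {S : Set (∀ y, O y)} {hS : S ⊆ c.N} {a : ∀ y, O y} {ha : a ∈ S}
    {L : ℕ} (hL : AA.f ^ L ∈ S) {R : Type u} [CommRing R] {φ : (blow c S hS a ha).N →+* R}
    (hφ : Kil (blow c S hS a ha).V φ) (hf : IsUnit (φ ⟨AA.f, (blow c S hS a ha).f_mem⟩)) :
    IsUnit (φ ⟨a, blow_ref.2 (hS ha)⟩) := by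
  have h := hφ.eq (x := ⟨AA.f, (blow c S hS a ha).f_mem⟩ ^ L)
    (z := ⟨a, blow_ref.2 (hS ha)⟩ * ⟨_, blow_mem hL⟩) (by
      intro y hy
      have := mul_pinv hy.2
      simp only [Subring.coe_mul, Subring.coe_pow, Pi.mul_apply, Pi.pow_apply]
      linear_combination (-(AA.f y ^ L)) * this)
  rw [map_pow, map_mul] at h
  have := hf.pow L
  rw [h, IsUnit.mul_iff] at this
  exact this.1

lemma blow_agree {c : Chart AA} {S : Set (∀ y, O y)} {hS : S ⊆ c.N} {a : ∀ y, O y} {ha : a ∈ S}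
    {R : Type u} [CommRing R] {φ : (blow c S hS a ha).N →+* R} {M : Subring (∀ y, O y)}
    {ψ : M →+* R} {W : Set Y} (hφ : Kil (blow c S hS a ha).V φ) (hψ : Kil W ψ)
    (hW : W ⊆ c.V ∩ Dom a)
    (hu : IsUnit (φ ⟨a, blow_ref.2 (hS ha)⟩)) (hM : (blow c S hS a ha).N ≤ M)
    (hag : ∀ x (hx : x ∈ c.N), ψ ⟨x, hM (blow_ref.2 hx)⟩ = φ ⟨x, blow_ref.2 hx⟩) (x)
    (hx : x ∈ (blow c S hS a ha).N) : ψ ⟨x, hM hx⟩ = φ ⟨x, hx⟩ := by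
  obtain ⟨p, z, hz, h⟩ := blow_le_Loc (Ref.refl c) hx (hS ha)
  have h1 := hφ.pow_mul (blow_ref.2 (hS ha)) hx (blow_ref.2 hz) h
  have h2 := hψ.pow_mul (hM (blow_ref.2 (hS ha))) (hM hx) (hM (blow_ref.2 hz)) (h.mono hW)
  rw [hag a (hS ha), hag z hz, ← h1] at h2
  exact (hu.pow p).mul_left_cancel h2

lemma Cov.Bl {ι : Type u} {X : ι → Chart AA} (h : Cov X) {S : ι → Set (∀ y, O y)} (hS : Cen X S) :
    Cov (Bl X S hS) := by
  intro e K _ OO φ hφ hf hb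
  obtain ⟨i, a, ha⟩ := e
  have hai : a ∈ (X i).N := hS.sub i ha
  obtain ⟨L, hL⟩ := hS.pow i
  have hre : Ref (Ngt.Bl X S hS ⟨i, a, ha⟩) (X i) := blow_ref
  have hu : IsUnit (φ ⟨a, hre.2 hai⟩) := blow_ne hL hφ (isUnit_iff_ne_zero.2 hf)
  obtain ⟨j, χ, hχ, hχi, hχj⟩ := h i K OO (φ.comp (Subring.inclusion hre.2))
    (fun x hx => hφ _ (hx.mono hre.1)) hf (fun x hx => hb x hx)
  have hχ1 : ∀ x (hx : x ∈ (X i).N), χ ⟨x, (sup_left _ _).2 hx⟩ = φ ⟨x, hre.2 hx⟩ :=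
    fun x hx => hχi ⟨x, hx⟩
  obtain ⟨L', hL'⟩ := hS.pow j
  have hbm : ∃ b, ∃ hb : b ∈ S j, ∀ s (hs : s ∈ S j),
      OO.valuation (χ ⟨s, (sup_right _ _).2 (hS.sub j hs)⟩) ≤
        OO.valuation (χ ⟨b, (sup_right _ _).2 (hS.sub j hb)⟩) := by
    have hfin : Finite (S j) := (hS.fin j).to_subtype
    have hne : Nonempty (S j) := ⟨⟨_, hL'⟩⟩
    obtain ⟨b, hb⟩ := Finite.exists_max (fun s : S j =>
      OO.valuation (χ ⟨s, (sup_right _ _).2 (hS.sub j s.2)⟩))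
    exact ⟨b.1, b.2, fun s hs => hb ⟨s, hs⟩⟩
  obtain ⟨b, hbS, hbmax⟩ := hbm
  have hbj : b ∈ (X j).N := hS.sub j hbS
  have haC : a ∈ ((X i).sup (X j)).N := (sup_left _ _).2 hai
  have hbC : b ∈ ((X i).sup (X j)).N := (sup_right _ _).2 hbj
  have hχf : χ ⟨AA.f, ((X i).sup (X j)).f_mem⟩ ≠ 0 := by rw [hχ1 _ (X i).f_mem]; exact hf
  have hχb : χ ⟨b, hbC⟩ ≠ 0 := by
    intro h0
    have h1 := hbmax _ hL'
    have h3 : χ ⟨AA.f ^ L', ((X i).sup (X j)).N.pow_mem ((X i).sup (X j)).f_mem _⟩ ≠ 0 := by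
      have : (⟨AA.f ^ L', ((X i).sup (X j)).N.pow_mem ((X i).sup (X j)).f_mem _⟩ : ((X i).sup (X j)).N) = ⟨AA.f, ((X i).sup (X j)).f_mem⟩ ^ L' := rfl
      rw [this, map_pow]; exact pow_ne_zero _ hχf
    have h2 : OO.valuation (χ ⟨b, hbC⟩) = 0 := by rw [h0, map_zero]
    have h4 := le_of_le_of_eq h1 h2
    rw [le_zero_iff, map_eq_zero] at h4
    exact h3 h4
  have hχa : χ ⟨a, haC⟩ ≠ 0 := by rw [hχ1 a hai]; exact hu.ne_zero
  have hab : χ ⟨a * b, mul_mem haC hbC⟩ = χ ⟨a, haC⟩ * χ ⟨b, hbC⟩ := by rw [← map_mul]; rfl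
  obtain ⟨ψ, hψ, hψk⟩ := exthom ((X i).sup (X j)) (mul_mem haC hbC) χ hχ (by
    rw [hab]; exact isUnit_iff_ne_zero.2 (mul_ne_zero hχa hχb))
  have hle : ((Ngt.Bl X S hS ⟨i, a, ha⟩).sup (Ngt.Bl X S hS ⟨j, b, hbS⟩)).N ≤ ((X i).sup (X j)).Loc (a * b) := by
    refine sup_le ((blow_le_Loc (sup_left _ _)).trans (Loc_mul haC hbC)) ?_
    refine (blow_le_Loc (sup_right (X i) (X j))).trans ?_
    change ((X i).sup (X j)).Loc b ≤ _
    rw [mul_comm]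
    exact Loc_mul hbC haC
  have hV : ((Ngt.Bl X S hS ⟨i, a, ha⟩).sup (Ngt.Bl X S hS ⟨j, b, hbS⟩)).V = ((X i).sup (X j)).V ∩ Dom (a * b) := by
    ext y
    simp only [Chart.sup, Ngt.Bl, blow, Dom, Set.mem_inter_iff, Set.mem_ofPred_eq, Pi.mul_apply,
      IsUnit.mul_iff]
    tauto
  have hK' : Kil ((Ngt.Bl X S hS ⟨i, a, ha⟩).sup (Ngt.Bl X S hS ⟨j, b, hbS⟩)).V
      (ψ.comp (Subring.inclusion hle)) := by
    intro x hx
    rw [hV] at hx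
    exact hψk _ hx
  refine ⟨⟨j, b, hbS⟩, ψ.comp (Subring.inclusion hle), hK', ?_, ?_⟩
  · rintro ⟨x, hx⟩
    refine blow_agree (c := X i) (S := S i) (hS := hS.sub i) (ha := ha) hφ hK'
      Set.inter_subset_left hu
      (sup_left (Ngt.Bl X S hS ⟨i, a, ha⟩) (Ngt.Bl X S hS ⟨j, b, hbS⟩)).2 ?_ x hx
    intro x hx
    exact (hψ ⟨x, (sup_left _ _).2 hx⟩).trans (hχ1 x hx)
  · set E := ((Ngt.Bl X S hS ⟨i, a, ha⟩).sup (Ngt.Bl X S hS ⟨j, b, hbS⟩)) with hE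
    have href : Ref E (Ngt.Bl X S hS ⟨j, b, hbS⟩) := sup_right _ _
    let M : Subring (∀ y, O y) :=
      Subring.map E.N.subtype (OO.toSubring.comap (ψ.comp (Subring.inclusion hle)))
    have hM : (Ngt.Bl X S hS ⟨j, b, hbS⟩).N ≤ M := by
      refine blow_le ?_ ?_ ?_
      · intro x hx
        refine ⟨⟨x, href.2 (blow_ref.2 hx)⟩, ?_, rfl⟩
        have := hχj ⟨x, hx⟩
        change ψ ⟨x, _⟩ ∈ OO
        rw [← hψ] at this
        exact this
      · intro x hx
        have hx' : x ∈ (Ngt.Bl X S hS ⟨j, b, hbS⟩).N := Chart.zero _ x hx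
        refine ⟨⟨x, href.2 hx'⟩, ?_, rfl⟩
        have h0 := hK' ⟨x, href.2 hx'⟩ (hx.mono Set.inter_subset_right)
        change (ψ.comp (Subring.inclusion hle)) _ ∈ OO
        rw [h0]; exact OO.zero_mem
      · intro s hs
        have hsm : s * pinv b ∈ E.N := href.2 (blow_mem hs)
        refine ⟨⟨_, hsm⟩, ?_, rfl⟩
        change (ψ.comp (Subring.inclusion hle)) _ ∈ OO
        have hsC : s ∈ ((X i).sup (X j)).N := (sup_right _ _).2 (hS.sub j hs)
        have hbE : b ∈ E.N := href.2 (blow_ref.2 hbj)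
        have hsE : s ∈ E.N := href.2 (blow_ref.2 (hS.sub j hs))
        have e := hK'.eq (x := ⟨s * pinv b, hsm⟩ * ⟨b, hbE⟩) (z := ⟨s, hsE⟩) (by
          intro y hy
          have := mul_pinv hy.2.2
          simp only [Subring.coe_mul, Pi.mul_apply]
          linear_combination (s y) * this)
        have e1 : (ψ.comp (Subring.inclusion hle)) ⟨b, hbE⟩ = χ ⟨b, hbC⟩ := hψ ⟨b, hbC⟩
        have e2 : (ψ.comp (Subring.inclusion hle)) ⟨s, hsE⟩ = χ ⟨s, hsC⟩ := hψ ⟨s, hsC⟩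
        rw [map_mul, e1, e2] at e
        have hm := hbmax s hs
        rw [← ValuationSubring.valuation_le_one_iff]
        have hv : 0 < OO.valuation (χ ⟨b, hbC⟩) := by
          rw [zero_lt_iff, Ne, map_eq_zero]; exact hχb
        rw [← mul_le_mul_iff_left₀ hv, one_mul, ← map_mul, e]
        exact hm
    rintro ⟨x, hx⟩
    obtain ⟨x', hx', h⟩ := hM hx
    have : x' = ⟨x, href.2 hx⟩ := Subtype.ext h
    subst this
    exact hx'

/-- Base data: `C → B → functions`. -/
structure BData (AA : Amb O) where
  C : Type u
  B : Type u
  [cC : CommRing C]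
  [cB : CommRing B]
  ρ : C →+* B
  σ : B →+* (∀ y, O y)
  σ_mem : ∀ V b, σ b ∈ AA.Sec V
  base_eq : AA.base = (σ.comp ρ).range
  f0 : C
  f0_eq : σ (ρ f0) = AA.f
  f0_unit : IsUnit (ρ f0)

attribute [instance] BData.cC BData.cB

lemma BData.mem (BB : BData AA) (t : BB.C) : BB.σ (BB.ρ t) ∈ AA.base := by
  rw [BB.base_eq]; exact ⟨t, rfl⟩

/-- pushout property -/
structure PB (BB : BData AA) (c : Chart AA) : Prop where
  ex : ∀ (R : Type u) [CommRing R] (φ : c.N →+* R) (β : BB.B →+* R), Kil c.V φ →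
    (∀ t, φ ⟨_, c.base_le (BB.mem t)⟩ = β (BB.ρ t)) →
    ∃ Φ : AA.Sec c.V →+* R, Kil c.V Φ ∧ (∀ b, Φ ⟨BB.σ b, BB.σ_mem _ _⟩ = β b) ∧
      ∀ x (hx : x ∈ c.N), Φ ⟨x, c.le hx⟩ = φ ⟨x, hx⟩
  un : ∀ (R : Type u) [CommRing R] (Φ Φ' : AA.Sec c.V →+* R), Kil c.V Φ → Kil c.V Φ' →
    (∀ b, Φ ⟨BB.σ b, BB.σ_mem _ _⟩ = Φ' ⟨BB.σ b, BB.σ_mem _ _⟩) →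
    (∀ x (hx : x ∈ c.N), Φ ⟨x, c.le hx⟩ = Φ' ⟨x, c.le hx⟩) → Φ = Φ'

/-- the full chart -/
def full (c : Chart AA) : Chart AA where
  V := c.V
  aff := c.aff
  N := AA.Sec c.V
  le := le_rfl
  zero _ hx := AA.zero_mem hx
  base_le := AA.base_le _

lemma PB.blow {BB : BData AA} {c : Chart AA} (h : PB BB c) {S : Set (∀ y, O y)} {hS : S ⊆ c.N}
    {a : ∀ y, O y} {ha : a ∈ S} {L : ℕ} (hL : AA.f ^ L ∈ S) : PB BB (blow c S hS a ha) := by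
  have hanti : AA.Sec c.V ≤ AA.Sec (Ngt.blow c S hS a ha).V := AA.anti Set.inter_subset_left
  have haV : a ∈ AA.Sec c.V := c.le (hS ha)
  constructor
  · intro R _ φ β hφ hc
    obtain ⟨Φ, h1, h2, h3⟩ := h.ex R (φ.comp (Subring.inclusion blow_ref.2)) β
      (fun x hx => hφ _ (hx.mono Set.inter_subset_left)) hc
    have hf : IsUnit (φ ⟨AA.f, (Ngt.blow c S hS a ha).f_mem⟩) := by
      have := hc BB.f0
      have e : (⟨_, (Ngt.blow c S hS a ha).base_le (BB.mem BB.f0)⟩ :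
        (Ngt.blow c S hS a ha).N) = ⟨AA.f, (Ngt.blow c S hS a ha).f_mem⟩ := Subtype.ext BB.f0_eq
      rw [e] at this
      rw [this]
      exact BB.f0_unit.map β
    have hu := blow_ne hL hφ hf
    obtain ⟨ψ, hψ, hψk⟩ := exthom (full c) (a := a) haV Φ h1 (by
      have := h3 a (hS ha)
      erw [this]; exact hu)
    have hle : AA.Sec (Ngt.blow c S hS a ha).V ≤ (full c).Loc a :=
      fun x hx _ => AA.L1 c.aff haV hx
    have hk : Kil (Ngt.blow c S hS a ha).V (ψ.comp (Subring.inclusion hle)) :=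
      fun x hx => hψk _ hx
    refine ⟨ψ.comp (Subring.inclusion hle), hk, ?_, ?_⟩
    · intro b
      rw [← h2]
      exact hψ ⟨_, BB.σ_mem _ b⟩
    · refine blow_agree hφ hk subset_rfl hu (Ngt.blow c S hS a ha).le (fun x hx => ?_)
      exact (hψ ⟨x, c.le hx⟩).trans (h3 x hx)
  · intro R _ Φ Φ' hk hk' hb hN
    have e : Φ.comp (Subring.inclusion hanti) = Φ'.comp (Subring.inclusion hanti) := by
      refine h.un R _ _ (fun x hx => hk _ (hx.mono Set.inter_subset_left))
        (fun x hx => hk' _ (hx.mono Set.inter_subset_left)) hb (fun x hx => hN x (blow_ref.2 hx))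
    ext ⟨x, hx⟩
    obtain ⟨p, z, hz, hh⟩ := AA.L1 c.aff haV hx
    have hu : IsUnit (Φ ⟨a, hanti haV⟩) := by
      have hp : pinv a ∈ AA.Sec (Ngt.blow c S hS a ha).V :=
        AA.inv_mem (Ngt.blow c S hS a ha).aff (hanti haV) Set.inter_subset_right
      have := hk.eq (x := ⟨a, hanti haV⟩ * ⟨pinv a, hp⟩) (z := 1) (fun y hy => mul_pinv hy.2)
      rw [map_mul, map_one] at this
      exact IsUnit.of_mul_eq_one _ this
    have h1 := hk.pow_mul (hanti haV) hx (hanti hz) hh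
    have h2 := hk'.pow_mul (hanti haV) hx (hanti hz) hh
    have ea : Φ ⟨a, hanti haV⟩ = Φ' ⟨a, hanti haV⟩ := RingHom.congr_fun e ⟨a, haV⟩
    have ez : Φ ⟨z, hanti hz⟩ = Φ' ⟨z, hanti hz⟩ := RingHom.congr_fun e ⟨z, hz⟩
    rw [← ea, ← ez, ← h1] at h2
    exact (hu.pow p).mul_left_cancel h2.symm

/-- All invariants of a family. -/
structure Inv (BB : BData AA) {ι : Type u} (X : ι → Chart AA) : Prop where
  fg : ∀ i, FG (X i)
  gop : ∀ i j, GOp (X i) (X j)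
  cov : Cov X
  pb : ∀ i, PB BB (X i)
  cover : ∀ y, ∃ i, y ∈ (X i).V

lemma Inv.Bl {BB : BData AA} {ι : Type u} {X : ι → Chart AA} (h : Inv BB X)
    {S : ι → Set (∀ y, O y)} (hS : Cen X S) : Inv BB (Bl X S hS) where
  fg e := (h.fg e.1).blow (hS.fin e.1)
  gop e e' := by
    obtain ⟨L, hL⟩ := hS.pow e'.1
    exact ((h.gop e.1 e'.1).bc (Bl_ref e)).blow hL
  cov := h.cov.Bl hS
  pb e := by
    obtain ⟨L, hL⟩ := hS.pow e.1
    exact (h.pb e.1).blow hL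
  cover y := by
    obtain ⟨i, hi⟩ := h.cover y
    obtain ⟨L, hL⟩ := hS.pow i
    exact ⟨⟨i, _, hL⟩, hi, (AA.f_unit y).pow L⟩

lemma merge_all {BB : BData AA} (n : ℕ) : ∀ {ι : Type u} [Finite ι] {X : ι → Chart AA} (lab : ι → ℕ),
    Inv BB X → (∀ i j, lab i = lab j → Op (X i) (X j)) → (∀ i, lab i ≤ n) →
    ∃ (ι' : Type u) (_ : Finite ι') (X' : ι' → Chart AA), Inv BB X' ∧ ∀ i j, Op (X' i) (X' j) := by
  induction n with
  | zero =>
    intro ι _ X lab h hop hl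
    refine ⟨ι, inferInstance, X, h, fun i j => hop i j ?_⟩
    have := hl i; have := hl j; omega
  | succ n ih =>
    intro ι _ X lab h hop hl
    obtain ⟨I, hI, K, hK, H⟩ := merge h.fg h.gop hop n (n + 1) (by omega)
    have : ∀ i, Finite (I i) := fun i => (hI.fin i).to_subtype
    have : ∀ i, Finite (K i) := fun i => (hK.fin i).to_subtype
    refine ih (fun g => min n (lab g.1.1)) ((h.Bl hI).Bl hK) (fun g g' hg => H g g' ?_)
      (fun g => by simp)
    have := hl g.1.1; have := hl g'.1.1
    omega

end Abstract
end Ngt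

namespace Ngt

/-- extension of a valuation ring along a field extension -/
lemma val_ext {κ k : Type u} [Field κ] [Field k] (i : κ →+* k) (OO : ValuationSubring κ) :
    ∃ W : ValuationSubring k, ∀ x, i x ∈ W ↔ x ∈ OO := by
  obtain ⟨W, hW, hl⟩ := IsLocalRing.exists_factor_valuationRing (i.comp OO.subtype)
  refine ⟨W, fun x => ⟨fun hx => ?_, fun hx => hW ⟨x, hx⟩⟩⟩
  by_contra hn
  have hx' : x⁻¹ ∈ OO := (OO.mem_or_inv_mem x).resolve_left hn
  have hx0 : x ≠ 0 := by rintro rfl; exact hn OO.zero_mem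
  have hu : IsUnit (⟨x⁻¹, hx'⟩ : OO) := by
    refine hl.map_nonunit _ ?_
    refine IsUnit.of_mul_eq_one ⟨i x, hx⟩ (Subtype.ext ?_)
    change i x⁻¹ * i x = 1
    rw [← map_mul, inv_mul_cancel₀ hx0, map_one]
  obtain ⟨y, hy⟩ := hu.exists_right_inv
  have : (x⁻¹ : κ) * y = 1 := congrArg Subtype.val hy
  have : x = y := by field_simp at this; exact this.symm
  exact hn (this ▸ y.2)

/-- composite valuation ring -/
lemma val_comp {L k : Type u} [Field L] [Field k] (V : ValuationSubring L) (h : V →+* k)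
    (W : ValuationSubring k) [IsLocalHom h] :
    ∃ V2 : ValuationSubring L, ∀ x, x ∈ V2 ↔ ∃ hx : x ∈ V, h ⟨x, hx⟩ ∈ W := by
  let S : Subring L := Subring.map V.subtype (W.toSubring.comap h)
  have hS : ∀ x, x ∈ S ↔ ∃ hx : x ∈ V, h ⟨x, hx⟩ ∈ W := by
    intro x
    constructor
    · rintro ⟨⟨x, hx⟩, h1, rfl⟩; exact ⟨hx, h1⟩
    · rintro ⟨hx, h1⟩; exact ⟨⟨x, hx⟩, h1, rfl⟩
  have key : ∀ x (hx : x ∈ V), x ∈ S ∨ x⁻¹ ∈ S := by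
    intro x hx
    by_cases h0 : h ⟨x, hx⟩ = 0
    · left; rw [hS]; exact ⟨hx, by rw [h0]; exact W.zero_mem⟩
    · have hu : IsUnit (⟨x, hx⟩ : V) := IsLocalHom.map_nonunit _ (isUnit_iff_ne_zero.2 h0)
      obtain ⟨y, hy⟩ := hu.exists_right_inv
      have hy1 : x * y = 1 := congrArg Subtype.val hy
      have hx0 : x ≠ 0 := by rintro rfl; simp at hy1
      have hyx : x⁻¹ = y := by rw [inv_eq_iff_eq_inv, eq_comm, inv_eq_of_mul_eq_one_left hy1]
      have hh : h ⟨x, hx⟩ * h y = 1 := by rw [← map_mul, hy, map_one]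
      have hhi : (h ⟨x, hx⟩)⁻¹ = h y := inv_eq_of_mul_eq_one_right hh
      rcases W.mem_or_inv_mem (h ⟨x, hx⟩) with h1 | h1
      · left; rw [hS]; exact ⟨hx, h1⟩
      · right; rw [hS, hyx]; exact ⟨y.2, by rw [hhi] at h1; exact h1⟩
  refine ⟨{ S with mem_or_inv_mem' := fun x => ?_ }, hS⟩
  rcases V.mem_or_inv_mem x with hx | hx
  · exact key x hx
  · have := key _ hx; rw [inv_inv] at this; exact this.symm

lemma exists_frac (R : Type u) [CommRing R] [IsDomain R] :
    ∃ (L : Type u) (_ : Field L) (j : R →+* L), Function.Injective j :=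
  ⟨FractionRing R, inferInstance, algebraMap _ _, IsFractionRing.injective R (FractionRing R)⟩

lemma val_lift {Q K : Type u} [CommRing Q] [IsDomain Q] [Field K] (φ : Q →+* K)
    (OO : ValuationSubring K) :
    ∃ (L : Type u) (_ : Field L) (V V2 : ValuationSubring L) (τ : Q →+* L)
      (k : Type u) (_ : Field k) (h : V →+* k) (W : ValuationSubring k)
      (hV : ∀ q, τ q ∈ V) (hle : V2 ≤ V), Function.Injective τ ∧
      (∀ q, h ⟨τ q, hV q⟩ = 0 ↔ φ q = 0) ∧
      (∀ q s, φ s ≠ 0 → ∀ w ∈ W, h ⟨τ q, hV q⟩ = h ⟨τ s, hV s⟩ * w → ∃ o ∈ OO, φ q = φ s * o) ∧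
      (∀ x (hx : x ∈ V2), h ⟨x, hle hx⟩ ∈ W) ∧ (∀ q, φ q ∈ OO → τ q ∈ V2) := by
  have hp : (RingHom.ker φ).IsPrime := RingHom.ker_isPrime φ
  let R := Localization.AtPrime (RingHom.ker φ)
  have hinj : Function.Injective (algebraMap Q R) :=
    IsLocalization.injective R (RingHom.ker φ).primeCompl_le_nonZeroDivisors
  have : IsDomain R := IsLocalization.isDomain_of_le_nonZeroDivisors (R := Q) (S := R)
    (M := (RingHom.ker φ).primeCompl) (RingHom.ker φ).primeCompl_le_nonZeroDivisors
  obtain ⟨L, _, jL, hFR⟩ := exists_frac R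
  obtain ⟨V, hV, hl⟩ := IsLocalRing.exists_factor_valuationRing jL
  have hunit : ∀ y : (RingHom.ker φ).primeCompl, IsUnit (φ y) := fun y =>
    isUnit_iff_ne_zero.2 (fun h0 => y.2 ((RingHom.mem_ker).2 h0))
  let φR : R →+* K := IsLocalization.lift (M := (RingHom.ker φ).primeCompl) (g := φ) hunit
  have hφR : ∀ q, φR (algebraMap Q R q) = φ q := fun q => IsLocalization.lift_eq _ q
  have hloc : IsLocalHom φR := by
    constructor
    intro r hr
    by_contra hn
    obtain ⟨⟨q, s⟩, hq⟩ := IsLocalization.surj (RingHom.ker φ).primeCompl r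
    have h1 : φR r * φ s = φ q := by
      rw [← hφR, ← hφR, ← map_mul]; exact congrArg φR hq
    have hq0 : φ q ≠ 0 := by rw [← h1]; exact mul_ne_zero hr.ne_zero (hunit s).ne_zero
    have : IsUnit (algebraMap Q R q) := IsLocalization.map_units R (⟨q, fun h => hq0 (RingHom.mem_ker.1 h)⟩ : (RingHom.ker φ).primeCompl)
    rw [← hq] at this
    exact hn (IsUnit.mul_iff.1 this).1
  let ε : IsLocalRing.ResidueField R →+* K := IsLocalRing.ResidueField.lift φR
  let δ : R →+* V := jL.codRestrict V.toSubring hV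
  have hδ : IsLocalHom δ := hl
  let ι : IsLocalRing.ResidueField R →+* IsLocalRing.ResidueField V :=
    IsLocalRing.ResidueField.map δ
  obtain ⟨W, hW⟩ := val_ext ι (OO.comap ε)
  obtain ⟨V2, hV2⟩ := val_comp V (IsLocalRing.residue V) W
  have hε : ∀ q, ε (IsLocalRing.residue R (algebraMap Q R q)) = φ q := fun q => hφR q
  refine ⟨L, inferInstance, V, V2, jL.comp (algebraMap Q R),
    IsLocalRing.ResidueField V, inferInstance, IsLocalRing.residue V, W, fun q => hV _,
    fun x hx => ((hV2 x).1 hx).1, ?_, ?_, ?_, ?_, ?_⟩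
  · exact hFR.comp hinj
  · intro q
    rw [← hε, map_eq_zero ε]
    change ι (IsLocalRing.residue R (algebraMap Q R q)) = 0 ↔ _
    rw [map_eq_zero ι]
  · intro q s hs w hw he
    change ι (IsLocalRing.residue R (algebraMap Q R q)) = ι (IsLocalRing.residue R (algebraMap Q R s)) * w at he
    have hs0 : IsLocalRing.residue R (algebraMap Q R s) ≠ 0 := by
      intro h0; rw [← hε, h0, map_zero] at hs; exact hs rfl
    have hs1 : ι (IsLocalRing.residue R (algebraMap Q R s)) ≠ 0 := by
      rwa [Ne, map_eq_zero]
    have hw' : w = ι (IsLocalRing.residue R (algebraMap Q R q) / IsLocalRing.residue R (algebraMap Q R s)) := by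
      rw [map_div₀, he]; field_simp
    rw [hw', hW, ValuationSubring.mem_comap, map_div₀, hε, hε] at hw
    exact ⟨_, hw, by field_simp⟩
  · intro x hx; exact ((hV2 x).1 hx).2
  · intro q hq
    rw [hV2]
    refine ⟨hV _, ?_⟩
    change ι (IsLocalRing.residue R (algebraMap Q R q)) ∈ W
    rw [hW, ValuationSubring.mem_comap, hε]
    exact hq

section Abstract

variable {Y : Type u} {O : Y → Type u} [∀ y, CommRing (O y)] {AA : Amb O}

open Chart

/-- ideal of functions vanishing on the chart -/
def vanI (c : Chart AA) : Ideal c.N where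
  carrier := {x | Van c.V (x : ∀ y, O y)}
  add_mem' {a b} ha hb := fun y hy => by
    have h1 := ha y hy; have h2 := hb y hy
    simp only [Subring.coe_add, Pi.add_apply, h1, h2, add_zero]
  zero_mem' := fun y hy => rfl
  smul_mem' a x hx := fun y hy => by
    have h1 := hx y hy
    simp only [smul_eq_mul, Subring.coe_mul, Pi.mul_apply, h1, mul_zero]

lemma mem_vanI {c : Chart AA} {x : c.N} : x ∈ vanI c ↔ Van c.V (x : ∀ y, O y) := Iff.rfl

/-- the point given by the kernel of a hom -/
lemma kerPt (c : Chart AA) {k : Type u} [Field k] (g : c.N →+* k) (hg : Kil c.V g) :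
    IsPt c {x | ∃ hx : x ∈ c.N, g ⟨x, hx⟩ = 0} where
  van x hx := ⟨c.zero x hx, hg _ hx⟩
  add x hx z hz := by
    rintro ⟨_, h1⟩ ⟨_, h2⟩
    refine ⟨add_mem hx hz, ?_⟩
    have : g (⟨x, hx⟩ + ⟨z, hz⟩) = 0 := by rw [map_add, h1, h2, add_zero]
    exact this
  mul x hx z hz := by
    rintro ⟨_, h1⟩
    refine ⟨mul_mem hx hz, ?_⟩
    have : g (⟨x, hx⟩ * ⟨z, hz⟩) = 0 := by rw [map_mul, h1, mul_zero]
    exact this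
  one := by
    rintro ⟨_, h1⟩
    have : g 1 = 0 := h1
    rw [map_one] at this
    exact one_ne_zero this
  prime x hx z hz := by
    rintro ⟨_, h1⟩
    have : g (⟨x, hx⟩ * ⟨z, hz⟩) = 0 := h1
    rw [map_mul, mul_eq_zero] at this
    exact this.imp (fun h => ⟨hx, h⟩) (fun h => ⟨hz, h⟩)

/-- Full coverage of valued points -/
lemma Cov.full {ι : Type u} {X : ι → Chart AA} (hc : Cov X) (hop : ∀ i j, Op (X i) (X j))
    (i : ι) (K : Type u) [Field K] (OO : ValuationSubring K) (φ : (X i).N →+* K)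
    (hφ : Kil (X i).V φ) (hb : ∀ x (hx : x ∈ AA.base), φ ⟨x, (X i).base_le hx⟩ ∈ OO) :
    ∃ (j : ι) (χ : ((X i).sup (X j)).N →+* K), Kil ((X i).sup (X j)).V χ ∧
      (∀ x : (X i).N, χ ⟨x, (sup_left _ _).2 x.2⟩ = φ x) ∧
      (∀ x : (X j).N, χ ⟨x, (sup_right _ _).2 x.2⟩ ∈ OO) := by
  have hp : (RingHom.ker φ).IsPrime := RingHom.ker_isPrime φ
  let f : (X i).N := ⟨AA.f, (X i).f_mem⟩
  obtain ⟨q, hq, hqv, hqd⟩ := Ideal.exists_le_prime_disjoint (vanI (X i))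
    (Submonoid.powers f ⊔ (RingHom.ker φ).primeCompl) (by
      rw [Set.disjoint_left]
      intro x hx hx'
      obtain ⟨_, ⟨n, rfl⟩, s, hs, rfl⟩ := Submonoid.mem_sup.1 hx'
      apply hs
      refine RingHom.mem_ker.2 ?_
      refine hφ s (fun y hy => ?_)
      have h1 := hx y hy
      simp only [Subring.coe_mul, Subring.coe_pow, Pi.mul_apply, Pi.pow_apply] at h1
      exact ((AA.f_unit y).pow n).mul_right_eq_zero.1 h1)
  rw [Set.disjoint_left] at hqd
  have hqk : q ≤ RingHom.ker φ := by
    intro x hx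
    by_contra hn
    exact hqd hx (Submonoid.mem_sup_right hn)
  have hfq : f ∉ q := fun h => hqd h (Submonoid.mem_sup_left (Submonoid.mem_powers f))
  let φ' : (X i).N ⧸ q →+* K := Ideal.Quotient.lift q φ (fun a ha => hqk ha)
  obtain ⟨L, _, V, V2, τ, k, _, h, W, hV, hle, hinj, hker, hdiv, hV2, hτ⟩ := val_lift φ' OO
  obtain ⟨j, χ, hχ, hχi, hχj⟩ := hc i L V2 (τ.comp (Ideal.Quotient.mk q))
    (fun x hx => by
      rw [RingHom.comp_apply, Ideal.Quotient.eq_zero_iff_mem.2 (hqv hx), map_zero])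
    (by
      rw [RingHom.comp_apply, Ne, map_eq_zero_iff _ hinj, Ideal.Quotient.eq_zero_iff_mem]
      exact hfq)
    (fun x hx => hτ _ (hb x hx))
  have hχV : ∀ x : ((X i).sup (X j)).N, χ x ∈ V := by
    let M : Subring (∀ y, O y) := Subring.map ((X i).sup (X j)).N.subtype (V.toSubring.comap χ)
    have hM : ((X i).sup (X j)).N ≤ M := by
      refine sup_le ?_ ?_
      · intro x hx
        refine ⟨⟨x, (sup_left _ _).2 hx⟩, ?_, rfl⟩
        change χ _ ∈ V
        rw [hχi ⟨x, hx⟩]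
        exact hV _
      · intro x hx
        exact ⟨⟨x, (sup_right _ _).2 hx⟩, hle (hχj ⟨x, hx⟩), rfl⟩
    rintro ⟨x, hx⟩
    obtain ⟨x', h1, h2⟩ := hM hx
    have : x' = ⟨x, hx⟩ := Subtype.ext h2
    subst this
    exact h1
  let g : ((X i).sup (X j)).N →+* k := h.comp (χ.codRestrict V.toSubring hχV)
  have hg : Kil ((X i).sup (X j)).V g := by
    intro x hx
    have : χ.codRestrict V.toSubring hχV x = 0 := Subtype.ext (hχ x hx)
    change h _ = 0
    rw [this, map_zero]
  have hgi : ∀ x (hx : x ∈ (X i).N), g ⟨x, (sup_left _ _).2 hx⟩ =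
      h ⟨τ (Ideal.Quotient.mk q ⟨x, hx⟩), hV _⟩ := by
    intro x hx
    change h _ = h _
    congr 1
    exact Subtype.ext (hχi ⟨x, hx⟩)
  obtain ⟨s, hs, hsP, hsV, hsN⟩ := hop i j _ (kerPt _ g hg)
  have hs0 : φ ⟨s, hs⟩ ≠ 0 := by
    intro h0
    refine hsP ⟨(sup_left _ _).2 hs, ?_⟩
    rw [hgi s hs, hker]
    exact h0
  obtain ⟨ψ, hψ, hψk⟩ := exthom (X i) hs φ hφ (isUnit_iff_ne_zero.2 hs0)
  have hl : ((X i).sup (X j)).N ≤ (X i).Loc s := sup_le (le_Loc _ _) hsN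
  have hkk : Kil ((X i).sup (X j)).V (ψ.comp (Subring.inclusion hl)) :=
    fun x hx => hψk _ (hx.mono (Set.subset_inter Set.inter_subset_left hsV))
  refine ⟨j, ψ.comp (Subring.inclusion hl), hkk, fun x => hψ x, ?_⟩
  rintro ⟨x, hx⟩
  obtain ⟨p, z, hz, e⟩ := hsN hx hs
  have hx' : x ∈ ((X i).sup (X j)).N := (sup_right _ _).2 hx
  have hsC : s ∈ ((X i).sup (X j)).N := (sup_left _ _).2 hs
  have hzC : z ∈ ((X i).sup (X j)).N := (sup_left _ _).2 hz
  have hgs : g ⟨s, hsC⟩ ≠ 0 := fun h0 => hsP ⟨hsC, h0⟩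
  obtain ⟨r, hr⟩ := ((X i).sup (X j)).L0 (x := s ^ p * x) (z := z) (s := s)
    (mul_mem (pow_mem hsC _) hx') hzC hsC (e.mono (Set.inter_subset_inter_left _ Set.inter_subset_left))
  have e1 : g ⟨s, hsC⟩ ^ p * g ⟨x, hx'⟩ = g ⟨z, hzC⟩ := by
    have := hg.eq (x := (⟨s, hsC⟩ : ((X i).sup (X j)).N) ^ r * ((⟨s, hsC⟩ : ((X i).sup (X j)).N) ^ p * ⟨x, hx'⟩))
      (z := (⟨s, hsC⟩ : ((X i).sup (X j)).N) ^ r * ⟨z, hzC⟩) hr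
    simp only [map_mul, map_pow] at this
    exact mul_left_cancel₀ (pow_ne_zero r hgs) this
  have e2 : φ ⟨s, hs⟩ ^ p * ψ ⟨x, hsN hx⟩ = φ ⟨z, hz⟩ := by
    have := hψk.pow_mul (le_Loc _ _ hs) (hsN hx) (le_Loc _ _ hz) e
    rw [hψ ⟨s, hs⟩, hψ ⟨z, hz⟩] at this
    exact this
  obtain ⟨o, ho, ho'⟩ := hdiv (Ideal.Quotient.mk q ⟨z, hz⟩) (Ideal.Quotient.mk q ⟨s, hs⟩ ^ p)
    (by rw [map_pow]; exact pow_ne_zero p hs0) (g ⟨x, hx'⟩) (hV2 _ (hχj ⟨x, hx⟩)) (by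
      rw [← hgi z hz, ← e1, hgi s hs, ← map_pow]
      congr 2
      exact Subtype.ext (map_pow τ _ _).symm)
  have ho2 : φ ⟨z, hz⟩ = φ ⟨s, hs⟩ ^ p * o := by
    rw [map_pow] at ho'; exact ho'
  rw [← e2] at ho2
  have := mul_left_cancel₀ (pow_ne_zero p hs0) ho2
  change ψ ⟨x, _⟩ ∈ OO
  rw [this]; exact ho
end Abstract
end Ngt

namespace Ngt

lemma isLocalization_away_of {R S T : Type u} [CommRing R] [CommRing S] [CommRing T] (q : R →+* S)
    [Algebra S T] (s : R) [IsLocalization.Away (q s) T]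
    (h1 : ∀ x : S, ∃ (p : ℕ) (z : R), q s ^ p * x = q z)
    (h2 : ∀ z : R, q z = 0 → ∃ p : ℕ, s ^ p * z = 0) :
    @IsLocalization.Away R _ s T _ ((algebraMap S T).comp q).toAlgebra := by
  let _ := ((algebraMap S T).comp q).toAlgebra
  have hu : IsUnit (algebraMap S T (q s)) := IsLocalization.Away.algebraMap_isUnit (q s)
  have hal : ∀ r, algebraMap R T r = algebraMap S T (q r) := fun r => rfl
  refine IsLocalization.Away.mk _ ?_ ?_ ?_
  · exact hu
  · intro t
    obtain ⟨n, a, ha⟩ := IsLocalization.Away.surj (q s) t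
    obtain ⟨p, z, hz⟩ := h1 a
    refine ⟨n + p, z, ?_⟩
    rw [hal, hal, ← hz, map_mul, map_pow, ← ha]; ring
  · intro a b hab
    rw [hal, hal, IsLocalization.eq_iff_exists (Submonoid.powers (q s))] at hab
    obtain ⟨⟨_, n, rfl⟩, hn⟩ := hab
    simp only at hn
    obtain ⟨p, hp⟩ := h2 (s ^ n * (a - b)) (by rw [map_mul, map_pow, map_sub, mul_sub, hn, sub_self])
    refine ⟨p + n, ?_⟩
    linear_combination hp

lemma open_of_loc {R S : Type u} [CommRing R] [CommRing S] (q : R →+* S)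
    (H : ∀ P : Ideal S, P.IsPrime → ∃ s : R, q s ∉ P ∧
      (∀ x : S, ∃ (p : ℕ) (z : R), q s ^ p * x = q z) ∧
      (∀ z : R, q z = 0 → ∃ p : ℕ, s ^ p * z = 0)) :
    IsOpenImmersion (Spec.map (CommRingCat.ofHom q)) := by
  have hloc : IsLocalIso (Spec.map (CommRingCat.ofHom q)) := by
    constructor
    intro x
    obtain ⟨s, hs, h1, h2⟩ := H x.asIdeal x.2
    let g : Spec (.of (Localization.Away (q s))) ⟶ Spec (.of S) :=
      Spec.map (CommRingCat.ofHom (algebraMap S (Localization.Away (q s))))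
    have hg : IsOpenImmersion g := IsOpenImmersion.of_isLocalization (q s)
    have hgq : IsOpenImmersion (g ≫ Spec.map (CommRingCat.ofHom q)) := by
      rw [← Spec.map_comp, ← CommRingCat.ofHom_comp]
      let _ := ((algebraMap S (Localization.Away (q s))).comp q).toAlgebra
      have : IsLocalization.Away s (Localization.Away (q s)) := isLocalization_away_of q s h1 h2
      exact IsOpenImmersion.of_isLocalization (S := Localization.Away (q s)) s
    refine ⟨g.opensRange, ?_, ?_⟩
    · have : x ∈ Set.range (PrimeSpectrum.comap (algebraMap S (Localization.Away (q s)))) := by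
        rw [PrimeSpectrum.localization_away_comap_range (Localization.Away (q s)) (q s)]
        exact hs
      exact this
    · rw [← Scheme.Hom.isoOpensRange_inv_comp, Category.assoc]
      infer_instance
  have c1 : MorphismProperty.ContainsIdentities (C := Scheme.{u}) @Flat.{u} :=
    ⟨fun X => (inferInstance : Flat (𝟙 X))⟩
  have c2 : MorphismProperty.ContainsIdentities (C := Scheme.{u}) @LocallyOfFinitePresentation.{u} :=
    ⟨fun X => (inferInstance : LocallyOfFinitePresentation (𝟙 X))⟩
  have c3 : IsZariskiLocalAtSource @Flat.{u} := HasRingHomProperty.instIsZariskiLocalAtSource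
  have c4 : IsZariskiLocalAtSource @LocallyOfFinitePresentation.{u} :=
    HasRingHomProperty.instIsZariskiLocalAtSource
  have hf : Flat (Spec.map (CommRingCat.ofHom q)) :=
    IsLocalIso.le_of_isZariskiLocalAtSource @Flat.{u} _ _ _ hloc
  have hf : LocallyOfFinitePresentation (Spec.map (CommRingCat.ofHom q)) :=
    IsLocalIso.le_of_isZariskiLocalAtSource @LocallyOfFinitePresentation.{u} _ _ _ hloc
  have hm : Mono (Spec.map (CommRingCat.ofHom q)) := by
    have : Epi (CommRingCat.ofHom q) := by
      constructor
      intro T a b hab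
      have hab' : ∀ r, a.hom (q r) = b.hom (q r) := fun r =>
        congrArg (fun t : CommRingCat.of R ⟶ T => t.hom r) hab
      ext x
      by_contra hne
      let J : Ideal T := Ideal.span {a.hom x - b.hom x}
      let I : Ideal S :=
        { carrier := {t | a.hom t * (a.hom x - b.hom x) = 0}
          add_mem' := fun {t t'} h h' => by
            simp only [Set.mem_ofPred_eq, map_add, add_mul] at *; rw [h, h', add_zero]
          zero_mem' := by simp
          smul_mem' := fun c t h => by
            simp only [Set.mem_ofPred_eq, smul_eq_mul, map_mul, mul_assoc] at *; rw [h, mul_zero] }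
      have hI : I ≠ ⊤ := by
        intro h
        have : (1 : S) ∈ I := h ▸ Submodule.mem_top
        have : a.hom 1 * (a.hom x - b.hom x) = 0 := this
        rw [map_one, one_mul, sub_eq_zero] at this
        exact hne this
      obtain ⟨P, hP, hIP⟩ := Ideal.exists_le_maximal I hI
      obtain ⟨s, hs, h1, -⟩ := H P hP.isPrime
      obtain ⟨p, z, hz⟩ := h1 x
      have : q s ^ p ∈ I := by
        change a.hom (q s ^ p) * (a.hom x - b.hom x) = 0
        have e1 : a.hom (q s ^ p * x) = b.hom (q s ^ p * x) := by rw [hz, hab']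
        rw [map_mul, map_mul, map_pow, map_pow, hab' s] at e1
        rw [map_pow, hab', mul_sub, e1, sub_self]
      exact hs (hP.isPrime.mem_of_pow_mem p (hIP this))
    exact inferInstanceAs (Mono (Scheme.Spec.map (CommRingCat.ofHom q).op))
  exact IsOpenImmersion.of_flat_of_mono _

section Abstract

variable {Y : Type u} {O : Y → Type u} [∀ y, CommRing (O y)] {AA : Amb O}

open Chart

/-- the ring of a chart -/
abbrev Qr (c : Chart AA) : Type u := c.N ⧸ vanI c

/-- classes -/
def mk (c : Chart AA) : c.N →+* Qr c := Ideal.Quotient.mk (vanI c)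

lemma mk_surj (c : Chart AA) (q : Qr c) : ∃ x, ∃ hx : x ∈ c.N, mk c ⟨x, hx⟩ = q := by
  obtain ⟨⟨x, hx⟩, h⟩ := Ideal.Quotient.mk_surjective q
  exact ⟨x, hx, h⟩

lemma mk_eq_zero {c : Chart AA} {x : c.N} : mk c x = 0 ↔ Van c.V (x : ∀ y, O y) :=
  Ideal.Quotient.eq_zero_iff_mem

lemma mk_kil (c : Chart AA) : Kil c.V (mk c) := fun _ hx => mk_eq_zero.2 hx

/-- transition maps -/
def qmap {c d : Chart AA} (h : Ref d c) : Qr c →+* Qr d :=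
  Ideal.quotientMap (vanI d) (Subring.inclusion h.2) (fun _ hx => Van.mono h.1 hx)

lemma qmap_mk {c d : Chart AA} (h : Ref d c) (x : ∀ y, O y) (hx : x ∈ c.N) :
    qmap h (mk c ⟨x, hx⟩) = mk d ⟨x, h.2 hx⟩ := rfl

lemma qhom_ext {c : Chart AA} {R : Type*} [CommRing R] {g g' : Qr c →+* R}
    (h : ∀ x (hx : x ∈ c.N), g (mk c ⟨x, hx⟩) = g' (mk c ⟨x, hx⟩)) : g = g' := by
  refine Ideal.Quotient.ringHom_ext ?_
  ext ⟨x, hx⟩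
  exact h x hx

/-- descend a hom -/
def qlift {c : Chart AA} {R : Type u} [CommRing R] (φ : c.N →+* R) (h : Kil c.V φ) : Qr c →+* R :=
  Ideal.Quotient.lift (vanI c) φ (fun x hx => h x hx)

lemma qlift_mk {c : Chart AA} {R : Type u} [CommRing R] (φ : c.N →+* R) (h : Kil c.V φ) (x : c.N) :
    qlift φ h (mk c x) = φ x := rfl

lemma comp_kil {c : Chart AA} {R : Type u} [CommRing R] (g : Qr c →+* R) :
    Kil c.V (g.comp (mk c)) := fun x hx => by
  rw [RingHom.comp_apply, mk_eq_zero.2 hx, map_zero]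

/-- the point of a prime -/
lemma idPt (c : Chart AA) (I : Ideal (Qr c)) (hI : I.IsPrime) :
    IsPt c {x | ∃ hx : x ∈ c.N, mk c ⟨x, hx⟩ ∈ I} where
  van x hx := ⟨c.zero x hx, by rw [mk_eq_zero.2 hx]; exact I.zero_mem⟩
  add x hx z hz := by
    rintro ⟨_, h1⟩ ⟨_, h2⟩
    refine ⟨add_mem hx hz, ?_⟩
    have := I.add_mem h1 h2
    rw [← map_add] at this
    exact this
  mul x hx z hz := by
    rintro ⟨_, h1⟩
    refine ⟨mul_mem hx hz, ?_⟩
    have := I.mul_mem_left (mk c ⟨x, hx⟩) h1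
    rw [← map_mul] at this
    exact this
  one := by
    rintro ⟨_, h1⟩
    have : mk c 1 ∈ I := h1
    rw [map_one] at this
    exact hI.ne_top ((Ideal.eq_top_iff_one I).2 this)
  prime x hx z hz := by
    rintro ⟨_, h1⟩
    have : mk c (⟨x, hx⟩ * ⟨z, hz⟩) ∈ I := h1
    rw [map_mul] at this
    exact (hI.mem_or_mem this).imp (fun h => ⟨hx, h⟩) (fun h => ⟨hz, h⟩)

lemma qmap_open {c d : Chart AA} (h : Ref c d) (hop : Op d c) :
    IsOpenImmersion (Spec.map (CommRingCat.ofHom (qmap h))) := by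
  refine open_of_loc _ (fun P hP => ?_)
  obtain ⟨s, hs, hsP, hsV, hsN⟩ := hop _ ((idPt c P hP).mono (Ref.sup h (Ref.refl c)))
  refine ⟨mk d ⟨s, hs⟩, fun hh => hsP ⟨h.2 hs, hh⟩, ?_, ?_⟩
  · intro x
    obtain ⟨x, hx, rfl⟩ := mk_surj c x
    obtain ⟨p, z, hz, e⟩ := hsN hx hs
    obtain ⟨r, hr⟩ := c.L0 (x := s ^ p * x) (z := z) (s := s) (mul_mem (pow_mem (h.2 hs) _) hx)
      (h.2 hz) (h.2 hs) (e.mono (Set.inter_subset_inter_left _ h.1))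
    refine ⟨r + p, mk d ⟨s ^ r * z, mul_mem (pow_mem hs _) hz⟩, ?_⟩
    rw [qmap_mk, qmap_mk]
    refine (mk_kil c).pow_mul _ _ _ ?_
    rw [pow_add, mul_assoc]
    exact hr
  · intro z hz0
    obtain ⟨z, hz, rfl⟩ := mk_surj d z
    rw [qmap_mk, mk_eq_zero] at hz0
    obtain ⟨p, hp⟩ := d.L0 (x := z) (z := 0) (s := s) hz (zero_mem _) hs
      (fun y hy => hz0 y (hsV hy))
    refine ⟨p, ?_⟩
    rw [← map_pow, ← map_mul, mk_eq_zero]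
    intro y hy
    have := hp y hy
    rw [mul_zero] at this
    exact this

/-- the index of the gluing -/
def GJ {ι : Type u} (X : ι → Chart AA) : Type u :=
  {c : Chart AA // (∃ i, Ref c (X i)) ∧ ∀ i, Op (X i) c}

instance {ι : Type u} (X : ι → Chart AA) : Preorder (GJ X) where
  le c d := Ref c.1 d.1
  le_refl c := Ref.refl c.1
  le_trans _ _ _ h h' := h.trans h'

lemma Op.sup {q c d : Chart AA} (h : Op q c) (h' : Op q d) : Op q (c.sup d) := by
  intro P hP
  obtain ⟨s, hs, hsP, hsV, hsN⟩ := h P (hP.mono ((Ref.refl q).sup_sup (sup_left c d)))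
  obtain ⟨t, ht, htP, htV, htN⟩ := h' P (hP.mono ((Ref.refl q).sup_sup (sup_right c d)))
  have hD : Dom (s * t) = Dom s ∩ Dom t := by
    ext y; simp [Dom, IsUnit.mul_iff]
  refine ⟨s * t, mul_mem hs ht, (hP.mono (sup_left q _)).not_mul hs ht hsP htP, ?_, ?_⟩
  · rw [hD]
    exact fun y hy => ⟨hsV ⟨hy.1, hy.2.1⟩, htV ⟨hy.1, hy.2.2⟩⟩
  · refine sup_le (hsN.trans (Loc_mul hs ht)) (htN.trans ?_)
    rw [mul_comm]
    exact Loc_mul ht hs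

/-- join in the index -/
def GJ.sup {ι : Type u} {X : ι → Chart AA} (c d : GJ X) : GJ X :=
  ⟨c.1.sup d.1, by
    obtain ⟨i, hi⟩ := c.2.1
    exact ⟨i, (sup_left _ _).trans hi⟩, fun i => (c.2.2 i).sup (d.2.2 i)⟩

lemma GJ.op {ι : Type u} {X : ι → Chart AA} (c d : GJ X) : Op c.1 d.1 := by
  obtain ⟨i, hi⟩ := c.2.1
  exact (d.2.2 i).bc hi

/-- the diagram -/
noncomputable def GF {ι : Type u} (X : ι → Chart AA) : GJ X ⥤ Scheme.{u} where
  obj c := Spec (.of (Qr c.1))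
  map {c d} h := Spec.map (CommRingCat.ofHom (qmap (leOfHom h)))
  map_id c := by
    have : qmap (Ref.refl c.1) = RingHom.id _ := qhom_ext (fun x hx => rfl)
    change Spec.map (CommRingCat.ofHom (qmap (Ref.refl c.1))) = _
    rw [this]; exact Spec.map_id _
  map_comp {c d e} h h' := by
    rw [← Spec.map_comp, ← CommRingCat.ofHom_comp]
    congr 2
    exact qhom_ext (fun x hx => rfl)

instance {ι : Type u} (X : ι → Chart AA) {c d : GJ X} (h : c ⟶ d) : IsOpenImmersion ((GF X).map h) :=
  qmap_open (leOfHom h) (GJ.op d c)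

lemma exists_fld {R : Type u} [CommRing R] (I : Ideal R) (hI : I.IsPrime) :
    ∃ (K : Type u) (_ : Field K) (ε : R →+* K), ∀ q, ε q = 0 ↔ q ∈ I :=
  ⟨I.ResidueField, inferInstance, algebraMap R _, fun _ => Ideal.algebraMap_residueField_eq_zero⟩

/-- two points of refinements with the same image come from the join -/
lemma join_pt' {k c d : Chart AA} (hc : Ref c k) (hd : Ref d k) (oc : Op k c) (od : Op k d)
    (I : Ideal (Qr c)) (hI : I.IsPrime) (I' : Ideal (Qr d)) (hI' : I'.IsPrime)
    (h' : ∀ z (hz : z ∈ k.N), mk c ⟨z, hc.2 hz⟩ ∈ I ↔ mk d ⟨z, hd.2 hz⟩ ∈ I') :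
    ∃ W : Ideal (Qr (c.sup d)), W.IsPrime ∧ (∀ q, qmap (sup_left c d) q ∈ W ↔ q ∈ I) ∧
      (∀ q, qmap (sup_right c d) q ∈ W ↔ q ∈ I') := by
  obtain ⟨s, hs, hsP, hsV, hsN⟩ := oc _ ((idPt c I hI).mono (Ref.sup hc (Ref.refl c)))
  obtain ⟨t, ht, htP, htV, htN⟩ := od _ ((idPt d I' hI').mono (Ref.sup hd (Ref.refl d)))
  have hs1 : mk c ⟨s, hc.2 hs⟩ ∉ I := fun hh => hsP ⟨_, hh⟩
  have ht1 : mk c ⟨t, hc.2 ht⟩ ∉ I := fun hh => htP ⟨hd.2 ht, (h' t ht).1 hh⟩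
  have hst1 : mk c ⟨s * t, hc.2 (mul_mem hs ht)⟩ ∉ I := by
    have e : mk c ⟨s * t, hc.2 (mul_mem hs ht)⟩ = mk c ⟨s, hc.2 hs⟩ * mk c ⟨t, hc.2 ht⟩ := by
      rw [← map_mul]; rfl
    rw [e]
    exact fun hh => (hI.mem_or_mem hh).elim hs1 ht1
  obtain ⟨K, _, ε, hε⟩ := exists_fld I hI
  obtain ⟨φ, hφ, hφ0⟩ : ∃ φ : k.N →+* K, Kil k.V φ ∧
      ∀ z (hz : z ∈ k.N), φ ⟨z, hz⟩ = 0 ↔ mk c ⟨z, hc.2 hz⟩ ∈ I :=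
    ⟨(ε.comp (qmap hc)).comp (mk k), comp_kil _, fun z hz => by
      rw [RingHom.comp_apply, RingHom.comp_apply, qmap_mk, hε]⟩
  have hst : s * t ∈ k.N := mul_mem hs ht
  obtain ⟨ψ, hψ, hψk⟩ := exthom k hst φ hφ (isUnit_iff_ne_zero.2 (by rw [Ne, hφ0]; exact hst1))
  have hD : Dom (s * t) = Dom s ∩ Dom t := by
    ext y; simp [Dom, IsUnit.mul_iff]
  have hle1 : c.N ≤ k.Loc (s * t) := hsN.trans (Loc_mul hs ht)
  have hle2 : d.N ≤ k.Loc (s * t) := htN.trans (by rw [mul_comm]; exact Loc_mul ht hs)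
  have hle : (c.sup d).N ≤ k.Loc (s * t) := sup_le hle1 hle2
  obtain ⟨g, hg⟩ : ∃ g : Qr (c.sup d) →+* K, ∀ z (hz : z ∈ (c.sup d).N),
      g (mk _ ⟨z, hz⟩) = ψ ⟨z, hle hz⟩ := by
    refine ⟨qlift (ψ.comp (Subring.inclusion hle)) (fun z hz => hψk _ (hz.mono ?_)), fun z hz => rfl⟩
    rw [hD]
    exact fun y hy => ⟨hsV ⟨hy.1, hy.2.1⟩, htV ⟨hy.1, hy.2.2⟩⟩
  have key : ∀ (e : Chart AA) (he : Ref e k) (J : Ideal (Qr e)) (_ : J.IsPrime) (hse : Ref (c.sup d) e)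
      (_ : ∀ z (hz : z ∈ k.N), mk c ⟨z, hc.2 hz⟩ ∈ I ↔ mk e ⟨z, he.2 hz⟩ ∈ J)
      (_ : e.N ≤ k.Loc (s * t)), ∀ q, qmap hse q ∈ RingHom.ker g ↔ q ∈ J := by
    intro e he J hJ hse hx₁ hel q
    obtain ⟨z, hz, rfl⟩ := mk_surj e q
    rw [RingHom.mem_ker, qmap_mk, hg]
    obtain ⟨p, w, hw, eq⟩ := hel hz hst
    have e1 := hψk.pow_mul (le_Loc _ _ hst) (hel hz) (le_Loc _ _ hw) eq
    rw [hψ ⟨_, hst⟩, hψ ⟨_, hw⟩] at e1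
    have hne : φ ⟨s * t, hst⟩ ^ p ≠ 0 := pow_ne_zero _ (by rw [Ne, hφ0]; exact hst1)
    obtain ⟨r, hr⟩ := e.L0 (x := (s * t) ^ p * z) (z := w) (s := s * t)
      (mul_mem (pow_mem (he.2 hst) _) hz) (he.2 hw) (he.2 hst)
      (eq.mono (Set.inter_subset_inter_left _ he.1))
    have hst2 : mk e ⟨s * t, he.2 hst⟩ ∉ J := by rw [← hx₁ _ hst]; exact hst1
    have e2 : mk e ⟨s * t, he.2 hst⟩ ^ (r + p) * mk e ⟨z, hz⟩ =
        mk e ⟨s * t, he.2 hst⟩ ^ r * mk e ⟨w, he.2 hw⟩ := by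
      have := (mk_kil e).pow_mul (p := r + p) (z := (s * t) ^ r * w) (he.2 hst) hz
        (mul_mem (pow_mem (he.2 hst) _) (he.2 hw)) (by rw [pow_add, mul_assoc]; exact hr)
      rw [this, ← map_pow, ← map_mul]; rfl
    have i1 : ψ ⟨z, hel hz⟩ = 0 ↔ φ ⟨w, hw⟩ = 0 := by
      rw [← e1, mul_eq_zero, or_iff_right hne]
    rw [i1, hφ0, hx₁ _ hw]
    have hp1 := fun n => mt (hJ.mem_of_pow_mem n) hst2
    constructor
    · intro hh
      have := J.mul_mem_left (mk e ⟨s * t, he.2 hst⟩ ^ r) hh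
      rw [← e2] at this
      exact (hJ.mem_or_mem this).resolve_left (hp1 _)
    · intro hh
      have := J.mul_mem_left (mk e ⟨s * t, he.2 hst⟩ ^ (r + p)) hh
      rw [e2] at this
      exact (hJ.mem_or_mem this).resolve_left (hp1 _)
  exact ⟨RingHom.ker g, RingHom.ker_isPrime g, key c hc I hI (sup_left c d) (fun z hz => Iff.rfl) hle1,
    key d hd I' hI' (sup_right c d) h' hle2⟩

lemma join_pt {k c d : Chart AA} (hc : Ref c k) (hd : Ref d k) (oc : Op k c) (od : Op k d)
    (x : PrimeSpectrum (Qr c)) (x' : PrimeSpectrum (Qr d))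
    (h : PrimeSpectrum.comap (qmap hc) x = PrimeSpectrum.comap (qmap hd) x') :
    ∃ w : PrimeSpectrum (Qr (c.sup d)), PrimeSpectrum.comap (qmap (sup_left c d)) w = x ∧
      PrimeSpectrum.comap (qmap (sup_right c d)) w = x' := by
  obtain ⟨W, hW, h1, h2⟩ := join_pt' hc hd oc od x.asIdeal x.2 x'.asIdeal x'.2 (fun z hz => by
    have := congrArg (fun t : PrimeSpectrum (Qr k) => mk k ⟨z, hz⟩ ∈ t.asIdeal) h
    simp only [PrimeSpectrum.comap_asIdeal, Ideal.mem_comap, qmap_mk] at this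
    rw [this])
  refine ⟨⟨W, hW⟩, PrimeSpectrum.ext (Ideal.ext fun q => ?_), PrimeSpectrum.ext (Ideal.ext fun q => ?_)⟩
  · rw [PrimeSpectrum.comap_asIdeal, Ideal.mem_comap]; exact h1 q
  · rw [PrimeSpectrum.comap_asIdeal, Ideal.mem_comap]; exact h2 q

instance {ι : Type u} (X : ι → Chart AA) : (GF X ⋙ Scheme.forget).IsLocallyDirected where
  cond {c d k} fc fd x x' h := by
    obtain ⟨w, h1, h2⟩ := join_pt (leOfHom fc) (leOfHom fd) (GJ.op k c) (GJ.op k d) x x' h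
    exact ⟨c.sup d, homOfLE (sup_left _ _), homOfLE (sup_right _ _), w, h1, h2⟩

/-- structure map on rings -/
def BData.γ (BB : BData AA) (c : Chart AA) : BB.C →+* Qr c :=
  (Ngt.mk c).comp ((BB.σ.comp BB.ρ).codRestrict c.N (fun t => c.base_le (BB.mem t)))

lemma qmap_γ (BB : BData AA) {c d : Chart AA} (h : Ref d c) : (qmap h).comp (BB.γ c) = BB.γ d := rfl

/-- the spectrum of a chart -/
noncomputable abbrev SQ (c : Chart AA) : Scheme.{u} := Spec (.of (Qr c))

/-- transition maps of spectra -/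
noncomputable def sq {c d : Chart AA} (h : Ref d c) : SQ d ⟶ SQ c :=
  Spec.map (CommRingCat.ofHom (qmap h))

/-- The glued scheme. -/
lemma exists_glue (BB : BData AA) {ι : Type u} (X : ι → Chart AA) (hop : ∀ i j, Op (X i) (X j)) :
    ∃ (Z : Scheme.{u}) (m : ∀ i, SQ (X i) ⟶ Z) (π : Z ⟶ Spec (.of BB.C)),
      (∀ i, IsOpenImmersion (m i)) ∧ (∀ i, m i ≫ π = Spec.map (CommRingCat.ofHom (BB.γ (X i)))) ∧
      (∀ z : Z, ∃ i, ∃ x, m i x = z) ∧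
      (∀ i j, sq (sup_left (X i) (X j)) ≫ m i =
        sq (sup_right (X i) (X j)) ≫ m j) ∧
      (∀ i j (x : SQ (X i)) (x' : SQ (X j)), m i x = m j x' →
        ∃ w : SQ ((X i).sup (X j)),
        sq (sup_left (X i) (X j)) w = x ∧
        sq (sup_right (X i) (X j)) w = x') := by
  let e : ι → GJ X := fun i => ⟨X i, ⟨i, Ref.refl _⟩, fun j => hop j i⟩
  let coc : Cocone (GF X) :=
    { pt := Spec (.of BB.C)
      ι := { app := fun c => Spec.map (CommRingCat.ofHom (BB.γ c.1))
             naturality := fun c d h => by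
              change Spec.map (CommRingCat.ofHom (qmap (leOfHom h))) ≫ Spec.map (CommRingCat.ofHom (BB.γ d.1)) =
                Spec.map (CommRingCat.ofHom (BB.γ c.1)) ≫ 𝟙 _
              rw [← Spec.map_comp, ← CommRingCat.ofHom_comp, qmap_γ, Category.comp_id] } }
  refine ⟨colimit (GF X), fun i => colimit.ι (GF X) (e i), colimit.desc (GF X) coc, ?_, ?_, ?_, ?_, ?_⟩
  · intro i; exact (inferInstance : IsOpenImmersion (colimit.ι (GF X) (e i)))
  · intro i; exact colimit.ι_desc coc (e i)
  · intro z
    obtain ⟨c, x, rfl⟩ := Scheme.IsLocallyDirected.ι_jointly_surjective (GF X) z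
    obtain ⟨i, hi⟩ := c.2.1
    refine ⟨i, (GF X).map (homOfLE hi : c ⟶ e i) x, ?_⟩
    have h1 := colimit.w (GF X) (homOfLE hi : c ⟶ e i)
    have h2 : ((GF X).map (homOfLE hi : c ⟶ e i) ≫ colimit.ι (GF X) (e i)) x = colimit.ι (GF X) c x := by
      rw [h1]
    exact h2
  · intro i j
    have h1 := colimit.w (GF X) (homOfLE (sup_left _ _) : (e i).sup (e j) ⟶ e i)
    have h2 := colimit.w (GF X) (homOfLE (sup_right _ _) : (e i).sup (e j) ⟶ e j)
    exact h1.trans h2.symm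
  · intro i j x x' h
    obtain ⟨k, fi, fj, w, h1, h2⟩ := (Scheme.IsLocallyDirected.ι_eq_ι_iff (GF X)).1 h
    have hk : k ≤ (e i).sup (e j) := Ref.sup (leOfHom fi) (leOfHom fj)
    refine ⟨(GF X).map (homOfLE hk) w, ?_, ?_⟩
    · rw [← h1]
      change (GF X).map (homOfLE (sup_left _ _) : (e i).sup (e j) ⟶ e i) ((GF X).map (homOfLE hk) w) = _
      rw [← Scheme.Hom.comp_apply, ← Functor.map_comp]; rfl
    · rw [← h2]
      change (GF X).map (homOfLE (sup_right _ _) : (e i).sup (e j) ⟶ e j) ((GF X).map (homOfLE hk) w) = _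
      rw [← Scheme.Hom.comp_apply, ← Functor.map_comp]; rfl

end Abstract
end Ngt

namespace Ngt

lemma factor_local {Z W : Scheme.{u}} (m : W ⟶ Z) [IsOpenImmersion m] {R : Type u} [CommRing R]
    [IsLocalRing R] (f : Spec (.of R) ⟶ Z)
    (h : f (IsLocalRing.closedPoint R) ∈ Set.range m) : ∃ g : Spec (.of R) ⟶ W, g ≫ m = f := by
  refine ⟨IsOpenImmersion.lift m f ?_, IsOpenImmersion.lift_fac _ _ _⟩
  rintro _ ⟨x, rfl⟩
  exact ((IsLocalRing.specializes_closedPoint (R := R) x).map f.continuous).mem_open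
    m.isOpenEmbedding.isOpen_range h

lemma exists_range {Q R K : Type u} [CommRing Q] [CommRing R] [Field K] [Algebra R K]
    (hinj : Function.Injective (algebraMap R K)) (φ : Q →+* K)
    (h : ∀ q, φ q ∈ (algebraMap R K).range) :
    ∃ ψ : Q →+* R, (algebraMap R K).comp ψ = φ := by
  let e := RingEquiv.ofBijective (algebraMap R K).rangeRestrict
    ⟨fun a b hab => hinj (congrArg Subtype.val hab), (algebraMap R K).rangeRestrict_surjective⟩
  refine ⟨e.symm.toRingHom.comp (φ.codRestrict _ h), ?_⟩
  ext q
  have : e (e.symm (φ.codRestrict _ h q)) = φ.codRestrict _ h q := e.apply_symm_apply _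
  exact congrArg Subtype.val this

lemma spec_surj {R S : Type u} [CommRing R] [CommRing S] (f : Spec (.of S) ⟶ Spec (.of R)) :
    ∃ φ : R →+* S, f = Spec.map (CommRingCat.ofHom φ) := by
  obtain ⟨φ, rfl⟩ := Spec.map_surjective f
  exact ⟨φ.hom, rfl⟩

lemma spec_inj {R S : Type u} [CommRing R] [CommRing S] {φ ψ : R →+* S}
    (h : Spec.map (CommRingCat.ofHom φ) = Spec.map (CommRingCat.ofHom ψ)) : φ = ψ := by
  have := Spec.map_injective h
  exact congrArg CommRingCat.Hom.hom this

section Abstract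

variable {Y : Type u} {O : Y → Type u} [∀ y, CommRing (O y)] {AA : Amb O}

open Chart

/-- glued scheme -/
structure Glue (BB : BData AA) {ι : Type u} (X : ι → Chart AA) where
  Z : Scheme.{u}
  m : ∀ i, SQ (X i) ⟶ Z
  π : Z ⟶ Spec (.of BB.C)
  mo : ∀ i, IsOpenImmersion (m i)
  mπ : ∀ i, m i ≫ π = Spec.map (CommRingCat.ofHom (BB.γ (X i)))
  cov : ∀ z : Z, ∃ i, ∃ x, m i x = z
  comm : ∀ i j, sq (sup_left (X i) (X j)) ≫ m i = sq (sup_right (X i) (X j)) ≫ m j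
  pt : ∀ i j (x : SQ (X i)) (x' : SQ (X j)), m i x = m j x' →
        ∃ w : SQ ((X i).sup (X j)), sq (sup_left (X i) (X j)) w = x ∧
        sq (sup_right (X i) (X j)) w = x'

lemma nonempty_glue (BB : BData AA) {ι : Type u} (X : ι → Chart AA) (hop : ∀ i j, Op (X i) (X j)) :
    Nonempty (Glue BB X) := by
  obtain ⟨Z, m, π, h1, h2, h3, h4, h5⟩ := exists_glue BB X hop
  exact ⟨⟨Z, m, π, h1, h2, h3, h4, h5⟩⟩

attribute [instance] Glue.mo

lemma FG.finiteType {BB : BData AA} {c : Chart AA} (h : FG c) : (BB.γ c).FiniteType := by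
  classical
  obtain ⟨G, hG, hM⟩ := h
  let _ := (BB.γ c).toAlgebra
  change Algebra.FiniteType BB.C (Qr c)
  let T : Finset (Qr c) := G.attach.image (fun x => mk c ⟨x.1, hG x.2⟩)
  refine ⟨T, ?_⟩
  let A := Algebra.adjoin BB.C (T : Set (Qr c))
  have key := hM ((A.toSubring.comap (mk c)).map c.N.subtype) ?_ ?_ ?_
  · rw [eq_top_iff]
    intro q _
    obtain ⟨x, hx, rfl⟩ := mk_surj c q
    obtain ⟨⟨z, hz⟩, h1, rfl⟩ := key hx
    exact h1
  · intro x hx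
    rw [BB.base_eq] at hx
    obtain ⟨t, rfl⟩ := hx
    exact ⟨⟨_, c.base_le (BB.mem t)⟩, A.algebraMap_mem t, rfl⟩
  · intro x hx
    refine ⟨⟨x, hG hx⟩, Algebra.subset_adjoin ?_, rfl⟩
    exact Finset.mem_image.2 ⟨⟨x, hx⟩, Finset.mem_attach _ _, rfl⟩
  · intro x hx
    refine ⟨⟨x, c.zero x hx⟩, ?_, rfl⟩
    change mk c _ ∈ A
    rw [mk_eq_zero.2 hx]
    exact A.zero_mem

namespace Glue
variable {BB : BData AA} {ι : Type u} {X : ι → Chart AA} (G : Glue BB X)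

/-- cover -/
noncomputable def cover : G.Z.OpenCover :=
  Scheme.Cover.mkOfCovers ι (fun i => SQ (X i)) G.m G.cov (fun i => G.mo i)

lemma lft (hfg : ∀ i, FG (X i)) : LocallyOfFiniteType G.π := by
  have : IsZariskiLocalAtSource @LocallyOfFiniteType.{u} := HasRingHomProperty.instIsZariskiLocalAtSource
  rw [IsZariskiLocalAtSource.iff_of_openCover (P := @LocallyOfFiniteType) G.cover]
  suffices h : ∀ i, LocallyOfFiniteType (G.m i ≫ G.π) from h
  intro i
  rw [G.mπ]
  exact (HasRingHomProperty.Spec_iff (P := @LocallyOfFiniteType)).2 (hfg i).finiteType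

lemma compact [Finite ι] : CompactSpace G.Z := by
  constructor
  have : (Set.univ : Set G.Z) = ⋃ i, Set.range (G.m i) := by
    ext z
    obtain ⟨i, x, rfl⟩ := G.cov z
    simp only [Set.mem_univ, Set.mem_iUnion, true_iff]
    exact ⟨i, x, rfl⟩
  rw [this]
  exact isCompact_iUnion (fun i => isCompact_range (G.m i).continuous)

lemma kfac {K : Type u} [Field K] {i j : ι} (α : Spec (.of K) ⟶ SQ (X i)) (β : Spec (.of K) ⟶ SQ (X j))
    (hop : Op (X i) (X j))
    (h : α ≫ G.m i = β ≫ G.m j) : ∃ κ : Spec (.of K) ⟶ SQ ((X i).sup (X j)),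
      κ ≫ sq (sup_left (X i) (X j)) = α ∧ κ ≫ sq (sup_right (X i) (X j)) = β := by
  have hp : G.m i (α (IsLocalRing.closedPoint K)) = G.m j (β (IsLocalRing.closedPoint K)) := by
    exact congrArg (fun t : Spec (.of K) ⟶ G.Z => t (IsLocalRing.closedPoint K)) h
  obtain ⟨w, h1, h2⟩ := G.pt i j _ _ hp
  have : IsOpenImmersion (sq (sup_left (X i) (X j))) :=
    qmap_open _ (Op.sup (Op.of_ref (Ref.refl _)) hop)
  obtain ⟨κ, hκ⟩ := factor_local (sq (sup_left (X i) (X j))) α ⟨w, h1⟩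
  refine ⟨κ, hκ, ?_⟩
  rw [← cancel_mono (G.m j), Category.assoc, ← G.comm, ← Category.assoc, hκ, h]

lemma exist (hcov : Cov X) (hop : ∀ i j, Op (X i) (X j)) : ValuativeCriterion.Existence G.π := by
  intro S
  obtain ⟨R, K, i₁, i₂, sq'⟩ := S
  obtain ⟨i, x, hx⟩ := G.cov (i₁ (IsLocalRing.closedPoint K))
  obtain ⟨g, hg⟩ := factor_local (G.m i) i₁ ⟨x, hx⟩
  obtain ⟨φ, rfl⟩ := spec_surj g
  obtain ⟨r, rfl⟩ := spec_surj i₂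
  have hinj : Function.Injective (algebraMap R K) := IsFractionRing.injective R K
  have w := sq'.w
  have hr : φ.comp (BB.γ (X i)) = (algebraMap R K).comp r := by
    apply spec_inj
    rw [CommRingCat.ofHom_comp, CommRingCat.ofHom_comp, Spec.map_comp, Spec.map_comp, ← w, ← hg,
      Category.assoc, G.mπ]
  let OO : ValuationSubring K :=
    { (algebraMap R K).range with
      mem_or_inv_mem' := fun x => by
        rcases ValuationRing.isInteger_or_isInteger R x with h | h
        · exact Or.inl h
        · exact Or.inr h }
  obtain ⟨j, χ, hk, h1, h2⟩ := hcov.full hop i K OO (φ.comp (Ngt.mk (X i))) (comp_kil φ) (by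
    intro x hx
    have hx' := hx
    rw [BB.base_eq] at hx'
    obtain ⟨t, rfl⟩ := hx'
    exact ⟨r t, (RingHom.congr_fun hr t).symm⟩)
  obtain ⟨ψ, hψ⟩ := exists_range hinj ((qlift χ hk).comp (qmap (sup_right (X i) (X j)))) (by
    intro q
    obtain ⟨x, hx, rfl⟩ := mk_surj _ q
    exact h2 ⟨x, hx⟩)
  have hφ : (qlift χ hk).comp (qmap (sup_left (X i) (X j))) = φ :=
    qhom_ext (fun x hx => h1 ⟨x, hx⟩)
  have e1 : Spec.map (CommRingCat.ofHom (algebraMap R K)) ≫ Spec.map (CommRingCat.ofHom ψ) =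
      Spec.map (CommRingCat.ofHom (qlift χ hk)) ≫ sq (sup_right (X i) (X j)) := by
    rw [sq, ← Spec.map_comp, ← Spec.map_comp, ← CommRingCat.ofHom_comp, ← CommRingCat.ofHom_comp, hψ]
  have e2 : Spec.map (CommRingCat.ofHom φ) =
      Spec.map (CommRingCat.ofHom (qlift χ hk)) ≫ sq (sup_left (X i) (X j)) := by
    rw [sq, ← Spec.map_comp, ← CommRingCat.ofHom_comp, hφ]
  refine ⟨⟨⟨Spec.map (CommRingCat.ofHom ψ) ≫ G.m j, ?_, ?_⟩⟩⟩
  · rw [← Category.assoc, e1, Category.assoc, ← G.comm, ← Category.assoc, ← e2, hg]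
  · rw [Category.assoc, G.mπ, ← Spec.map_comp, ← CommRingCat.ofHom_comp]
    congr 2
    refine RingHom.ext fun t => hinj ?_
    have a1 := RingHom.congr_fun hr t
    have a2 := RingHom.congr_fun hψ (BB.γ (X j) t)
    have a3 := RingHom.congr_fun hφ (BB.γ (X i) t)
    simp only [RingHom.comp_apply] at a1 a2 a3 ⊢
    rw [a2, ← a1, ← a3]
    rfl

lemma uniq (hop : ∀ i j, Op (X i) (X j)) : ValuativeCriterion.Uniqueness G.π := by
  intro S
  obtain ⟨R, K, i₁, i₂, sq'⟩ := S
  constructor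
  rintro ⟨l, hl, hl2⟩ ⟨l', hl', hl2'⟩
  obtain ⟨i, x, hx⟩ := G.cov (l (IsLocalRing.closedPoint R))
  obtain ⟨j, x', hx'⟩ := G.cov (l' (IsLocalRing.closedPoint R))
  obtain ⟨g, hg⟩ := factor_local (G.m i) l ⟨x, hx⟩
  obtain ⟨g', hg'⟩ := factor_local (G.m j) l' ⟨x', hx'⟩
  obtain ⟨α, rfl⟩ := spec_surj g
  obtain ⟨β, rfl⟩ := spec_surj g'
  have hinj : Function.Injective (algebraMap R K) := IsFractionRing.injective R K
  obtain ⟨κ, h1, h2⟩ := G.kfac (Spec.map (CommRingCat.ofHom (algebraMap R K)) ≫ Spec.map (CommRingCat.ofHom α))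
    (Spec.map (CommRingCat.ofHom (algebraMap R K)) ≫ Spec.map (CommRingCat.ofHom β)) (hop i j) (by
      rw [Category.assoc, Category.assoc, hg, hg', hl, hl'])
  obtain ⟨k, rfl⟩ := spec_surj κ
  rw [sq, ← Spec.map_comp, ← Spec.map_comp, ← CommRingCat.ofHom_comp, ← CommRingCat.ofHom_comp] at h1 h2
  have h1 := spec_inj h1
  have h2 := spec_inj h2
  have hle : ((X i).sup (X j)).N ≤ (((algebraMap R K).range).comap (k.comp (Ngt.mk _))).map
      ((X i).sup (X j)).N.subtype := by
    refine sup_le (fun x hx => ?_) (fun x hx => ?_)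
    · exact ⟨⟨x, (sup_left (X i) (X j)).2 hx⟩, ⟨α (Ngt.mk _ ⟨x, hx⟩), (RingHom.congr_fun h1 (Ngt.mk _ ⟨x, hx⟩)).symm⟩, rfl⟩
    · exact ⟨⟨x, (sup_right (X i) (X j)).2 hx⟩, ⟨β (Ngt.mk _ ⟨x, hx⟩), (RingHom.congr_fun h2 (Ngt.mk _ ⟨x, hx⟩)).symm⟩, rfl⟩
  obtain ⟨ψ, hψ⟩ := exists_range hinj k (by
    intro q
    obtain ⟨x, hx, rfl⟩ := mk_surj _ q
    obtain ⟨⟨z, hz⟩, h3, rfl⟩ := hle hx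
    exact h3)
  have e1 : ψ.comp (qmap (sup_left (X i) (X j))) = α := by
    refine RingHom.ext fun t => hinj ?_
    rw [← RingHom.comp_apply, ← RingHom.comp_assoc, hψ, h1]; rfl
  have e2 : ψ.comp (qmap (sup_right (X i) (X j))) = β := by
    refine RingHom.ext fun t => hinj ?_
    rw [← RingHom.comp_apply, ← RingHom.comp_assoc, hψ, h2]; rfl
  have : l = l' := by
    rw [← hg, ← hg', ← e1, ← e2, CommRingCat.ofHom_comp, CommRingCat.ofHom_comp, Spec.map_comp,
      Spec.map_comp, Category.assoc, Category.assoc]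
    exact congrArg (fun t => Spec.map (CommRingCat.ofHom ψ) ≫ t) (G.comm i j)
  subst this
  rfl

lemma proper [Finite ι] [IsNoetherianRing BB.C] (h : Inv BB X) (hop : ∀ i j, Op (X i) (X j)) :
    IsProper G.π := by
  have := G.lft h.fg
  have := G.compact
  have : IsLocallyNoetherian G.Z := LocallyOfFiniteType.isLocallyNoetherian G.π
  exact IsProper.of_valuativeCriterion _ (ValuativeCriterion.iff.2 ⟨G.exist h.cov hop, G.uniq hop⟩)

end Glue
end Abstract
end Ngt

namespace Ngt

section Geo

variable {Y : Scheme.{u}}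

/-- stalks -/
abbrev St (Y : Scheme.{u}) (y : Y) : Type u := Y.presheaf.stalk y

/-- germs -/
noncomputable def ge (U : Y.Opens) (y : Y) (hy : y ∈ U) : Γ(Y, U) →+* St Y y :=
  (Y.presheaf.germ U y hy).hom

/-- restrictions -/
noncomputable def rs {U V : Y.Opens} (h : V ≤ U) : Γ(Y, U) →+* Γ(Y, V) :=
  (Y.presheaf.map (homOfLE h).op).hom

lemma ge_rs {U V : Y.Opens} (h : V ≤ U) (y : Y) (hy : y ∈ V) (s : Γ(Y, U)) :
    ge V y hy (rs h s) = ge U y (h hy) s :=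
  TopCat.Presheaf.germ_res_apply Y.presheaf (homOfLE h) y hy s

lemma ge_ext {U : Y.Opens} {s t : Γ(Y, U)} (h : ∀ y hy, ge U y hy s = ge U y hy t) : s = t :=
  TopCat.Presheaf.section_ext Y.sheaf U s t h

lemma mem_bas {U : Y.Opens} (s : Γ(Y, U)) {y : Y} (hy : y ∈ U) :
    y ∈ Y.basicOpen s ↔ IsUnit (ge U y hy s) := Scheme.mem_basicOpen Y s y hy

open Classical in
/-- extension by zero -/
noncomputable def fn (U : Y.Opens) (s : Γ(Y, U)) : ∀ y, St Y y :=
  fun y => if h : y ∈ U then ge U y h s else 0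

lemma fn_eq {U : Y.Opens} (s : Γ(Y, U)) {y : Y} (h : y ∈ U) : fn U s y = ge U y h s := dif_pos h

/-- the sections -/
def gSec (V : Set Y) : Subring (∀ y, St Y y) where
  carrier := {x | ∃ (U : Y.Opens) (_ : V ⊆ U) (s : Γ(Y, U)), ∀ y (hy : y ∈ U), y ∈ V → x y = ge U y hy s}
  mul_mem' := by
    rintro a b ⟨U, hU, s, h⟩ ⟨W, hW, t, h'⟩
    refine ⟨U ⊓ W, Set.subset_inter hU hW, rs inf_le_left s * rs inf_le_right t, fun y hy hv => ?_⟩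
    rw [map_mul, ge_rs, ge_rs, ← h y hy.1 hv, ← h' y hy.2 hv]; rfl
  one_mem' := ⟨⊤, Set.subset_univ _, 1, fun y hy _ => by rw [map_one]; rfl⟩
  add_mem' := by
    rintro a b ⟨U, hU, s, h⟩ ⟨W, hW, t, h'⟩
    refine ⟨U ⊓ W, Set.subset_inter hU hW, rs inf_le_left s + rs inf_le_right t, fun y hy hv => ?_⟩
    rw [map_add, ge_rs, ge_rs, ← h y hy.1 hv, ← h' y hy.2 hv]; rfl
  zero_mem' := ⟨⊤, Set.subset_univ _, 0, fun y hy _ => by rw [map_zero]; rfl⟩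
  neg_mem' := by
    rintro a ⟨U, hU, s, h⟩
    refine ⟨U, hU, -s, fun y hy hv => ?_⟩
    rw [map_neg, ← h y hy hv]; rfl

lemma mem_gSec {V : Y.Opens} {x : ∀ y, St Y y} :
    x ∈ gSec (V : Set Y) ↔ ∃ s : Γ(Y, V), ∀ y hy, x y = ge V y hy s := by
  constructor
  · rintro ⟨U, hU, s, h⟩
    have hU' : V ≤ U := hU
    exact ⟨rs hU' s, fun y hy => by rw [ge_rs]; exact h y (hU hy) hy⟩
  · rintro ⟨s, h⟩
    exact ⟨V, subset_rfl, s, fun y hy _ => h y hy⟩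

lemma fn_mem {U : Y.Opens} (s : Γ(Y, U)) {V : Set Y} (h : V ⊆ U) : fn U s ∈ gSec V :=
  ⟨U, h, s, fun _ hy _ => fn_eq s hy⟩

/-- the section of a function -/
noncomputable def sec (V : Y.Opens) : gSec (V : Set Y) →+* Γ(Y, V) where
  toFun x := (mem_gSec.1 x.2).choose
  map_one' := ge_ext fun y hy => by
    rw [← (mem_gSec.1 (1 : gSec (V : Set Y)).2).choose_spec y hy, map_one]; rfl
  map_zero' := ge_ext fun y hy => by
    rw [← (mem_gSec.1 (0 : gSec (V : Set Y)).2).choose_spec y hy, map_zero]; rfl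
  map_mul' a b := ge_ext fun y hy => by
    rw [map_mul, ← (mem_gSec.1 a.2).choose_spec y hy, ← (mem_gSec.1 b.2).choose_spec y hy,
      ← (mem_gSec.1 (a * b).2).choose_spec y hy]; rfl
  map_add' a b := ge_ext fun y hy => by
    rw [map_add, ← (mem_gSec.1 a.2).choose_spec y hy, ← (mem_gSec.1 b.2).choose_spec y hy,
      ← (mem_gSec.1 (a + b).2).choose_spec y hy]; rfl

lemma ge_sec {V : Y.Opens} (x : gSec (V : Set Y)) (y : Y) (hy : y ∈ V) :
    ge V y hy (sec V x) = x.1 y := ((mem_gSec.1 x.2).choose_spec y hy).symm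

lemma sec_fn {V U : Y.Opens} (h : V ≤ U) (s : Γ(Y, U)) (hs : fn U s ∈ gSec (V : Set Y)) :
    sec V ⟨fn U s, hs⟩ = rs h s :=
  ge_ext fun y hy => by rw [ge_sec, ge_rs, ← fn_eq s (h hy)]

lemma rs_refl {V : Y.Opens} (s : Γ(Y, V)) : rs le_rfl s = s :=
  ge_ext fun y hy => by rw [ge_rs]

lemma rs_rs {U V W : Y.Opens} (h : V ≤ U) (h' : W ≤ V) (s : Γ(Y, U)) :
    rs h' (rs h s) = rs (h'.trans h) s :=
  ge_ext fun y hy => by rw [ge_rs, ge_rs, ge_rs]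

lemma sec_surj (V : Y.Opens) : Function.Surjective (sec V) := fun s =>
  ⟨⟨fn V s, fn_mem s subset_rfl⟩, by rw [sec_fn le_rfl, rs_refl]⟩

lemma sec_zero {V : Y.Opens} {x : gSec (V : Set Y)} :
    sec V x = 0 ↔ Van (V : Set Y) (x : ∀ y, St Y y) := by
  constructor
  · intro h y hy
    rw [← ge_sec x y hy, h, map_zero]
  · intro h
    exact ge_ext fun y hy => by rw [ge_sec, map_zero]; exact h y hy

lemma sec_eq {V : Y.Opens} {x z : gSec (V : Set Y)} :
    sec V x = sec V z ↔ EqV (V : Set Y) (x : ∀ y, St Y y) z := by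
  constructor
  · intro h y hy
    rw [← ge_sec x y hy, h, ge_sec]
  · intro h
    exact ge_ext fun y hy => by rw [ge_sec, ge_sec]; exact h y hy

lemma sec_bas {V : Y.Opens} (x : gSec (V : Set Y)) :
    (Y.basicOpen (sec V x) : Set Y) = (V : Set Y) ∩ Dom (x : ∀ y, St Y y) := by
  ext y
  constructor
  · intro h
    have hy : y ∈ V := Y.basicOpen_le _ h
    have := (mem_bas _ hy).1 h
    rw [ge_sec] at this
    exact ⟨hy, this⟩
  · rintro ⟨hy, h⟩
    refine (mem_bas _ hy).2 ?_
    rw [ge_sec]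
    exact h

lemma gL0 {V : Y.Opens} (hV : IsAffineOpen V) {x s : ∀ y, St Y y} (hx : x ∈ gSec (V : Set Y))
    (hs : s ∈ gSec (V : Set Y)) (h : Van ((V : Set Y) ∩ Dom s) x) :
    ∃ p : ℕ, Van (V : Set Y) (s ^ p * x) := by
  have hl := hV.isLocalization_basicOpen (sec V ⟨s, hs⟩)
  have h0 : algebraMap Γ(Y, V) Γ(Y, Y.basicOpen (sec V ⟨s, hs⟩)) (sec V ⟨x, hx⟩) =
      algebraMap Γ(Y, V) Γ(Y, Y.basicOpen (sec V ⟨s, hs⟩)) 0 := by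
    refine ge_ext fun y hy => ?_
    change ge _ y hy (rs (Y.basicOpen_le _) _) = ge _ y hy (rs (Y.basicOpen_le _) _)
    rw [ge_rs, ge_rs, map_zero, ge_sec]
    refine h y ?_
    rw [← sec_bas ⟨s, hs⟩]; exact hy
  rw [IsLocalization.eq_iff_exists (Submonoid.powers (sec V ⟨s, hs⟩))] at h0
  obtain ⟨⟨_, p, rfl⟩, hp⟩ := h0
  refine ⟨p, (sec_zero (x := (⟨s, hs⟩ : gSec (V : Set Y)) ^ p * ⟨x, hx⟩)).1 ?_⟩
  rw [map_mul, map_pow]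
  simpa using hp

lemma gL1 {V : Y.Opens} (hV : IsAffineOpen V) {x s : ∀ y, St Y y}
    (hs : s ∈ gSec (V : Set Y)) (hx : x ∈ gSec ((V : Set Y) ∩ Dom s)) :
    ∃ p : ℕ, ∃ z ∈ gSec (V : Set Y), EqV ((V : Set Y) ∩ Dom s) (s ^ p * x) z := by
  have hl := hV.isLocalization_basicOpen (sec V ⟨s, hs⟩)
  rw [← sec_bas ⟨s, hs⟩] at hx ⊢
  obtain ⟨p, a, ha⟩ := IsLocalization.Away.surj (sec V ⟨s, hs⟩) (sec (Y.basicOpen (sec V ⟨s, hs⟩)) ⟨x, hx⟩)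
  refine ⟨p, fn V a, fn_mem a subset_rfl, fun y hy => ?_⟩
  have hyV : y ∈ V := Y.basicOpen_le _ hy
  have := congrArg (ge _ y hy) ha
  change ge _ y hy (_ * (rs (Y.basicOpen_le _) _) ^ p) = ge _ y hy (rs (Y.basicOpen_le _) _) at this
  rw [map_mul, map_pow, ge_sec, ge_rs, ge_rs, ge_sec] at this
  rw [fn_eq _ hyV, ← this, mul_comm]
  rfl

lemma gInv {V : Y.Opens} (hV : IsAffineOpen V) {s : ∀ y, St Y y}
    (hs : s ∈ gSec (V : Set Y)) (h : (V : Set Y) ⊆ Dom s) : pinv s ∈ gSec (V : Set Y) := by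
  have hl := hV.isLocalization_basicOpen (sec V ⟨s, hs⟩)
  have e : Y.basicOpen (sec V ⟨s, hs⟩) = V := by
    apply SetLike.coe_injective
    rw [sec_bas]
    exact Set.inter_eq_left.2 h
  have hu : IsUnit (rs (Y.basicOpen_le _) (sec V ⟨s, hs⟩) : Γ(Y, Y.basicOpen (sec V ⟨s, hs⟩))) :=
    IsLocalization.Away.algebraMap_isUnit (sec V ⟨s, hs⟩)
  obtain ⟨t, ht⟩ := hu.exists_right_inv
  refine mem_gSec.2 ⟨rs e.ge t, fun y hy => ?_⟩
  have hy' : y ∈ Y.basicOpen (sec V ⟨s, hs⟩) := e.ge hy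
  have := congrArg (ge _ y hy') ht
  rw [map_mul, ge_rs, ge_sec, map_one] at this
  rw [ge_rs]
  have h2 := mul_pinv (h hy)
  calc pinv s y = pinv s y * (s y * ge _ y hy' t) := by rw [this, mul_one]
    _ = (s y * pinv s y) * ge _ y hy' t := by ring
    _ = _ := by rw [h2, one_mul]

variable (Y) in
/-- global functions -/
noncomputable def glob : Γ(Y, ⊤) →+* (∀ y, St Y y) where
  toFun s := fn ⊤ s
  map_one' := by funext y; rw [fn_eq _ (by trivial), map_one]; rfl
  map_zero' := by funext y; rw [fn_eq _ (by trivial), map_zero]; rfl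
  map_mul' a b := by
    funext y; rw [fn_eq _ (by trivial), map_mul, Pi.mul_apply, fn_eq _ (by trivial), fn_eq _ (by trivial)]
  map_add' a b := by
    funext y; rw [fn_eq _ (by trivial), map_add, Pi.add_apply, fn_eq _ (by trivial), fn_eq _ (by trivial)]

variable [Y.IsSeparated] {B C : Type u} [CommRing B] [CommRing C] [IsNoetherianRing C]

/-- the ambient data of a scheme -/
noncomputable def amb (β : B →+* Γ(Y, ⊤)) (ρ : C →+* B) (f0 : C) (hf : IsUnit (ρ f0)) :
    Amb (St Y) where
  Aff := {V | ∃ U : Y.Opens, IsAffineOpen U ∧ (U : Set Y) = V}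
  Sec := gSec
  inter := by
    rintro _ _ ⟨U, hU, rfl⟩ ⟨V, hV, rfl⟩
    exact ⟨U ⊓ V, hU.inf hV, rfl⟩
  basic := by
    rintro _ s ⟨U, hU, rfl⟩ hs
    exact ⟨_, hU.basicOpen (sec U ⟨s, hs⟩), sec_bas _⟩
  zero_mem {V x} h := ⟨⊤, Set.subset_univ _, 0, fun y hy hv => by rw [map_zero]; exact h y hv⟩
  anti {V W} h := by
    rintro x ⟨U, hU, s, hx⟩
    exact ⟨U, h.trans hU, s, fun y hy hv => hx y hy (h hv)⟩
  inv_mem := by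
    rintro _ s ⟨U, hU, rfl⟩ hs h
    exact gInv hU hs h
  L0 := by
    rintro _ x s ⟨U, hU, rfl⟩ hx hs h
    exact gL0 hU hx hs h
  L1 := by
    rintro _ x s ⟨U, hU, rfl⟩ hs hx
    exact gL1 hU hs hx
  f := glob Y (β (ρ f0))
  f_unit y := (((hf.map β).map (glob Y)).map (Pi.evalRingHom (St Y) y))
  base := (((glob Y).comp β).comp ρ).range
  base_noeth := isNoetherianRing_range _
  base_le V := by
    rintro _ ⟨t, rfl⟩
    exact fn_mem _ (Set.subset_univ _)
  f_mem := ⟨f0, rfl⟩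

/-- the base data of a scheme -/
noncomputable def bdata (β : B →+* Γ(Y, ⊤)) (ρ : C →+* B) (f0 : C) (hf : IsUnit (ρ f0)) :
    BData (amb β ρ f0 hf) where
  C := C
  B := B
  ρ := ρ
  σ := (glob Y).comp β
  σ_mem _ _ := fn_mem _ (Set.subset_univ _)
  base_eq := rfl
  f0 := f0
  f0_eq := rfl
  f0_unit := hf

end Geo
end Ngt

namespace Ngt

lemma pb_of_charts {W Z S S' : Scheme.{u}} (h0 : W ⟶ Z) (g : W ⟶ S') (π : Z ⟶ S) (r : S' ⟶ S)
    (UU : Z.OpenCover) (T : UU.I₀ → Scheme.{u}) (k : ∀ i, T i ⟶ UU.X i) (j : ∀ i, T i ⟶ W)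
    (h1 : ∀ i, IsPullback (k i) (j i) (UU.f i) h0)
    (h2 : ∀ i, IsPullback (k i) (j i ≫ g) (UU.f i ≫ π) r) : IsPullback h0 g π r := by
  refine Scheme.isPullback_of_openCover _ _ _ _ UU (fun i => ?_)
  refine (h2 i).of_iso ((h1 i).flip.isoPullback) (Iso.refl _) (Iso.refl _) (Iso.refl _) ?_ ?_ ?_ ?_
  · rw [Iso.refl_hom, Category.comp_id]
    exact ((h1 i).flip.isoPullback_hom_snd).symm
  · rw [Iso.refl_hom, Category.comp_id]
    exact (((h1 i).flip.isoPullback_hom_fst_assoc) g).symm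
  · simp
  · simp

section Geo

variable {Y : Scheme.{u}} [Y.IsSeparated] {B C : Type u} [CommRing B] [CommRing C]
  [IsNoetherianRing C] {β : B →+* Γ(Y, ⊤)} {ρ : C →+* B} {f0 : C} {hf : IsUnit (ρ f0)}

open Chart

/-- the open set of a chart -/
noncomputable def ope (c : Chart (amb β ρ f0 hf)) : Y.Opens := c.aff.choose

lemma ope_aff (c : Chart (amb β ρ f0 hf)) : IsAffineOpen (ope c) := c.aff.choose_spec.1

lemma ope_coe (c : Chart (amb β ρ f0 hf)) : (ope c : Set Y) = c.V := c.aff.choose_spec.2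

lemma mem_ope {c : Chart (amb β ρ f0 hf)} {y : Y} : y ∈ ope c ↔ y ∈ c.V := by
  rw [← ope_coe]; rfl

/-- sections over a chart -/
noncomputable def cs (c : Chart (amb β ρ f0 hf)) : (amb β ρ f0 hf).Sec c.V →+* Γ(Y, ope c) :=
  (sec (ope c)).comp (Subring.inclusion (show gSec c.V ≤ gSec (ope c : Set Y) by rw [ope_coe]))

lemma ge_cs {c : Chart (amb β ρ f0 hf)} (x : (amb β ρ f0 hf).Sec c.V) (y : Y) (hy : y ∈ ope c) :
    ge _ y hy (cs c x) = x.1 y := ge_sec _ y hy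

lemma cs_surj (c : Chart (amb β ρ f0 hf)) : Function.Surjective (cs c) := fun s => by
  obtain ⟨⟨x, hx⟩, rfl⟩ := sec_surj _ s
  exact ⟨⟨x, by rw [ope_coe] at hx; exact hx⟩, rfl⟩

lemma cs_zero {c : Chart (amb β ρ f0 hf)} {x : (amb β ρ f0 hf).Sec c.V} :
    cs c x = 0 ↔ Van c.V (x : ∀ y, St Y y) := by
  refine sec_zero.trans ?_
  have h : ∀ z : ∀ y, St Y y, Van (ope c : Set Y) z ↔ Van c.V z := fun z => by rw [ope_coe]
  exact h x

/-- the comparison of chart rings and sections -/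
noncomputable def th (c : Chart (amb β ρ f0 hf)) : Qr c →+* Γ(Y, ope c) :=
  qlift ((cs c).comp (Subring.inclusion c.le)) (fun _ hx => cs_zero.2 hx)

lemma th_mk (c : Chart (amb β ρ f0 hf)) (x : ∀ y, St Y y) (hx : x ∈ c.N) :
    th c (Ngt.mk c ⟨x, hx⟩) = cs c ⟨x, c.le hx⟩ := rfl

lemma ope_le {c d : Chart (amb β ρ f0 hf)} (h : Ref d c) : ope d ≤ ope c := fun _ hy =>
  mem_ope.2 (h.1 (mem_ope.1 hy))

lemma th_qmap {c d : Chart (amb β ρ f0 hf)} (h : Ref d c) :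
    (th d).comp (qmap h) = (rs (ope_le h)).comp (th c) := by
  refine qhom_ext fun x hx => ?_
  rw [RingHom.comp_apply, qmap_mk, th_mk, RingHom.comp_apply, th_mk]
  exact ge_ext fun y hy => by rw [ge_rs, ge_cs, ge_cs]

/-- the spectrum of sections -/
noncomputable abbrev TT (c : Chart (amb β ρ f0 hf)) : Scheme.{u} := Spec Γ(Y, ope c)

/-- chart map -/
noncomputable def jj (c : Chart (amb β ρ f0 hf)) : TT c ⟶ Y := (ope_aff c).fromSpec

instance (c : Chart (amb β ρ f0 hf)) : IsOpenImmersion (jj c) :=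
  inferInstanceAs (IsOpenImmersion (ope_aff c).fromSpec)

lemma jj_range (c : Chart (amb β ρ f0 hf)) : (jj c).opensRange = ope c :=
  (ope_aff c).opensRange_fromSpec

/-- map to the spectrum -/
noncomputable def kk (c : Chart (amb β ρ f0 hf)) : TT c ⟶ SQ c := Spec.map (CommRingCat.ofHom (th c))

lemma jj_map {c d : Chart (amb β ρ f0 hf)} (h : Ref d c) :
    Spec.map (CommRingCat.ofHom (rs (ope_le h))) ≫ jj c = jj d :=
  (ope_aff c).map_fromSpec (ope_aff d) (homOfLE (ope_le h)).op

lemma kk_map {c d : Chart (amb β ρ f0 hf)} (h : Ref d c) :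
    Spec.map (CommRingCat.ofHom (rs (ope_le h))) ≫ kk c = kk d ≫ sq h := by
  rw [kk, kk, sq, ← Spec.map_comp, ← Spec.map_comp, ← CommRingCat.ofHom_comp,
    ← CommRingCat.ofHom_comp, th_qmap]

lemma jj_g (c : Chart (amb β ρ f0 hf)) :
    jj c ≫ Y.toSpecΓ ≫ Spec.map (CommRingCat.ofHom β) =
      Spec.map (CommRingCat.ofHom ((rs le_top).comp β)) := by
  rw [jj, IsAffineOpen.fromSpec_toSpecΓ_assoc, ← Spec.map_comp]
  rfl

lemma cs_σ (c : Chart (amb β ρ f0 hf)) (b : B) (h) : cs c ⟨(bdata β ρ f0 hf).σ b, h⟩ = rs le_top (β b) := by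
  refine ge_ext fun y hy => ?_
  rw [ge_cs, ge_rs, ← fn_eq]
  rfl

lemma pb_aff {c : Chart (amb β ρ f0 hf)} (h : PB (bdata β ρ f0 hf) c) :
    IsPullback (kk c) (Spec.map (CommRingCat.ofHom ((rs le_top).comp β)))
      (Spec.map (CommRingCat.ofHom ((bdata β ρ f0 hf).γ c))) (Spec.map (CommRingCat.ofHom ρ)) := by
  refine isPullback_SpecMap_of_isPushout _ _ _ _ ?_
  have w : CommRingCat.ofHom ((bdata β ρ f0 hf).γ c) ≫ CommRingCat.ofHom (th c) =
      CommRingCat.ofHom ρ ≫ CommRingCat.ofHom ((rs (le_top : ope c ≤ ⊤)).comp β) := by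
    ext t
    exact cs_σ c (ρ t) _
  have H : ∀ (R : Type u) [CommRing R] (φ : Qr c →+* R) (b : B →+* R),
      φ.comp ((bdata β ρ f0 hf).γ c) = b.comp ρ →
      ∃ Φ : Γ(Y, ope c) →+* R, Φ.comp (th c) = φ ∧ Φ.comp ((rs le_top).comp β) = b := by
    intro R _ φ b hw
    obtain ⟨Φ, hk, hb, hx⟩ := h.ex R (φ.comp (Ngt.mk c)) b (comp_kil φ)
      (fun t => congrArg (fun (q : C →+* R) => q t) hw)
    refine ⟨(cs c).liftOfSurjective (cs_surj c) ⟨Φ, fun x hx => hk x (cs_zero.1 hx)⟩,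
      qhom_ext fun x hxN => ?_, RingHom.ext fun t => ?_⟩
    · rw [RingHom.comp_apply, th_mk]
      refine ((cs c).liftOfRightInverse_comp_apply _ _ _ _).trans ?_
      exact hx x hxN
    · rw [RingHom.comp_apply, RingHom.comp_apply, ← cs_σ c t ((bdata β ρ f0 hf).σ_mem _ _)]
      refine ((cs c).liftOfRightInverse_comp_apply _ _ _ _).trans ?_
      exact hb t
  have H2 : ∀ (R : Type u) [CommRing R] (Φ Ψ : Γ(Y, ope c) →+* R),
      Φ.comp (th c) = Ψ.comp (th c) → Φ.comp ((rs le_top).comp β) = Ψ.comp ((rs le_top).comp β) →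
      Φ = Ψ := by
    intro R _ Φ Ψ e1 e2
    have := h.un R (Φ.comp (cs c)) (Ψ.comp (cs c))
      (fun x hx => by rw [RingHom.comp_apply, cs_zero.2 hx, map_zero])
      (fun x hx => by rw [RingHom.comp_apply, cs_zero.2 hx, map_zero])
      (fun t => by
        have := congrArg (fun q : B →+* R => q t) e2
        rw [RingHom.comp_apply, RingHom.comp_apply, cs_σ c t]
        exact this)
      (fun x hx => congrArg (fun q : Qr c →+* R => q (Ngt.mk c ⟨x, hx⟩)) e1)
    refine RingHom.ext fun s => ?_
    obtain ⟨x, rfl⟩ := cs_surj c s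
    exact congrArg (fun q : (amb β ρ f0 hf).Sec c.V →+* R => q x) this
  choose D hD1 hD2 using H
  refine ⟨⟨w⟩, ⟨PushoutCocone.IsColimit.mk w
    (fun s => CommRingCat.ofHom (D s.pt s.inl.hom s.inr.hom (congrArg CommRingCat.Hom.hom s.condition)))
    (fun s => ?_) (fun s => ?_) (fun s q h1 h2 => ?_)⟩⟩
  · ext1
    exact hD1 _ _ _ _
  · ext1
    exact hD2 _ _ _ _
  · ext1
    refine H2 _ _ _ ?_ ?_
    · refine Eq.trans ?_ (hD1 _ _ _ _).symm
      exact congrArg CommRingCat.Hom.hom h1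
    · refine Eq.trans ?_ (hD2 _ _ _ _).symm
      exact congrArg CommRingCat.Hom.hom h2

variable {ι : Type u} {X : ι → Chart (amb β ρ f0 hf)} (G : Glue (bdata β ρ f0 hf) X)

/-- cover of the scheme by charts -/
noncomputable def ycov (hc : ∀ y, ∃ i, y ∈ (X i).V) : Y.OpenCover :=
  Scheme.Cover.mkOfCovers ι (fun i => TT (X i)) (fun i => jj (X i))
    (fun y => by
      obtain ⟨i, hi⟩ := hc y
      have : y ∈ (jj (X i)).opensRange := by rw [jj_range]; exact mem_ope.2 hi
      exact ⟨i, this⟩)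
    (fun i => inferInstance)

lemma glue_comp (i j : ι) :
    pullback.fst (jj (X i)) (jj (X j)) ≫ kk (X i) ≫ G.m i =
      pullback.snd (jj (X i)) (jj (X j)) ≫ kk (X j) ≫ G.m j := by
  let d := (X i).sup (X j)
  let p := pullback.fst (jj (X i)) (jj (X j)) ≫ jj (X i)
  have hp : Set.range p ⊆ Set.range (jj d) := by
    rintro _ ⟨w, rfl⟩
    have h1 : p w ∈ (jj (X i)).opensRange := ⟨pullback.fst (jj (X i)) (jj (X j)) w, rfl⟩
    have h2 : p w ∈ (jj (X j)).opensRange := ⟨pullback.snd (jj (X i)) (jj (X j)) w, by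
      change (pullback.snd (jj (X i)) (jj (X j)) ≫ jj (X j)) w = _
      rw [← pullback.condition]⟩
    rw [jj_range] at h1 h2
    have : p w ∈ (jj d).opensRange := by
      rw [jj_range]; exact mem_ope.2 ⟨mem_ope.1 h1, mem_ope.1 h2⟩
    exact this
  let l := IsOpenImmersion.lift (jj d) p hp
  have hl : l ≫ jj d = p := IsOpenImmersion.lift_fac _ _ _
  have e1 : pullback.fst (jj (X i)) (jj (X j)) =
      l ≫ Spec.map (CommRingCat.ofHom (rs (ope_le (sup_left (X i) (X j))))) := by
    rw [← cancel_mono (jj (X i)), Category.assoc, jj_map (sup_left (X i) (X j))]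
    exact hl.symm
  have e2 : pullback.snd (jj (X i)) (jj (X j)) =
      l ≫ Spec.map (CommRingCat.ofHom (rs (ope_le (sup_right (X i) (X j))))) := by
    rw [← cancel_mono (jj (X j)), Category.assoc, jj_map (sup_right (X i) (X j)), ← pullback.condition]
    exact hl.symm
  rw [e1, e2, Category.assoc, Category.assoc, reassoc_of% (kk_map (sup_left (X i) (X j))),
    reassoc_of% (kk_map (sup_right (X i) (X j))), G.comm]

lemma glue_pb (hc : ∀ y, ∃ i, y ∈ (X i).V) (hop : ∀ i j, Op (X i) (X j))
    (hpb : ∀ i, PB (bdata β ρ f0 hf) (X i)) :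
    ∃ h0 : Y ⟶ G.Z, IsPullback h0 (Y.toSpecΓ ≫ Spec.map (CommRingCat.ofHom β)) G.π
      (Spec.map (CommRingCat.ofHom ρ)) := by
  let h0 : Y ⟶ G.Z := (ycov hc).glueMorphisms (fun i => kk (X i) ≫ G.m i) (glue_comp G)
  have h0j : ∀ i, jj (X i) ≫ h0 = kk (X i) ≫ G.m i := fun i =>
    (ycov hc).ι_glueMorphisms (fun i => kk (X i) ≫ G.m i) (glue_comp G) i
  refine ⟨h0, pb_of_charts h0 _ G.π _ G.cover (fun i => TT (X i)) (fun i => kk (X i))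
    (fun i => jj (X i)) (fun (i : ι) => ?_) (fun (i : ι) => ?_)⟩
  · have := G.mo i
    suffices IsPullback (kk (X i)) (jj (X i)) (G.m i) h0 from this
    refine IsOpenImmersion.isPullback _ _ (G.m i) _ (h0j i) ?_
    rw [jj_range]
    ext y
    constructor
    · rintro ⟨x, hx⟩
      obtain ⟨k, hk⟩ := hc y
      have : y ∈ (jj (X k)).opensRange := by rw [jj_range]; exact mem_ope.2 hk
      obtain ⟨t, rfl⟩ := this
      have e : h0 (jj (X k) t) = G.m k (kk (X k) t) := by
        change (jj (X k) ≫ h0) t = _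
        rw [h0j]; rfl
      obtain ⟨w, -, hw⟩ := G.pt i k x (kk (X k) t) (hx.trans e)
      have hP := (idPt ((X i).sup (X k)) w.asIdeal w.2).mono (sup_comm' (X i) (X k))
      obtain ⟨s, hs, hsP, hsV, -⟩ := hop k i _ hP
      refine mem_ope.2 (hsV ?_)
      refine ⟨hk, ?_⟩
      have h1 : th (X k) (Ngt.mk (X k) ⟨s, hs⟩) ∉ t.asIdeal := by
        intro hh
        have h2 : Ngt.mk (X k) ⟨s, hs⟩ ∈ (kk (X k) t).asIdeal := hh
        rw [← hw] at h2
        exact hsP ⟨(sup_right (X i) (X k)).2 hs, h2⟩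
      have h3 : t ∈ (ope_aff (X k)).fromSpec ⁻¹ᵁ Y.basicOpen (th (X k) (Ngt.mk (X k) ⟨s, hs⟩)) := by
        rw [IsAffineOpen.fromSpec_preimage_basicOpen]
        exact h1
      have h4 : jj (X k) t ∈ Y.basicOpen (th (X k) (Ngt.mk (X k) ⟨s, hs⟩)) := h3
      have h5 := (mem_bas _ (mem_ope.2 hk)).1 h4
      rw [th_mk, ge_cs] at h5
      exact h5
    · intro hy
      have : y ∈ (jj (X i)).opensRange := by rw [jj_range]; exact hy
      obtain ⟨t, rfl⟩ := this
      refine ⟨kk (X i) t, ?_⟩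
      change (kk (X i) ≫ G.m i) t = (jj (X i) ≫ h0) t
      rw [h0j]
  · have := pb_aff (hpb i)
    rw [← jj_g] at this
    have e : Spec.map (CommRingCat.ofHom ((bdata β ρ f0 hf).γ (X i))) = G.m i ≫ G.π := (G.mπ i).symm
    exact e ▸ this

end Geo
end Ngt

namespace Ngt

section Abstract

variable {Y : Type u} {O : Y → Type u} [∀ y, CommRing (O y)]

open Chart

/-- standard charts -/
def std (AA : Amb O) (V : Set Y) (hV : V ∈ AA.Aff) {n : ℕ} (x : Fin n → ∀ y, O y)
    (hx : ∀ k, x k ∈ AA.Sec V) : Chart AA where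
  V := V
  aff := hV
  N := Subring.closure ((AA.base : Set (∀ y, O y)) ∪ {z | Van V z} ∪ Set.range (fun k => AA.f * x k))
  le := by
    rw [Subring.closure_le]
    rintro z ((hz | hz) | ⟨k, rfl⟩)
    · exact AA.base_le _ hz
    · exact AA.zero_mem hz
    · exact mul_mem (AA.base_le _ AA.f_mem) (hx k)
  zero z hz := Subring.subset_closure (Or.inl (Or.inr hz))
  base_le _ hz := Subring.subset_closure (Or.inl (Or.inl hz))

variable {AA : Amb O} {V : Set Y} {hV : V ∈ AA.Aff} {n : ℕ} {x : Fin n → ∀ y, O y}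
  {hx : ∀ k, x k ∈ AA.Sec V}

lemma std_le {M : Subring (∀ y, O y)} (h1 : AA.base ≤ M) (h2 : ∀ z, Van V z → z ∈ M)
    (h3 : ∀ k, AA.f * x k ∈ M) : (std AA V hV x hx).N ≤ M := by
  change Subring.closure _ ≤ M
  rw [Subring.closure_le]
  rintro z ((hz | hz) | ⟨k, rfl⟩)
  · exact h1 hz
  · exact h2 z hz
  · exact h3 k

lemma std_mem (k : Fin n) : AA.f * x k ∈ (std AA V hV x hx).N :=
  Subring.subset_closure (Or.inr ⟨k, rfl⟩)

lemma std_gen (k : Fin n) : x k ∈ (gen (std AA V hV x hx)).N :=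
  ⟨1, by rw [pow_one]; exact std_mem k⟩

lemma std_FG : FG (std AA V hV x hx) := by
  classical
  refine ⟨Finset.univ.image (fun k => AA.f * x k), ?_, fun M h1 h2 h3 => ?_⟩
  · intro z hz
    simp only [Finset.coe_image, Finset.coe_univ, Set.image_univ] at hz
    obtain ⟨k, rfl⟩ := hz
    exact std_mem k
  · exact std_le h1 h3 (fun k => h2 _ (Finset.mem_image_of_mem _ (Finset.mem_univ k)))

lemma gen_le_Loc (c : Chart AA) : (gen c).N ≤ c.Loc AA.f := by
  rintro z ⟨n, hz⟩
  exact (mem_Loc c.f_mem).2 ⟨n, _, hz, fun _ _ => rfl⟩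

lemma dom_f (c : Chart AA) : c.V ∩ Dom AA.f = c.V := Set.inter_eq_left.2 fun y _ => AA.f_unit y

/-- extension to the generic locus -/
lemma ext_gen (c : Chart AA) {R : Type u} [CommRing R] (φ : c.N →+* R) (hφ : Kil c.V φ)
    (hu : IsUnit (φ ⟨AA.f, c.f_mem⟩)) :
    ∃ ψ : (gen c).N →+* R, (∀ z (hz : z ∈ c.N) (hz' : z ∈ (gen c).N), ψ ⟨z, hz'⟩ = φ ⟨z, hz⟩) ∧ Kil c.V ψ := by
  obtain ⟨ψ, h1, h2⟩ := exthom c c.f_mem φ hφ hu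
  rw [dom_f] at h2
  refine ⟨ψ.comp (Subring.inclusion (gen_le_Loc c)), fun z hz _ => h1 ⟨z, hz⟩, fun z hz => h2 _ hz⟩

lemma std_PB {BB : BData AA}
    (hs : ∀ z ∈ AA.Sec V, ∃ p : MvPolynomial (Fin n) BB.B, EqV V (MvPolynomial.eval₂ BB.σ x p) z)
    (Rl : Set (MvPolynomial (Fin n) BB.B))
    (hR : ∀ p, Van V (MvPolynomial.eval₂ BB.σ x p) → p ∈ Ideal.span Rl)
    (hR' : ∀ r ∈ Rl, Van V (MvPolynomial.eval₂ BB.σ x r))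
    (hco : ∀ r ∈ Rl, ∀ m, ∃ t, BB.ρ BB.f0 * MvPolynomial.coeff m r = BB.ρ t) :
    PB BB (std AA V hV x hx) where
  ex R _ φ b hk hb := by
    have hf : φ ⟨AA.f, f_mem _⟩ = b (BB.ρ BB.f0) := by
      rw [← hb]
      congr 1
      exact Subtype.ext BB.f0_eq.symm
    have hu : IsUnit (b (BB.ρ BB.f0)) := BB.f0_unit.map b
    obtain ⟨ψ, h1, h2⟩ := ext_gen _ φ hk (hf ▸ hu)
    let Φ0 : MvPolynomial (Fin n) BB.B →+* R := MvPolynomial.eval₂Hom b (fun k => ψ ⟨x k, std_gen k⟩)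
    let D : Subring ((∀ y, O y) × R) := ((gen (std AA V hV x hx)).N.subtype.prod ψ).range
    have hpr : ∀ p, MvPolynomial.eval₂ (BB.σ.prod b) (fun k => (x k, ψ ⟨x k, std_gen k⟩)) p =
        (MvPolynomial.eval₂ BB.σ x p, Φ0 p) := by
      intro p
      refine Prod.ext ?_ ?_
      · exact MvPolynomial.eval₂_comp_left (RingHom.fst (∀ y, O y) R) (BB.σ.prod b) _ p
      · exact MvPolynomial.eval₂_comp_left (RingHom.snd (∀ y, O y) R) (BB.σ.prod b) _ p
    have hΦR : ∀ r ∈ Rl, Φ0 r = 0 := by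
      intro r hr
      have hD : MvPolynomial.eval₂ (BB.σ.prod b) (fun k => (x k, ψ ⟨x k, std_gen k⟩)) r ∈ D := by
        refine MvPolynomial.eval₂_mem (fun m _ => ?_) (fun k => ⟨⟨x k, std_gen k⟩, rfl⟩)
        obtain ⟨t, ht⟩ := hco r hr m
        have hb1 : AA.f * BB.σ (r.coeff m) = BB.σ (BB.ρ t) := by rw [← ht, map_mul, BB.f0_eq]
        have hg : BB.σ (r.coeff m) ∈ (gen (std AA V hV x hx)).N :=
          ⟨1, by rw [pow_one, hb1]; exact (std AA V hV x hx).base_le (BB.mem t)⟩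
        refine ⟨⟨_, hg⟩, Prod.ext rfl ?_⟩
        change ψ ⟨_, hg⟩ = b _
        have hfg : AA.f ∈ (gen (std AA V hV x hx)).N := f_mem _
        have e1 : ψ ⟨AA.f, hfg⟩ * ψ ⟨_, hg⟩ = b (BB.ρ t) := by
          rw [← map_mul, ← hb, ← h1 _ _ (Chart.base_le _ (BB.mem t))]
          congr 1
          exact Subtype.ext hb1
        rw [h1 _ (f_mem _) _, hf, ← ht, map_mul] at e1
        exact hu.mul_left_cancel e1
      rw [hpr] at hD
      obtain ⟨⟨z, hz⟩, hz2⟩ := hD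
      have e1 : z = MvPolynomial.eval₂ BB.σ x r := congrArg Prod.fst hz2
      have e2 : ψ ⟨z, hz⟩ = Φ0 r := congrArg Prod.snd hz2
      rw [← e2]
      refine h2 _ ?_
      change Van V z
      rw [e1]; exact hR' r hr
    have hker : ∀ p, Van V (MvPolynomial.eval₂ BB.σ x p) → Φ0 p = 0 := by
      intro p hp
      have : Ideal.span Rl ≤ RingHom.ker Φ0 := Ideal.span_le.2 fun r hr => hΦR r hr
      exact this (hR p hp)
    let c := full (std AA V hV x hx)
    let ev : MvPolynomial (Fin n) BB.B →+* AA.Sec V :=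
      MvPolynomial.eval₂Hom (BB.σ.codRestrict (AA.Sec V) (BB.σ_mem V)) (fun k => ⟨x k, hx k⟩)
    have hev : ∀ p, (ev p : ∀ y, O y) = MvPolynomial.eval₂ BB.σ x p := fun p =>
      MvPolynomial.eval₂_comp_left (AA.Sec V).subtype _ _ p
    let e : MvPolynomial (Fin n) BB.B →+* Qr c := (Ngt.mk c).comp ev
    have he : Function.Surjective e := by
      intro q
      obtain ⟨z, hz, rfl⟩ := mk_surj c q
      obtain ⟨p, hp⟩ := hs z hz
      refine ⟨p, (mk_kil c).eq ?_⟩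
      intro y hy
      exact (congrFun (hev p) y).trans (hp y hy)
    let L : Qr c →+* R := e.liftOfSurjective he ⟨Φ0, fun p hp => hker p (by
      have : Van V (ev p : ∀ y, O y) := mk_eq_zero.1 hp
      rw [← hev]; exact this)⟩
    have hL : ∀ p, L (e p) = Φ0 p := fun p => RingHom.liftOfRightInverse_comp_apply _ _ _ _ _
    have hΦb : ∀ t, L (Ngt.mk c ⟨BB.σ t, BB.σ_mem _ _⟩) = b t := by
      intro t
      have h : e (MvPolynomial.C t) = Ngt.mk c ⟨BB.σ t, BB.σ_mem _ _⟩ :=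
        congrArg (Ngt.mk c) (MvPolynomial.eval₂Hom_C _ _ t)
      exact (congrArg L h).symm.trans ((hL _).trans (MvPolynomial.eval₂Hom_C _ _ t))
    have hΦx : ∀ k, L (Ngt.mk c ⟨x k, hx k⟩) = ψ ⟨x k, std_gen k⟩ := by
      intro k
      have h : e (MvPolynomial.X k) = Ngt.mk c ⟨x k, hx k⟩ :=
        congrArg (Ngt.mk c) (MvPolynomial.eval₂Hom_X' _ _ k)
      exact (congrArg L h).symm.trans ((hL _).trans (MvPolynomial.eval₂Hom_X' _ _ k))
    have hK : Kil V (L.comp (Ngt.mk c)) := comp_kil L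
    refine ⟨L.comp (Ngt.mk c), hK, hΦb, fun z hz => ?_⟩
    let D2 : Subring (∀ y, O y) :=
      (((L.comp (Ngt.mk c)).comp (Subring.inclusion (std AA V hV x hx).le)).eqLocus φ).map
        (std AA V hV x hx).N.subtype
    have hD2 : (std AA V hV x hx).N ≤ D2 := by
      refine std_le ?_ ?_ ?_
      · intro z hz
        refine ⟨⟨z, Chart.base_le _ hz⟩, ?_, rfl⟩
        rw [BB.base_eq] at hz
        obtain ⟨t, rfl⟩ := hz
        exact (hΦb _).trans (hb t).symm
      · intro z hz
        refine ⟨⟨z, Chart.zero _ z hz⟩, ?_, rfl⟩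
        exact (hK _ hz).trans (hk ⟨z, Chart.zero _ z hz⟩ hz).symm
      · intro k
        refine ⟨⟨_, std_mem k⟩, ?_, rfl⟩
        have e1 : L (Ngt.mk c ⟨AA.f * x k, (std AA V hV x hx).le (std_mem k)⟩) =
          L (Ngt.mk c ⟨BB.σ (BB.ρ BB.f0), BB.σ_mem _ _⟩) * L (Ngt.mk c ⟨x k, hx k⟩) := by
          rw [← map_mul, ← map_mul]
          congr 2
          exact Subtype.ext (by change _ = BB.σ (BB.ρ BB.f0) * x k; rw [BB.f0_eq])
        refine e1.trans ?_
        have hfg : AA.f ∈ (gen (std AA V hV x hx)).N := f_mem _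
        rw [hΦb, hΦx, ← hf, ← h1 _ _ hfg, ← map_mul]
        exact h1 _ _ _
    obtain ⟨⟨z', hz'⟩, h, rfl⟩ := hD2 hz
    exact h
  un R _ Φ Φ' hk hk' hb hN := by
    have hx1 : ∀ k, Φ ⟨x k, hx k⟩ = Φ' ⟨x k, hx k⟩ := by
      intro k
      have hu : IsUnit (Φ ⟨BB.σ (BB.ρ BB.f0), BB.σ_mem _ _⟩) :=
        BB.f0_unit.map (Φ.comp (BB.σ.codRestrict (AA.Sec V) (BB.σ_mem V)))
      refine hu.mul_left_cancel ?_
      have e1 : (⟨BB.σ (BB.ρ BB.f0), BB.σ_mem _ _⟩ : AA.Sec V) * ⟨x k, hx k⟩ =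
          ⟨AA.f * x k, (std AA V hV x hx).le (std_mem k)⟩ :=
        Subtype.ext (by change BB.σ (BB.ρ BB.f0) * x k = _; rw [BB.f0_eq])
      have e2 := (Φ.map_mul _ _).symm.trans (congrArg Φ e1)
      have e3 := (Φ'.map_mul _ _).symm.trans (congrArg Φ' e1)
      refine e2.trans ?_
      refine (hN _ (std_mem k)).trans ?_
      refine e3.symm.trans ?_
      congr 1
      exact (hb _).symm
    refine RingHom.ext fun z => ?_
    let ev : MvPolynomial (Fin n) BB.B →+* AA.Sec V :=
      MvPolynomial.eval₂Hom (BB.σ.codRestrict (AA.Sec V) (BB.σ_mem V)) (fun k => ⟨x k, hx k⟩)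
    have hev : ∀ p, (ev p : ∀ y, O y) = MvPolynomial.eval₂ BB.σ x p := fun p =>
      MvPolynomial.eval₂_comp_left (AA.Sec V).subtype _ _ p
    have hE : Φ.comp ev = Φ'.comp ev := by
      refine MvPolynomial.ringHom_ext (fun t => ?_) (fun k => ?_)
      · have h : ev (MvPolynomial.C t) = ⟨BB.σ t, BB.σ_mem _ _⟩ := MvPolynomial.eval₂Hom_C _ _ t
        exact (congrArg Φ h).trans ((hb t).trans (congrArg Φ' h).symm)
      · have h : ev (MvPolynomial.X k) = ⟨x k, hx k⟩ := MvPolynomial.eval₂Hom_X' _ _ k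
        exact (congrArg Φ h).trans ((hx1 k).trans (congrArg Φ' h).symm)
    obtain ⟨p, hp⟩ := hs z.1 z.2
    have hpz : EqV V (ev p : ∀ y, O y) (z : ∀ y, O y) := fun y hy =>
      (congrFun (hev p) y).trans (hp y hy)
    exact (hk.eq hpz).symm.trans ((RingHom.congr_fun hE p).trans (hk'.eq hpz))

end Abstract
end Ngt

namespace Ngt

section Geo

variable {Y : Scheme.{u}} [Y.IsSeparated]

lemma sep_surj {V V' : Y.Opens} (hV : IsAffineOpen V) (hV' : IsAffineOpen V') :
    (rs (inf_le_left : V ⊓ V' ≤ V)).range ⊔ (rs (inf_le_right : V ⊓ V' ≤ V')).range = ⊤ := by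
  have hW : IsAffineOpen (V ⊓ V') := hV.inf hV'
  set R0 := (rs (inf_le_left : V ⊓ V' ≤ V)).range ⊔ (rs (inf_le_right : V ⊓ V' ≤ V')).range with hR0
  let α : Γ(Y, V) →+* R0 := (rs (inf_le_left : V ⊓ V' ≤ V)).codRestrict R0
    (fun s => (le_sup_left : _ ≤ R0) ⟨s, rfl⟩)
  let α' : Γ(Y, V') →+* R0 := (rs (inf_le_right : V ⊓ V' ≤ V')).codRestrict R0
    (fun s => (le_sup_right : _ ≤ R0) ⟨s, rfl⟩)
  let m := Spec.map (Y.presheaf.map (homOfLE (inf_le_left : V ⊓ V' ≤ V)).op)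
  let m' := Spec.map (Y.presheaf.map (homOfLE (inf_le_right : V ⊓ V' ≤ V')).op)
  have hm : m ≫ hV.fromSpec = hW.fromSpec := hV.map_fromSpec hW _
  have hm' : m' ≫ hV'.fromSpec = hW.fromSpec := hV'.map_fromSpec hW _
  have hio : IsOpenImmersion m' := by
    have : IsOpenImmersion (m' ≫ hV'.fromSpec) := by rw [hm']; infer_instance
    exact IsOpenImmersion.of_comp m' hV'.fromSpec
  have hpb : IsPullback m m' hV.fromSpec hV'.fromSpec := by
    refine IsOpenImmersion.isPullback _ _ _ _ (hm'.trans hm.symm) ?_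
    refine TopologicalSpace.Opens.ext ?_
    ext p
    have e1 : p ∈ hV'.fromSpec ⁻¹ᵁ hV.fromSpec.opensRange ↔ hV'.fromSpec p ∈ V := by
      rw [hV.opensRange_fromSpec]; rfl
    have e2 : hV'.fromSpec p ∈ V' := by
      have : hV'.fromSpec p ∈ hV'.fromSpec.opensRange := ⟨p, rfl⟩
      rw [hV'.opensRange_fromSpec] at this
      exact this
    refine e1.trans ⟨fun h => ?_, ?_⟩
    · have : hV'.fromSpec p ∈ hW.fromSpec.opensRange := by
        rw [hW.opensRange_fromSpec]; exact ⟨h, e2⟩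
      obtain ⟨q, hq⟩ := this
      refine ⟨q, hV'.fromSpec.isOpenEmbedding.injective ?_⟩
      rw [← Scheme.Hom.comp_apply, hm']; exact hq
    · rintro ⟨q, rfl⟩
      rw [← Scheme.Hom.comp_apply, hm']
      have : hW.fromSpec q ∈ hW.fromSpec.opensRange := ⟨q, rfl⟩
      rw [hW.opensRange_fromSpec] at this
      exact this.1
  let t := terminal.from Y
  let κ : Spec Γ(Y, V ⊓ V') ⟶ Spec (.of R0) := Spec.map (CommRingCat.ofHom R0.subtype)
  let μ : Spec (.of R0) ⟶ pullback (hV.fromSpec ≫ t) (hV'.fromSpec ≫ t) :=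
    pullback.lift (Spec.map (CommRingCat.ofHom α)) (Spec.map (CommRingCat.ofHom α'))
      (terminal.hom_ext _ _)
  have hκ : κ ≫ μ = hpb.isoPullback.hom ≫ pullback.mapDesc hV.fromSpec hV'.fromSpec t := by
    refine pullback.hom_ext ?_ ?_
    · have : κ ≫ Spec.map (CommRingCat.ofHom α) = m := by
        rw [← Spec.map_comp]; rfl
      rw [Category.assoc, Category.assoc]
      have h1 : μ ≫ pullback.fst _ _ = Spec.map (CommRingCat.ofHom α) := pullback.lift_fst _ _ _
      have h2 : pullback.mapDesc hV.fromSpec hV'.fromSpec t ≫ pullback.fst _ _ = pullback.fst _ _ :=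
        (pullback.lift_fst _ _ _).trans (Category.comp_id _)
      exact (congrArg (fun g => κ ≫ g) h1).trans (this.trans (hpb.isoPullback_hom_fst.symm.trans
        (congrArg (fun g => hpb.isoPullback.hom ≫ g) h2.symm)))
    · have : κ ≫ Spec.map (CommRingCat.ofHom α') = m' := by
        rw [← Spec.map_comp]; rfl
      rw [Category.assoc, Category.assoc]
      have h1 : μ ≫ pullback.snd _ _ = Spec.map (CommRingCat.ofHom α') := pullback.lift_snd _ _ _
      have h2 : pullback.mapDesc hV.fromSpec hV'.fromSpec t ≫ pullback.snd _ _ = pullback.snd _ _ :=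
        (pullback.lift_snd _ _ _).trans (Category.comp_id _)
      exact (congrArg (fun g => κ ≫ g) h1).trans (this.trans (hpb.isoPullback_hom_snd.symm.trans
        (congrArg (fun g => hpb.isoPullback.hom ≫ g) h2.symm)))
  have hsep : IsSeparated t := inferInstance
  have hcl : IsClosedImmersion (κ ≫ μ) := by rw [hκ]; infer_instance
  have hcl' : IsClosedImmersion κ := IsClosedImmersion.of_comp κ μ
  have hs := (IsClosedImmersion.isAffine_surjective_of_isAffine κ).2
  have hs' : Function.Surjective R0.subtype := by
    intro s
    obtain ⟨r, hr⟩ := hs ((Scheme.ΓSpecIso Γ(Y, V ⊓ V')).inv s)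
    refine ⟨(Scheme.ΓSpecIso (.of R0)).hom r, ?_⟩
    have := Scheme.ΓSpecIso_naturality (CommRingCat.ofHom R0.subtype)
    have h2 := congrArg (fun g => g.hom r) this
    refine Eq.trans h2.symm ?_
    change (Scheme.ΓSpecIso Γ(Y, V ⊓ V')).hom (κ.appTop r) = s
    rw [hr]
    simp
  rw [eq_top_iff]
  intro s _
  obtain ⟨r, rfl⟩ := hs' s
  exact r.2

lemma gSec_anti {V W : Set Y} (h : V ⊆ W) : gSec W ≤ gSec V := by
  rintro x ⟨U, hU, s, hx⟩
  exact ⟨U, h.trans hU, s, fun y hy hv => hx y hy (h hv)⟩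

lemma sep_gen {V V' : Y.Opens} (hV : IsAffineOpen V) (hV' : IsAffineOpen V') (s : Γ(Y, V ⊓ V')) :
    ∃ (w : ∀ y, St Y y) (h : w ∈ gSec ((V ⊓ V' : Y.Opens) : Set Y)),
      w ∈ gSec (V : Set Y) ⊔ gSec (V' : Set Y) ∧ sec (V ⊓ V') ⟨w, h⟩ = s := by
  let D : Subring Γ(Y, V ⊓ V') := ((gSec (V : Set Y) ⊔ gSec (V' : Set Y)).comap
    (gSec ((V ⊓ V' : Y.Opens) : Set Y)).subtype).map (sec (V ⊓ V'))
  have hD : (rs (inf_le_left : V ⊓ V' ≤ V)).range ⊔ (rs (inf_le_right : V ⊓ V' ≤ V')).range ≤ D := by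
    refine sup_le ?_ ?_
    · rintro _ ⟨s, rfl⟩
      exact ⟨⟨fn V s, fn_mem s Set.inter_subset_left⟩, (le_sup_left : gSec (V : Set Y) ≤ _) (fn_mem s subset_rfl),
        sec_fn inf_le_left s _⟩
    · rintro _ ⟨s, rfl⟩
      exact ⟨⟨fn V' s, fn_mem s Set.inter_subset_right⟩, (le_sup_right : gSec (V' : Set Y) ≤ _) (fn_mem s subset_rfl),
        sec_fn inf_le_right s _⟩
  rw [sep_surj hV hV'] at hD
  obtain ⟨⟨w, h⟩, h1, h2⟩ := hD (Subring.mem_top s)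
  exact ⟨w, h, h1, h2⟩

lemma cov_inter {V V' : Y.Opens} (hV : IsAffineOpen V) (hV' : IsAffineOpen V') :
    ∃ (I : Type u) (t : Finset I) (a c : I → ∀ y, St Y y),
      (∀ i ∈ t, a i ∈ gSec (V : Set Y) ∧ (V : Set Y) ∩ Dom (a i) ⊆ V' ∧
        c i ∈ gSec (V : Set Y) ⊔ gSec (V' : Set Y)) ∧
      EqV ((V : Set Y) ∩ V') 1 (∑ i ∈ t, c i * a i) := by
  classical
  have hW : IsAffineOpen (V ⊓ V') := hV.inf hV'
  let S : Set Γ(Y, V ⊓ V') := {t | ∃ s : Γ(Y, V), Y.basicOpen s ≤ V' ∧ rs inf_le_left s = t}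
  have hS : Ideal.span S = ⊤ := by
    rw [← hW.iSup_basicOpen_eq_self_iff]
    refine le_antisymm (iSup_le fun s => Y.basicOpen_le _) fun y hy => ?_
    obtain ⟨s, hs, hys⟩ := hV.exists_basicOpen_le (V := V ⊓ V') ⟨y, hy⟩ hy.1
    refine TopologicalSpace.Opens.mem_iSup.2 ⟨⟨rs inf_le_left s, s, hs.trans inf_le_right, rfl⟩, ?_⟩
    rw [mem_bas _ hy, ge_rs, ← mem_bas]
    exact hys
  have h1 : (1 : Γ(Y, V ⊓ V')) ∈ Submodule.span _ S := (Ideal.eq_top_iff_one _).1 hS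
  obtain ⟨t, htS, h1⟩ := Submodule.mem_span_finite_of_mem_span h1
  rw [Submodule.mem_span_finset] at h1
  obtain ⟨g, -, hg⟩ := h1
  have hpre : ∀ s : Γ(Y, V ⊓ V'), ∃ a : ∀ y, St Y y, s ∈ t → a ∈ gSec (V : Set Y) ∧
      (V : Set Y) ∩ Dom a ⊆ V' ∧ ∀ y (hy : y ∈ V ⊓ V'), a y = ge _ y hy s := by
    intro s
    by_cases hs : s ∈ t
    · obtain ⟨r, hr, rfl⟩ := htS hs
      refine ⟨fn V r, fun _ => ⟨fn_mem r subset_rfl, ?_, fun y hy => ?_⟩⟩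
      · rintro y ⟨hy, hd⟩
        refine hr ((mem_bas _ hy).2 ?_)
        rw [← fn_eq]; exact hd
      · rw [ge_rs, fn_eq _ hy.1]
    · exact ⟨0, fun h => (hs h).elim⟩
  choose a ha using hpre
  choose w hw hw1 hw2 using fun s => sep_gen hV hV' (g s)
  refine ⟨_, t, a, w, fun i hi => ⟨(ha i hi).1, (ha i hi).2.1, hw1 i⟩, fun y hy => ?_⟩
  have hy' : y ∈ V ⊓ V' := hy
  have := congrArg (ge _ y hy') hg
  rw [map_sum, map_one] at this
  rw [Finset.sum_apply]
  refine this.symm.trans (Finset.sum_congr rfl fun i hi => ?_)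
  rw [smul_eq_mul, map_mul, Pi.mul_apply, (ha i hi).2.2 y hy']
  congr 1
  rw [← hw2 i, ge_sec]

end Geo
end Ngt

namespace Ngt

section Abstract

variable {Y : Type u} {O : Y → Type u} [∀ y, CommRing (O y)]

open Chart

variable {AA : Amb O} {V : Set Y} {hV : V ∈ AA.Aff} {n : ℕ} {x : Fin n → ∀ y, O y}
  {hx : ∀ k, x k ∈ AA.Sec V}

lemma gen_le {d : Chart AA} {M : Subring (∀ y, O y)} (h : d.N ≤ M) (hf : pinv AA.f ∈ M) :
    (gen d).N ≤ M := by
  rintro z ⟨n, hn⟩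
  have : z = pinv AA.f ^ n * (AA.f ^ n * z) := by
    rw [← mul_assoc, ← mul_pow, pinv_f_mul, one_pow, one_mul]
  rw [this]
  exact mul_mem (pow_mem hf _) (h hn)

lemma std_loc {c : Chart AA} {s : ∀ y, O y} (hsub : c.V ∩ Dom s ⊆ V)
    (hz : ∀ k, x k ∈ (gen c).Loc s) : (gen (std AA V hV x hx)).N ≤ (gen c).Loc s := by
  refine gen_le (std_le ?_ ?_ ?_) (le_Loc _ _ (pinv_f_mem c))
  · exact (gen c).base_le.trans (le_Loc _ _)
  · intro z hz
    exact van_Loc _ (hz.mono hsub)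
  · intro k
    exact mul_mem (le_Loc _ _ (f_mem _)) (hz k)

lemma std_gop {c : Chart AA} {I : Type u} (t : Finset I) (a b : I → ∀ y, O y)
    (ha : ∀ i ∈ t, a i ∈ (gen c).N ∧ c.V ∩ Dom (a i) ⊆ V ∧
      b i ∈ ((gen c).sup (gen (std AA V hV x hx))).N)
    (h1 : EqV (c.V ∩ V) 1 (∑ i ∈ t, b i * a i))
    (hz : ∀ i ∈ t, ∀ k, x k ∈ (gen c).Loc (a i)) : GOp c (std AA V hV x hx) := by
  intro P hP
  by_cases h : ∃ i ∈ t, a i ∉ P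
  · obtain ⟨i, hi, hiP⟩ := h
    exact ⟨a i, (ha i hi).1, hiP, (ha i hi).2.1, std_loc (ha i hi).2.1 (hz i hi)⟩
  · push Not at h
    exfalso
    set e := (gen c).sup (gen (std AA V hV x hx))
    have hs : ∀ t' ⊆ t, (∑ i ∈ t', b i * a i) ∈ P ∧ (∑ i ∈ t', b i * a i) ∈ e.N := by
      classical
      intro t'
      induction t' using Finset.induction_on with
      | empty => exact fun _ => ⟨hP.van _ (fun _ _ => rfl), zero_mem _⟩
      | insert i s his ih =>
        intro hs
        have hi := hs (Finset.mem_insert_self _ _)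
        obtain ⟨i1, i2⟩ := ih ((Finset.subset_insert _ _).trans hs)
        have ha' : a i ∈ e.N := (sup_left _ _).2 (ha i hi).1
        have hm := mul_mem (ha i hi).2.2 ha'
        rw [Finset.sum_insert his]
        exact ⟨hP.add _ hm _ i2 (hP.mul _ (ha i hi).2.2 _ ha' (h i hi)) i1, add_mem hm i2⟩
    obtain ⟨s1, s2⟩ := hs t subset_rfl
    refine hP.one ?_
    have hv : Van e.V (1 - ∑ i ∈ t, b i * a i) := fun y hy => by
      rw [Pi.sub_apply, h1 y hy, sub_self]
    have := hP.add _ (sub_mem (one_mem _) s2) _ s2 (hP.van _ hv) s1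
    rwa [sub_add_cancel] at this

lemma std_in_gen {BB : BData AA} {z : ∀ y, O y} (p : MvPolynomial (Fin n) BB.B)
    (hp : EqV V (MvPolynomial.eval₂ BB.σ x p) z)
    (hco : ∀ m ∈ p.support, ∃ t, BB.ρ BB.f0 * MvPolynomial.coeff m p = BB.ρ t) :
    z ∈ (gen (std AA V hV x hx)).N := by
  refine mem_congr (gen (std AA V hV x hx)) hp ?_
  refine MvPolynomial.eval₂_mem (fun m hm => ?_) (fun k => std_gen k)
  by_cases h0 : p.coeff m = 0
  · rw [h0, map_zero]; exact zero_mem _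
  obtain ⟨t, ht⟩ := hco m (MvPolynomial.mem_support_iff.2 h0)
  refine ⟨1, ?_⟩
  rw [pow_one, ← BB.f0_eq, ← map_mul, ht]
  exact (std AA V hV x hx).base_le (BB.mem t)

end Abstract
end Ngt

namespace Ngt

section Geo

variable {Y : Scheme.{u}}

lemma vc {B : Type u} [CommRing B] (β : B →+* Γ(Y, ⊤))
    (hg : ValuativeCriterion.Existence (Y.toSpecΓ ≫ Spec.map (CommRingCat.ofHom β)))
    {ι : Type u} (V : ι → Y.Opens) (hV : ∀ i, IsAffineOpen (V i)) (hc : ∀ y, ∃ i, y ∈ V i)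
    (i : ι) (K : Type u) [Field K] (W : ValuationSubring K) (φ : Γ(Y, V i) →+* K)
    (hφ : ∀ b, φ (rs le_top (β b)) ∈ W) :
    ∃ (j : ι) (s : Γ(Y, V i)) (hs : Y.basicOpen s ≤ V j), φ s ≠ 0 ∧
      ∀ (x : Γ(Y, V j)) (p : ℕ) (z : Γ(Y, V i)),
        rs (Y.basicOpen_le s) (s ^ p) * rs hs x = rs (Y.basicOpen_le s) z →
        ∃ w ∈ W, φ z = φ s ^ p * w := by
  let i1 : Spec (.of K) ⟶ Y := Spec.map (CommRingCat.ofHom φ) ≫ (hV i).fromSpec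
  let bW : B →+* W := (φ.comp ((rs le_top).comp β)).codRestrict W.toSubring hφ
  let i2 : Spec (.of W) ⟶ Spec (.of B) := Spec.map (CommRingCat.ofHom bW)
  have hsq : CommSq i1 (Spec.map (CommRingCat.ofHom (algebraMap W K)))
      (Y.toSpecΓ ≫ Spec.map (CommRingCat.ofHom β)) i2 := by
    constructor
    have e1 : (hV i).fromSpec ≫ Y.toSpecΓ = Spec.map (CommRingCat.ofHom (rs (le_top : V i ≤ ⊤))) :=
      (hV i).fromSpec_toSpecΓ
    change (Spec.map (CommRingCat.ofHom φ) ≫ (hV i).fromSpec) ≫ Y.toSpecΓ ≫ _ = _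
    rw [Category.assoc, ← Category.assoc (hV i).fromSpec, e1, ← Spec.map_comp, ← Spec.map_comp,
      ← Spec.map_comp]
    rfl
  obtain ⟨⟨l, hl1, hl2⟩⟩ := hg { R := W, K := K, i₁ := i1, i₂ := i2, commSq := hsq }
  replace hl1 : Spec.map (CommRingCat.ofHom (algebraMap W K)) ≫ l = i1 := hl1
  obtain ⟨j, hj⟩ := hc (l (IsLocalRing.closedPoint W))
  obtain ⟨q, hq⟩ := factor_local (hV j).fromSpec l (by rw [(hV j).range_fromSpec]; exact hj)
  obtain ⟨ψ, rfl⟩ := spec_surj q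
  let pt : Spec (.of K) := IsLocalRing.closedPoint K
  have hi : i1 pt ∈ V i := by
    have : i1 pt ∈ Set.range (hV i).fromSpec := ⟨Spec.map (CommRingCat.ofHom φ) pt, rfl⟩
    rw [(hV i).range_fromSpec] at this
    exact this
  have hj' : i1 pt ∈ V j := by
    have : i1 pt ∈ Set.range (hV j).fromSpec := by
      rw [← hl1, ← hq]
      exact ⟨_, rfl⟩
    rw [(hV j).range_fromSpec] at this
    exact this
  obtain ⟨s, hs, hys⟩ := (hV i).exists_basicOpen_le (V := V j) ⟨i1 pt, hj'⟩ hi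
  have hD := (hV i).basicOpen s
  obtain ⟨q, hq2⟩ := factor_local hD.fromSpec i1 (by rw [hD.range_fromSpec]; exact hys)
  obtain ⟨θ, rfl⟩ := spec_surj q
  have hθi : θ.comp (rs (Y.basicOpen_le s)) = φ := by
    apply spec_inj
    rw [← cancel_mono (hV i).fromSpec]
    change _ = i1
    rw [← hq2, ← (hV i).map_fromSpec hD (homOfLE (Y.basicOpen_le s)).op, ← Category.assoc, ← Spec.map_comp]
    rfl
  have hθj : θ.comp (rs hs) = (algebraMap W K).comp ψ := by
    apply spec_inj
    rw [← cancel_mono (hV j).fromSpec]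
    have : Spec.map (CommRingCat.ofHom ((algebraMap W K).comp ψ)) ≫ (hV j).fromSpec = i1 := by
      rw [← hl1, ← hq, ← Category.assoc, ← Spec.map_comp]
      rfl
    rw [this, ← hq2, ← (hV j).map_fromSpec hD (homOfLE hs).op, ← Category.assoc, ← Spec.map_comp]
    rfl
  refine ⟨j, s, hs, ?_, fun x p z h => ⟨ψ x, (ψ x).2, ?_⟩⟩
  · have hu : IsUnit (rs (Y.basicOpen_le s) s) := RingedSpace.isUnit_res_basicOpen _ s
    have := hu.map θ
    rw [← RingHom.comp_apply, hθi] at this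
    exact this.ne_zero
  · have := congrArg θ h
    rw [map_mul, ← RingHom.comp_apply, ← RingHom.comp_apply, ← RingHom.comp_apply, hθi, hθj, map_pow] at this
    exact this.symm

end Geo
end Ngt

namespace Ngt

section Ultra

variable {Λ : Type u} (UU : Ultrafilter Λ) (K : Λ → Type u) [∀ T, Field (K T)]

/-- null sequences -/
def nul : Ideal (∀ T, K T) where
  carrier := {x | ∀ᶠ T in (UU : Filter Λ), x T = 0}
  add_mem' {a b} ha hb := by
    filter_upwards [ha, hb] with T h1 h2
    rw [Pi.add_apply, h1, h2, add_zero]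
  zero_mem' := Filter.Eventually.of_forall fun _ => rfl
  smul_mem' c x hx := by
    filter_upwards [hx] with T h
    rw [smul_eq_mul, Pi.mul_apply, h, mul_zero]

lemma mem_nul {x : ∀ T, K T} : x ∈ nul UU K ↔ ∀ᶠ T in (UU : Filter Λ), x T = 0 := Iff.rfl

instance nul_max : (nul UU K).IsMaximal := by
  rw [Ideal.isMaximal_iff]
  constructor
  · intro h
    obtain ⟨T, hT⟩ := (show ∀ᶠ T in (UU : Filter Λ), (1 : ∀ T, K T) T = 0 from h).exists
    exact one_ne_zero hT
  · intro J x hJ hx hxJ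
    have h1 : ∀ᶠ T in (UU : Filter Λ), x T ≠ 0 := by
      rw [mem_nul, ← Ultrafilter.eventually_not] at hx
      exact hx
    have h2 : x⁻¹ * x - 1 ∈ nul UU K := by
      filter_upwards [h1] with T hT
      rw [Pi.sub_apply, Pi.mul_apply, Pi.inv_apply, inv_mul_cancel₀ hT]
      exact sub_self _
    have := J.sub_mem (J.mul_mem_left x⁻¹ hxJ) (hJ h2)
    rwa [sub_sub_cancel] at this

/-- ultraproduct -/
abbrev Ul : Type u := (∀ T, K T) ⧸ nul UU K

noncomputable instance : Field (Ul UU K) := Ideal.Quotient.field _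

/-- the class -/
abbrev cl : (∀ T, K T) →+* Ul UU K := Ideal.Quotient.mk _

lemma cl_zero {x : ∀ T, K T} : cl UU K x = 0 ↔ ∀ᶠ T in (UU : Filter Λ), x T = 0 :=
  Ideal.Quotient.eq_zero_iff_mem

lemma cl_eq {x z : ∀ T, K T} : cl UU K x = cl UU K z ↔ ∀ᶠ T in (UU : Filter Λ), x T = z T := by
  rw [← sub_eq_zero, ← map_sub, cl_zero]
  simp only [Pi.sub_apply, sub_eq_zero]

/-- integral sequences -/
def intg (OO : ∀ T, ValuationSubring (K T)) : Subring (∀ T, K T) where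
  carrier := {x | ∀ᶠ T in (UU : Filter Λ), x T ∈ OO T}
  mul_mem' {a b} ha hb := by
    filter_upwards [ha, hb] with T h1 h2
    exact mul_mem h1 h2
  one_mem' := Filter.Eventually.of_forall fun T => one_mem (OO T)
  add_mem' {a b} ha hb := by
    filter_upwards [ha, hb] with T h1 h2
    exact add_mem h1 h2
  zero_mem' := Filter.Eventually.of_forall fun T => zero_mem (OO T)
  neg_mem' {a} ha := by
    filter_upwards [ha] with T h1
    exact neg_mem h1

/-- valuation ring of the ultraproduct -/
noncomputable def Uo (OO : ∀ T, ValuationSubring (K T)) : ValuationSubring (Ul UU K) where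
  toSubring := (intg UU K OO).map (cl UU K)
  mem_or_inv_mem' z := by
    obtain ⟨x, rfl⟩ := Ideal.Quotient.mk_surjective z
    by_cases h : ∀ᶠ T in (UU : Filter Λ), x T ∈ OO T
    · exact Or.inl ⟨x, h, rfl⟩
    · right
      rw [← Ultrafilter.eventually_not] at h
      refine ⟨x⁻¹, ?_, ?_⟩
      · change ∀ᶠ T in (UU : Filter Λ), (x T)⁻¹ ∈ OO T
        filter_upwards [h] with T hT
        exact ((OO T).mem_or_inv_mem (x T)).resolve_left hT
      · refine eq_inv_of_mul_eq_one_left ?_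
        rw [← map_mul, ← map_one (cl UU K), cl_eq]
        filter_upwards [h] with T hT
        refine inv_mul_cancel₀ (fun h0 => hT ?_)
        rw [h0]; exact zero_mem _

lemma cl_mem {OO : ∀ T, ValuationSubring (K T)} {x : ∀ T, K T} :
    cl UU K x ∈ Uo UU K OO ↔ ∀ᶠ T in (UU : Filter Λ), x T ∈ OO T := by
  constructor
  · rintro ⟨z, hz, h⟩
    rw [cl_eq] at h
    filter_upwards [hz, h] with T h1 h2
    rw [← h2]; exact h1
  · intro h
    exact ⟨x, h, rfl⟩

open Classical in
/-- raw limit -/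
noncomputable def raw {F : Type u} [CommRing F] (N : Λ → Subring F) (φ : ∀ T, N T →+* K T) (z : F) :
    ∀ T, K T := fun T => if h : z ∈ N T then φ T ⟨z, h⟩ else 0

lemma raw_eq {F : Type u} [CommRing F] {N : Λ → Subring F} {φ : ∀ T, N T →+* K T} {z : F} {T : Λ}
    (h : z ∈ N T) : raw K N φ z T = φ T ⟨z, h⟩ := dif_pos h

/-- limit of homomorphisms -/
noncomputable def lm {F : Type u} [CommRing F] (G : Subring F) (N : Λ → Subring F)
    (φ : ∀ T, N T →+* K T) (hN : ∀ z ∈ G, ∀ᶠ T in (UU : Filter Λ), z ∈ N T) : G →+* Ul UU K where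
  toFun z := cl UU K (raw K N φ z)
  map_one' := by
    rw [← map_one (cl UU K), cl_eq]
    exact Filter.Eventually.of_forall fun T =>
      (raw_eq K (one_mem (N T))).trans (map_one (φ T))
  map_zero' := by
    rw [← map_zero (cl UU K), cl_eq]
    exact Filter.Eventually.of_forall fun T =>
      (raw_eq K (zero_mem (N T))).trans (map_zero (φ T))
  map_mul' a b := by
    rw [← map_mul (cl UU K), cl_eq]
    filter_upwards [hN a a.2, hN b b.2] with T ha hb
    rw [Pi.mul_apply, raw_eq K ha, raw_eq K hb, ← map_mul]
    exact raw_eq K (mul_mem ha hb)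
  map_add' a b := by
    rw [← map_add (cl UU K), cl_eq]
    filter_upwards [hN a a.2, hN b b.2] with T ha hb
    rw [Pi.add_apply, raw_eq K ha, raw_eq K hb, ← map_add]
    exact raw_eq K (add_mem ha hb)

end Ultra

section Abstract

variable {Y : Type u} {O : Y → Type u} [∀ y, CommRing (O y)]

open Chart

variable {AA : Amb O} {V : Set Y} {hV : V ∈ AA.Aff} {n : ℕ} {x : Fin n → ∀ y, O y}
  {hx : ∀ k, x k ∈ AA.Sec V}

lemma std_cov {c : Chart AA} {K : Type u} [Field K] (OO : ValuationSubring K) (φ : c.N →+* K)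
    (hb : ∀ x (hx : x ∈ AA.base), φ ⟨x, c.base_le hx⟩ ∈ OO)
    (ψ : (gen c).N →+* K) (hψ : ∀ z (hz : z ∈ c.N) (hz' : z ∈ (gen c).N), ψ ⟨z, hz'⟩ = φ ⟨z, hz⟩)
    (hk : Kil c.V ψ) (s : ∀ y, O y) (hs : s ∈ (gen c).N) (hs0 : ψ ⟨s, hs⟩ ≠ 0)
    (hsub : c.V ∩ Dom s ⊆ V)
    (h : ∀ k, ∃ (p : ℕ) (z : ∀ y, O y) (hz : z ∈ (gen c).N) (w : K),
      EqV (c.V ∩ Dom s) (s ^ p * x k) z ∧ ψ ⟨z, hz⟩ = ψ ⟨s, hs⟩ ^ p * w ∧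
      φ ⟨AA.f, c.f_mem⟩ * w ∈ OO) :
    ∃ χ : (c.sup (std AA V hV x hx)).N →+* K, Kil (c.sup (std AA V hV x hx)).V χ ∧
      (∀ z : c.N, χ ⟨z, (sup_left _ _).2 z.2⟩ = φ z) ∧
      (∀ z : (std AA V hV x hx).N, χ ⟨z, (sup_right _ _).2 z.2⟩ ∈ OO) := by
  obtain ⟨θ, h1, h2⟩ := exthom (gen c) hs ψ hk (isUnit_iff_ne_zero.2 hs0)
  have hxL : ∀ k, x k ∈ (gen c).Loc s := by
    intro k
    obtain ⟨p, z, hz, w, e, -⟩ := h k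
    exact (mem_Loc hs).2 ⟨p, z, hz, e⟩
  have hd : (std AA V hV x hx).N ≤ (gen c).Loc s :=
    (gen_ref _).2.trans (std_loc hsub hxL)
  have hc : c.N ≤ (gen c).Loc s := (gen_ref c).2.trans (le_Loc _ _)
  have hcd : (c.sup (std AA V hV x hx)).N ≤ (gen c).Loc s := sup_le hc hd
  have hθ : ∀ z (hz : z ∈ c.N), θ ⟨z, hc hz⟩ = φ ⟨z, hz⟩ := fun z hz =>
    (h1 ⟨z, (gen_ref c).2 hz⟩).trans (hψ z hz _)
  refine ⟨θ.comp (Subring.inclusion hcd), fun z hz => h2 _ (hz.mono ?_), fun z => hθ z z.2, ?_⟩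
  · exact Set.subset_inter Set.inter_subset_left hsub
  · let D : Subring (∀ y, O y) := (OO.toSubring.comap θ).map ((gen c).Loc s).subtype
    have hD : (std AA V hV x hx).N ≤ D := by
      refine std_le ?_ ?_ ?_
      · intro z hz
        refine ⟨⟨z, hc (c.base_le hz)⟩, ?_, rfl⟩
        change θ _ ∈ OO
        rw [hθ z (c.base_le hz)]
        exact hb z hz
      · intro z hz
        refine ⟨⟨z, van_Loc _ (hz.mono hsub)⟩, ?_, rfl⟩
        change θ _ ∈ OO
        rw [h2 ⟨z, van_Loc _ (hz.mono hsub)⟩ (hz.mono hsub)]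
        exact zero_mem _
      · intro k
        refine ⟨⟨AA.f, hc c.f_mem⟩ * ⟨x k, hxL k⟩, ?_, rfl⟩
        change θ _ ∈ OO
        obtain ⟨p, z, hz, w, e, e2, e3⟩ := h k
        have e4 : θ ⟨x k, hxL k⟩ = w := by
          have e5 : θ (⟨s, le_Loc _ _ hs⟩ ^ p * ⟨x k, hxL k⟩) = θ ⟨z, le_Loc _ _ hz⟩ := h2.eq e
          rw [map_mul, map_pow] at e5
          have e6 := h1 ⟨s, hs⟩
          have e7 := h1 ⟨z, hz⟩
          refine mul_left_cancel₀ (pow_ne_zero p hs0) ?_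
          rw [← e2, ← e7, ← e5, ← e6]
        rw [map_mul, e4, hθ _ c.f_mem]
        exact e3
    intro z
    obtain ⟨⟨z', hz'⟩, h3, h4⟩ := hD z.2
    have h4' : z' = z.1 := h4
    subst h4'
    exact h3

end Abstract
end Ngt

namespace Ngt

/-- limit presentation of a ring -/
structure Sys (B : Type u) [CommRing B] where
  S : Submonoid B
  Λ : Type u
  l : Filter Λ
  ne : l.NeBot
  C : Λ → Type u
  cr : ∀ T, CommRing (C T)
  no : ∀ T, IsNoetherianRing (C T)
  ρ : ∀ T, C T →+* B
  f : ∀ T, C T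
  hf : ∀ T, IsUnit (ρ T (f T))
  E0 : ∀ b : B, ∃ s ∈ S, ∀ᶠ T in l, ∃ t, s * b = ρ T t
  E1 : ∀ s ∈ S, ∀ᶠ T in l, ∃ t, ρ T (f T) = ρ T t * s
  E2 : ∀ s ∈ S, ∀ᶠ T in l, ∃ t, s = ρ T t

attribute [instance] Sys.cr Sys.no Sys.ne

lemma Sys.E {B : Type u} [CommRing B] (SS : Sys B) (b : B) :
    ∀ᶠ T in SS.l, ∃ t, SS.ρ T (SS.f T) * b = SS.ρ T t := by
  obtain ⟨s, hs, h⟩ := SS.E0 b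
  filter_upwards [h, SS.E1 s hs] with T ⟨t, ht⟩ ⟨t', ht'⟩
  exact ⟨t' * t, by rw [ht', mul_assoc, ht, map_mul]⟩

/-- finite presentation data of a scheme -/
structure Fp {Y : Scheme.{u}} {B : Type u} [CommRing B] (β : B →+* Γ(Y, ⊤)) where
  ι : Type u
  fin : Finite ι
  V : ι → Y.Opens
  hV : ∀ i, IsAffineOpen (V i)
  hc : ∀ y, ∃ i, y ∈ V i
  n : ι → ℕ
  x : ∀ i, Fin (n i) → ∀ y, St Y y
  hx : ∀ i k, x i k ∈ gSec (V i : Set Y)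
  hs : ∀ i, ∀ z ∈ gSec (V i : Set Y), ∃ p : MvPolynomial (Fin (n i)) B,
    EqV (V i : Set Y) (MvPolynomial.eval₂ ((glob Y).comp β) (x i) p) z
  Rl : ∀ i, Finset (MvPolynomial (Fin (n i)) B)
  hR : ∀ i p, Van (V i : Set Y) (MvPolynomial.eval₂ ((glob Y).comp β) (x i) p) →
    p ∈ Ideal.span (Rl i : Set (MvPolynomial (Fin (n i)) B))
  hR' : ∀ i, ∀ r ∈ Rl i, Van (V i : Set Y) (MvPolynomial.eval₂ ((glob Y).comp β) (x i) r)

attribute [instance] Fp.fin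

section Geo

variable {Y : Scheme.{u}} [Y.IsSeparated] {B : Type u} [CommRing B] {β : B →+* Γ(Y, ⊤)}
  (SS : Sys B) (GG : Fp β)

open Chart

/-- the charts at a finite level -/
noncomputable def MM (T : SS.Λ) (i : GG.ι) : Chart (amb β (SS.ρ T) (SS.f T) (SS.hf T)) :=
  std (amb β (SS.ρ T) (SS.f T) (SS.hf T)) (GG.V i) ⟨GG.V i, GG.hV i, rfl⟩ (GG.x i) (GG.hx i)

lemma ev_gen (i : GG.ι) {z : ∀ y, St Y y} (hz : z ∈ gSec (GG.V i : Set Y)) :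
    ∀ᶠ T in SS.l, z ∈ (gen (MM SS GG T i)).N := by
  obtain ⟨p, hp⟩ := GG.hs i z hz
  have : ∀ᶠ T in SS.l, ∀ m ∈ p.support, ∃ t, SS.ρ T (SS.f T) * p.coeff m = SS.ρ T t :=
    (Filter.eventually_all_finset _).2 fun m _ => SS.E _
  filter_upwards [this] with T hT
  exact std_in_gen (BB := bdata β (SS.ρ T) (SS.f T) (SS.hf T)) p hp hT

lemma ev_pb (i : GG.ι) :
    ∀ᶠ T in SS.l, PB (bdata β (SS.ρ T) (SS.f T) (SS.hf T)) (MM SS GG T i) := by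
  have : ∀ᶠ T in SS.l, ∀ r ∈ GG.Rl i, ∀ m ∈ r.support, ∃ t, SS.ρ T (SS.f T) * r.coeff m = SS.ρ T t :=
    (Filter.eventually_all_finset _).2 fun r _ => (Filter.eventually_all_finset _).2 fun m _ => SS.E _
  filter_upwards [this] with T hT
  let R : Set (MvPolynomial (Fin (GG.n i)) B) := ↑(GG.Rl i)
  refine std_PB (BB := bdata β (SS.ρ T) (SS.f T) (SS.hf T)) (GG.hs i) R (GG.hR i) (GG.hR' i) ?_
  intro r hr m
  by_cases h0 : r.coeff m = 0
  · exact ⟨0, by rw [h0, mul_zero, map_zero]⟩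
  · exact hT r hr m (MvPolynomial.mem_support_iff.2 h0)

lemma ev_gop (i j : GG.ι) : ∀ᶠ T in SS.l, GOp (MM SS GG T i) (MM SS GG T j) := by
  obtain ⟨I, t, a, c, h1, h2⟩ := cov_inter (GG.hV i) (GG.hV j)
  have hc : ∀ w ∈ gSec (GG.V i : Set Y) ⊔ gSec (GG.V j : Set Y),
      ∀ᶠ T in SS.l, w ∈ ((gen (MM SS GG T i)).sup (gen (MM SS GG T j))).N := by
    let D : Subring (∀ y, St Y y) :=
      { carrier := {w | ∀ᶠ T in SS.l, w ∈ ((gen (MM SS GG T i)).sup (gen (MM SS GG T j))).N}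
        mul_mem' := fun {a b} ha hb => by
          filter_upwards [ha, hb] with T h1 h2
          exact mul_mem h1 h2
        one_mem' := Filter.Eventually.of_forall fun T => one_mem _
        add_mem' := fun {a b} ha hb => by
          filter_upwards [ha, hb] with T h1 h2
          exact add_mem h1 h2
        zero_mem' := Filter.Eventually.of_forall fun T => zero_mem _
        neg_mem' := fun {a} ha => by
          filter_upwards [ha] with T h1
          exact neg_mem h1 }
    have hD : gSec (GG.V i : Set Y) ⊔ gSec (GG.V j : Set Y) ≤ D := by
      refine sup_le ?_ ?_
      · intro w hw
        change ∀ᶠ T in SS.l, _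
        filter_upwards [ev_gen SS GG i hw] with T hT
        exact (sup_left _ _).2 hT
      · intro w hw
        change ∀ᶠ T in SS.l, _
        filter_upwards [ev_gen SS GG j hw] with T hT
        exact (sup_right _ _).2 hT
    intro w hw
    exact hD hw
  have e1 : ∀ᶠ T in SS.l, ∀ k ∈ t, a k ∈ (gen (MM SS GG T i)).N :=
    (Filter.eventually_all_finset _).2 fun k hk => ev_gen SS GG i (h1 k hk).1
  have e2 : ∀ᶠ T in SS.l, ∀ k ∈ t, c k ∈ ((gen (MM SS GG T i)).sup (gen (MM SS GG T j))).N :=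
    (Filter.eventually_all_finset _).2 fun k hk => hc _ (h1 k hk).2.2
  have e3 : ∀ᶠ T in SS.l, ∀ k ∈ t, ∀ m ∈ Finset.univ, a k ∈ (gen (MM SS GG T i)).N →
      GG.x j m ∈ (gen (MM SS GG T i)).Loc (a k) := by
    refine (Filter.eventually_all_finset _).2 fun k hk => (Filter.eventually_all_finset _).2 fun m _ => ?_
    obtain ⟨p, z, hz, e⟩ := gL1 (GG.hV i) (h1 k hk).1 (gSec_anti (h1 k hk).2.1 (GG.hx j m))
    filter_upwards [ev_gen SS GG i hz] with T hT hak
    exact (mem_Loc hak).2 ⟨p, z, hT, e⟩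
  filter_upwards [e1, e2, e3] with T h3 h4 h5
  exact std_gop t a c (fun k hk => ⟨h3 k hk, (h1 k hk).2.1, h4 k hk⟩) h2
    (fun k hk m => h5 k hk m (Finset.mem_univ _) (h3 k hk))

end Geo
end Ngt

namespace Ngt

section Geo

variable {Y : Scheme.{u}} [Y.IsSeparated] {B : Type u} [CommRing B] {β : B →+* Γ(Y, ⊤)}
  (SS : Sys B) (GG : Fp β)

open Chart

lemma MM_V (T : SS.Λ) (i : GG.ι) : (MM SS GG T i).V = (GG.V i : Set Y) := rfl

lemma base_iff (T : SS.Λ) (z : ∀ y, St Y y) :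
    z ∈ (amb β (SS.ρ T) (SS.f T) (SS.hf T)).base ↔ ∃ t, glob Y (β (SS.ρ T t)) = z := Iff.rfl

/-- coarsening of a valuation ring -/
def coar {L : Type u} [Field L] (VV : ValuationSubring L) {M : Type u} [CommMonoid M] (S : M →* L)
    (hS : ∀ s, S s ∈ VV) : ValuationSubring L where
  carrier := {z | ∃ s, S s * z ∈ VV}
  mul_mem' := by
    rintro a b ⟨s, hs⟩ ⟨t, ht⟩
    refine ⟨s * t, ?_⟩
    rw [map_mul, mul_mul_mul_comm]
    exact mul_mem hs ht
  one_mem' := ⟨1, by rw [map_one, mul_one]; exact one_mem _⟩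
  add_mem' := by
    rintro a b ⟨s, hs⟩ ⟨t, ht⟩
    refine ⟨s * t, ?_⟩
    have : S (s * t) * (a + b) = S t * (S s * a) + S s * (S t * b) := by rw [map_mul]; ring
    rw [this]
    exact add_mem (mul_mem (hS _) hs) (mul_mem (hS _) ht)
  zero_mem' := ⟨1, by rw [mul_zero]; exact zero_mem _⟩
  neg_mem' := by
    rintro a ⟨s, hs⟩
    refine ⟨s, ?_⟩
    rw [mul_neg]
    exact neg_mem hs
  mem_or_inv_mem' z := by
    rcases VV.mem_or_inv_mem z with h | h
    · exact Or.inl ⟨1, by rwa [map_one, one_mul]⟩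
    · exact Or.inr ⟨1, by rwa [map_one, one_mul]⟩

lemma glob_gSec (V : Y.Opens) (b : Γ(Y, ⊤)) : glob Y b ∈ gSec (V : Set Y) :=
  fn_mem _ (Set.subset_univ _)

lemma cov_lim (hg : ValuativeCriterion.Existence (Y.toSpecΓ ≫ Spec.map (CommRingCat.ofHom β)))
    (i : GG.ι) {Λ : Type u} (UU : Ultrafilter Λ) (τ : Λ → SS.Λ)
    (hτ : Filter.Tendsto τ UU SS.l) (K : Λ → Type u) [∀ T, Field (K T)]
    (OO : ∀ T, ValuationSubring (K T)) (φ : ∀ T, (MM SS GG (τ T) i).N →+* K T)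
    (h1 : ∀ T, Kil (MM SS GG (τ T) i).V (φ T))
    (h2 : ∀ T, φ T ⟨_, (MM SS GG (τ T) i).f_mem⟩ ≠ 0)
    (h3 : ∀ T, ∀ x (hx : x ∈ (amb β (SS.ρ (τ T)) (SS.f (τ T)) (SS.hf (τ T))).base),
      φ T ⟨x, (MM SS GG (τ T) i).base_le hx⟩ ∈ OO T) :
    ∃ (T : Λ) (j : GG.ι) (χ : ((MM SS GG (τ T) i).sup (MM SS GG (τ T) j)).N →+* K T),
      Kil ((MM SS GG (τ T) i).sup (MM SS GG (τ T) j)).V χ ∧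
      (∀ x : (MM SS GG (τ T) i).N, χ ⟨x, (sup_left _ _).2 x.2⟩ = φ T x) ∧
      (∀ x : (MM SS GG (τ T) j).N, χ ⟨x, (sup_right _ _).2 x.2⟩ ∈ OO T) := by
  have hex := fun T => ext_gen (MM SS GG (τ T) i) (φ T) (h1 T) (isUnit_iff_ne_zero.2 (h2 T))
  choose ψ hψ hk using hex
  have hN : ∀ z ∈ gSec (GG.V i : Set Y), ∀ᶠ T in (UU : Filter Λ), z ∈ (gen (MM SS GG (τ T) i)).N :=
    fun z hz => hτ.eventually (ev_gen SS GG i hz)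
  let N : Λ → Subring (∀ y, St Y y) := fun T => (gen (MM SS GG (τ T) i)).N
  let Φ : gSec (GG.V i : Set Y) →+* Ul UU K := lm UU K (gSec (GG.V i : Set Y)) N ψ hN
  have hΦ : ∀ z, Φ z = cl UU K (raw K N ψ z) := fun z => rfl
  have hΦk : ∀ z ∈ RingHom.ker (sec (GG.V i)), z ∈ RingHom.ker Φ := by
    intro z hz
    rw [RingHom.mem_ker] at hz ⊢
    rw [hΦ, cl_zero]
    filter_upwards [hN z z.2] with T hT
    rw [raw_eq K hT]
    exact hk T _ (sec_zero.1 hz)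
  let Φ' : Γ(Y, GG.V i) →+* Ul UU K :=
    (sec (GG.V i)).liftOfSurjective (sec_surj _) ⟨Φ, hΦk⟩
  have hΦ' : ∀ z, Φ' (sec (GG.V i) z) = Φ z := fun z =>
    RingHom.liftOfRightInverse_comp_apply _ _ (Function.rightInverse_surjInv (sec_surj _)) ⟨Φ, hΦk⟩ z
  let gB : B →+* gSec (GG.V i : Set Y) :=
    ((glob Y).comp β).codRestrict (gSec (GG.V i : Set Y)) (fun b => glob_gSec _ _)
  have hbase : ∀ b, (∀ᶠ T in SS.l, ∃ t, b = SS.ρ T t) → Φ (gB b) ∈ Uo UU K OO := by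
    intro b hb
    rw [hΦ, cl_mem]
    filter_upwards [hN _ (gB b).2, hτ.eventually hb] with T hT ⟨t, ht⟩
    have hm : (gB b : ∀ y, St Y y) ∈ (amb β (SS.ρ (τ T)) (SS.f (τ T)) (SS.hf (τ T))).base :=
      ⟨t, by rw [ht]; rfl⟩
    rw [raw_eq K hT, hψ T _ ((MM SS GG (τ T) i).base_le hm)]
    exact h3 T _ hm
  let W : ValuationSubring (Ul UU K) := coar (Uo UU K OO)
    ((Φ.comp gB).toMonoidHom.comp SS.S.subtype) (fun s => hbase _ (SS.E2 s s.2))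
  have hW : ∀ z, z ∈ W ↔ ∃ s : SS.S, Φ (gB s) * z ∈ Uo UU K OO := fun z => Iff.rfl
  have hgB : ∀ b, sec (GG.V i) (gB b) = rs le_top (β b) := fun b =>
    sec_fn le_top (β b) (glob_gSec _ _)
  obtain ⟨j, s, hs, hs0, hv⟩ := vc β hg GG.V GG.hV GG.hc i (Ul UU K) W Φ' (by
    intro b
    rw [← hgB, hΦ', hW]
    obtain ⟨s, hs, h⟩ := SS.E0 b
    refine ⟨⟨s, hs⟩, ?_⟩
    rw [← map_mul, ← map_mul]
    exact hbase _ h)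
  obtain ⟨⟨s', hs'⟩, rfl⟩ := sec_surj _ s
  have hDV : (GG.V i : Set Y) ∩ Dom s' ⊆ GG.V j := by
    rw [← sec_bas ⟨s', hs'⟩]; exact hs
  have hstep : ∀ k, ∃ (p : ℕ) (z : gSec (GG.V i : Set Y)) (ω : ∀ T, K T) (v : SS.S),
      EqV ((GG.V i : Set Y) ∩ Dom s') (s' ^ p * GG.x j k) z ∧
      Φ z = Φ ⟨s', hs'⟩ ^ p * cl UU K ω ∧ Φ (gB v) * cl UU K ω ∈ Uo UU K OO := by
    intro k
    obtain ⟨p, z, hz, e⟩ := gL1 (GG.hV i) hs' (gSec_anti hDV (GG.hx j k))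
    obtain ⟨w, hw, e'⟩ := hv (sec (GG.V j) ⟨GG.x j k, GG.hx j k⟩) p (sec (GG.V i) ⟨z, hz⟩) (by
      refine ge_ext fun y hy => ?_
      have hy' : y ∈ (GG.V i : Set Y) ∩ Dom s' := by rw [← sec_bas ⟨s', hs'⟩]; exact hy
      rw [map_mul, ge_rs, ge_rs, ge_rs, map_pow, ge_sec, ge_sec, ge_sec]
      exact e y hy')
    obtain ⟨ω, rfl⟩ := Ideal.Quotient.mk_surjective w
    obtain ⟨v, hv⟩ := (hW _).1 hw
    refine ⟨p, ⟨z, hz⟩, ω, v, e, ?_, hv⟩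
    rw [hΦ', hΦ'] at e'
    exact e'
  choose p z ω v e1 e2 e3 using hstep
  have hs0' : Φ ⟨s', hs'⟩ ≠ 0 := by rw [← hΦ']; exact hs0
  have ev0 : ∀ᶠ T in (UU : Filter Λ), raw K N ψ s' T ≠ 0 := by
    rw [hΦ, Ne, cl_zero, ← Ultrafilter.eventually_not] at hs0'
    exact hs0'
  have ev1 : ∀ᶠ T in (UU : Filter Λ), ∀ k, (z k : ∀ y, St Y y) ∈ N T :=
    Filter.eventually_all.2 fun k => hN _ (z k).2
  have ev2 : ∀ᶠ T in (UU : Filter Λ), ∀ k, raw K N ψ (z k) T = raw K N ψ s' T ^ p k * ω k T := by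
    refine Filter.eventually_all.2 fun k => ?_
    have := e2 k
    rw [hΦ, hΦ, ← map_pow, ← map_mul, cl_eq] at this
    exact this
  have ev3 : ∀ᶠ T in (UU : Filter Λ), ∀ k, raw K N ψ (gB (v k)) T * ω k T ∈ OO T := by
    refine Filter.eventually_all.2 fun k => ?_
    have := e3 k
    rw [hΦ, ← map_mul, cl_mem] at this
    exact this
  have ev4 : ∀ᶠ T in (UU : Filter Λ), ∀ k, ∃ t, SS.ρ (τ T) (SS.f (τ T)) = SS.ρ (τ T) t * v k :=
    Filter.eventually_all.2 fun k => hτ.eventually (SS.E1 _ (v k).2)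
  have ev5 : ∀ᶠ T in (UU : Filter Λ), ∀ k, (gB (v k) : ∀ y, St Y y) ∈ N T :=
    Filter.eventually_all.2 fun k => hN _ (gB (v k)).2
  obtain ⟨T, a0, a1, a2, a3, a4, a5, a6⟩ :=
    (ev0.and (ev1.and (ev2.and (ev3.and (ev4.and (ev5.and (hN s' hs'))))))).exists
  rw [raw_eq K a6] at a0
  refine ⟨T, j, std_cov (OO T) (φ T) (h3 T) (ψ T) (hψ T) (hk T) s' a6 a0 hDV (fun k => ?_)⟩
  refine ⟨p k, z k, a1 k, ω k T, e1 k, ?_, ?_⟩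
  · have := a2 k
    rw [raw_eq K (a1 k), raw_eq (z := s') K a6] at this
    exact this
  · obtain ⟨t, ht⟩ := a4 k
    have h5 := a3 k
    rw [raw_eq K (a5 k)] at h5
    have hm : glob Y (β (SS.ρ (τ T) t)) ∈ (amb β (SS.ρ (τ T)) (SS.f (τ T)) (SS.hf (τ T))).base :=
      ⟨t, rfl⟩
    have hm' := (MM SS GG (τ T) i).base_le hm
    have hf1 : φ T ⟨_, (MM SS GG (τ T) i).f_mem⟩ = φ T ⟨_, hm'⟩ * ψ T ⟨_, a5 k⟩ := by
      rw [← hψ T _ hm' ((gen_ref _).2 hm'), ← hψ T _ (MM SS GG (τ T) i).f_mem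
        ((gen_ref _).2 (MM SS GG (τ T) i).f_mem), ← map_mul]
      congr 1
      apply Subtype.ext
      change glob Y (β (SS.ρ (τ T) (SS.f (τ T)))) = glob Y (β (SS.ρ (τ T) t)) * glob Y (β (v k))
      rw [ht, map_mul, map_mul]
    rw [hf1, mul_assoc]
    exact mul_mem (h3 T _ hm) h5

lemma ev_cov (hg : ValuativeCriterion.Existence (Y.toSpecΓ ≫ Spec.map (CommRingCat.ofHom β)))
    (i : GG.ι) : ∀ᶠ T in SS.l, ∀ (K : Type u) [Field K] (OO : ValuationSubring K)
      (φ : (MM SS GG T i).N →+* K), Kil (MM SS GG T i).V φ → φ ⟨_, (MM SS GG T i).f_mem⟩ ≠ 0 →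
      (∀ x (hx : x ∈ (amb β (SS.ρ T) (SS.f T) (SS.hf T)).base),
        φ ⟨x, (MM SS GG T i).base_le hx⟩ ∈ OO) →
      ∃ (j : GG.ι) (χ : ((MM SS GG T i).sup (MM SS GG T j)).N →+* K),
      Kil ((MM SS GG T i).sup (MM SS GG T j)).V χ ∧
      (∀ x : (MM SS GG T i).N, χ ⟨x, (sup_left _ _).2 x.2⟩ = φ x) ∧
      (∀ x : (MM SS GG T j).N, χ ⟨x, (sup_right _ _).2 x.2⟩ ∈ OO) := by
  by_contra hcon
  have hfr := Filter.not_eventually.1 hcon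
  set bad : Set SS.Λ := {T | ¬ _} with hbad
  have hne : (Filter.comap (Subtype.val : bad → SS.Λ) SS.l).NeBot := by
    rw [Filter.comap_neBot_iff_frequently, Subtype.range_coe]
    exact hfr
  have hb : ∀ T : bad, T.1 ∈ bad := fun T => T.2
  rw [hbad] at hb
  simp only [Set.mem_setOf_eq, not_forall] at hb
  choose K iK OO φ h1 h2 h3 h4 using hb
  obtain ⟨T, h⟩ := cov_lim SS GG hg i (Ultrafilter.of (Filter.comap (Subtype.val : bad → SS.Λ) SS.l))
    Subtype.val (Filter.tendsto_comap.mono_left (Ultrafilter.of_le _)) K OO φ h1 h2 h3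
  exact h4 T h

lemma ex_inv (hg : ValuativeCriterion.Existence (Y.toSpecΓ ≫ Spec.map (CommRingCat.ofHom β))) :
    ∃ T, Inv (bdata β (SS.ρ T) (SS.f T) (SS.hf T)) (MM SS GG T) := by
  have e1 : ∀ᶠ T in SS.l, ∀ i j, GOp (MM SS GG T i) (MM SS GG T j) :=
    Filter.eventually_all.2 fun i => Filter.eventually_all.2 fun j => ev_gop SS GG i j
  have e2 := Filter.eventually_all.2 fun i => ev_pb SS GG i
  have e3 := Filter.eventually_all.2 fun i => ev_cov SS GG hg i
  obtain ⟨T, a1, a2, a3⟩ := (e1.and (e2.and e3)).exists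
  exact ⟨T, ⟨fun i => std_FG, a1, fun i K _ => a3 i K, a2, GG.hc⟩⟩

end Geo
end Ngt

namespace Ngt

section Geo

variable {Y : Scheme.{u}}

lemma eval_ge {B : Type u} [CommRing B] (β : B →+* Γ(Y, ⊤)) (V : Y.Opens) {n : ℕ}
    (q : MvPolynomial (Fin n) B →+* Γ(Y, V)) (hq : ∀ b, q (MvPolynomial.C b) = rs le_top (β b))
    (p : MvPolynomial (Fin n) B) (y : Y) (hy : y ∈ V) :
    MvPolynomial.eval₂ ((glob Y).comp β) (fun k => fn V (q (MvPolynomial.X k))) p y =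
      ge V y hy (q p) := by
  have : (Pi.evalRingHom (St Y) y).comp
      (MvPolynomial.eval₂Hom ((glob Y).comp β) (fun k => fn V (q (MvPolynomial.X k)))) =
      (ge V y hy).comp q := by
    refine MvPolynomial.ringHom_ext (fun b => ?_) (fun k => ?_)
    · rw [RingHom.comp_apply, RingHom.comp_apply, hq, ge_rs, MvPolynomial.eval₂Hom_C]
      exact fn_eq _ _
    · rw [RingHom.comp_apply, RingHom.comp_apply, MvPolynomial.eval₂Hom_X']
      exact fn_eq _ _
  exact RingHom.congr_fun this p

lemma ex_pres {B : Type u} [CommRing B] (β : B →+* Γ(Y, ⊤)) (V : Y.Opens)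
    (h : ((rs (le_top : V ≤ ⊤)).comp β).FinitePresentation) :
    ∃ (n : ℕ) (q : MvPolynomial (Fin n) B →+* Γ(Y, V)), (∀ b, q (MvPolynomial.C b) = rs le_top (β b)) ∧
      Function.Surjective q ∧ (RingHom.ker q).FG := by
  letI := ((rs (le_top : V ≤ ⊤)).comp β).toAlgebra
  obtain ⟨n, q, h1, h2⟩ := h
  exact ⟨n, q.toRingHom, fun b => q.commutes b, h1, h2⟩

lemma rs_fp {B : Type u} [CommRing B] (β : B →+* Γ(Y, ⊤))
    (hg : LocallyOfFinitePresentation (Y.toSpecΓ ≫ Spec.map (CommRingCat.ofHom β)))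
    {V : Y.Opens} (hV : IsAffineOpen V) : ((rs (le_top : V ≤ ⊤)).comp β).FinitePresentation := by
  have h1 : LocallyOfFinitePresentation (hV.fromSpec ≫ (Y.toSpecΓ ≫ Spec.map (CommRingCat.ofHom β))) :=
    inferInstance
  have e1 : hV.fromSpec ≫ Y.toSpecΓ = Spec.map (CommRingCat.ofHom (rs (le_top : V ≤ ⊤))) :=
    hV.fromSpec_toSpecΓ
  rw [← Category.assoc, e1, ← Spec.map_comp, LocallyOfFinitePresentation.SpecMap_iff] at h1
  exact h1

lemma nonempty_Fp {B : Type u} [CommRing B] (β : B →+* Γ(Y, ⊤)) [CompactSpace Y]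
    (hg : LocallyOfFinitePresentation (Y.toSpecΓ ≫ Spec.map (CommRingCat.ofHom β))) :
    Nonempty (Fp β) := by
  obtain ⟨s, hs, e⟩ := isCompact_iff_finite_and_eq_biUnion_affineOpens (U := (⊤ : Y.Opens)).1
    (isCompact_univ (X := Y))
  have h := fun i : s => ex_pres β i.1.1 (rs_fp β hg i.1.2)
  choose n q hq hs' hfg using h
  choose R hR using hfg
  have hz : ∀ (i : s) p, Van (i.1.1 : Set Y) (MvPolynomial.eval₂ ((glob Y).comp β)
      (fun k => fn i.1.1 (q i (MvPolynomial.X k))) p) ↔ q i p = 0 := by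
    intro i p
    constructor
    · intro h
      refine ge_ext fun y hy => ?_
      rw [← eval_ge β _ (q i) (hq i), map_zero]
      exact h y hy
    · intro h y hy
      rw [eval_ge β _ (q i) (hq i) p y hy, h, map_zero]
  exact ⟨{
    ι := s
    fin := hs
    V := fun i => i.1.1
    hV := fun i => i.1.2
    hc := fun y => by
      have : y ∈ (⊤ : Y.Opens) := trivial
      rw [e] at this
      simp only [TopologicalSpace.Opens.mem_iSup] at this
      obtain ⟨i, hi, h⟩ := this
      exact ⟨⟨i, hi⟩, h⟩
    n := n
    x := fun i k => fn i.1.1 (q i (MvPolynomial.X k))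
    hx := fun i k => fn_mem _ subset_rfl
    hs := fun i z hz => by
      obtain ⟨p, hp⟩ := hs' i (sec i.1.1 ⟨z, hz⟩)
      refine ⟨p, fun y hy => ?_⟩
      rw [eval_ge β _ (q i) (hq i) p y hy, hp, ge_sec]
    Rl := R
    hR := fun i p hp => by
      rw [hR, RingHom.mem_ker]
      exact (hz i p).1 hp
    hR' := fun i r hr => by
      rw [hz, ← RingHom.mem_ker, ← hR]
      exact Ideal.subset_span hr }⟩

end Geo

section Alg

variable {A : Type u} [CommRing A] (U : Submonoid A)

open Classical in
/-- finite level subring -/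
noncomputable def CT (T : Finset A × Finset U) : Subalgebra ℤ A :=
  Algebra.adjoin ℤ ((T.1 : Set A) ∪ (T.2.image Subtype.val : Finset A))

lemma CT_noeth (T : Finset A × Finset U) : IsNoetherianRing (CT U T) := by
  classical
  have : Algebra.FiniteType ℤ (CT U T) := by
    refine (Subalgebra.fg_iff_finiteType _).1 ⟨T.1 ∪ T.2.image Subtype.val, ?_⟩
    rw [CT]
    congr 1
    push_cast
    rfl
  exact Algebra.FiniteType.isNoetherianRing ℤ _

lemma CT_mem1 {T : Finset A × Finset U} {a : A} (h : a ∈ T.1) : a ∈ CT U T :=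
  Algebra.subset_adjoin (Or.inl h)

lemma CT_mem2 {T : Finset A × Finset U} {a : U} (h : a ∈ T.2) : (a : A) ∈ CT U T := by
  classical
  exact Algebra.subset_adjoin (Or.inr (Finset.mem_image_of_mem _ h))

lemma CT_prod (T : Finset A × Finset U) : ((∏ v ∈ T.2, v : U) : A) ∈ CT U T := by
  rw [Submonoid.coe_finsetProd]
  exact prod_mem fun v hv => CT_mem2 U hv

/-- the standard system -/
noncomputable def sys : Sys (Localization U) where
  S := U.map (algebraMap A (Localization U))
  Λ := Finset A × Finset U
  l := Filter.atTop
  ne := by classical infer_instance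
  C T := CT U T
  cr T := inferInstance
  no T := CT_noeth U T
  ρ T := (algebraMap A (Localization U)).comp (CT U T).val.toRingHom
  f T := ⟨_, CT_prod U T⟩
  hf T := IsLocalization.map_units (Localization U) (∏ v ∈ T.2, v : U)
  E0 b := by
    classical
    obtain ⟨⟨a, v⟩, h⟩ := IsLocalization.surj U b
    refine ⟨_, ⟨v, v.2, rfl⟩, ?_⟩
    filter_upwards [Filter.eventually_ge_atTop (({a}, ∅) : Finset A × Finset U)] with T hT
    refine ⟨⟨a, CT_mem1 U (hT.1 (Finset.mem_singleton_self a))⟩, ?_⟩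
    rw [mul_comm]
    exact h
  E1 := by
    classical
    rintro _ ⟨v, hv, rfl⟩
    filter_upwards [Filter.eventually_ge_atTop ((∅, {⟨v, hv⟩}) : Finset A × Finset U)] with T hT
    have hv' : (⟨v, hv⟩ : U) ∈ T.2 := hT.2 (Finset.mem_singleton_self _)
    refine ⟨⟨((∏ w ∈ T.2.erase ⟨v, hv⟩, w : U) : A), ?_⟩, ?_⟩
    · rw [Submonoid.coe_finsetProd]
      exact prod_mem fun w hw => CT_mem2 U (Finset.mem_of_mem_erase hw)
    · change algebraMap A (Localization U) ((∏ w ∈ T.2, w : U) : A) =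
        algebraMap A (Localization U) ((∏ w ∈ T.2.erase ⟨v, hv⟩, w : U) : A) * algebraMap A (Localization U) v
      rw [← Finset.prod_erase_mul _ _ hv', ← map_mul]
      rfl
  E2 := by
    classical
    rintro _ ⟨v, hv, rfl⟩
    filter_upwards [Filter.eventually_ge_atTop (({v}, ∅) : Finset A × Finset U)] with T hT
    exact ⟨⟨v, CT_mem1 U (hT.1 (Finset.mem_singleton_self v))⟩, rfl⟩

end Alg
end Ngt

namespace Ngt

open Chart in
theorem main_result {A : Type u} [CommRing A] (U : Submonoid A) {Y : Scheme.{u}}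
    (g : Y ⟶ Spec (CommRingCat.of (Localization U)))
    (hg₁ : IsProper g) (hg₂ : LocallyOfFinitePresentation g) :
    ∃ (X : Scheme.{u}) (f : X ⟶ Spec (CommRingCat.of A)),
      IsProper f ∧ LocallyOfFinitePresentation f ∧
      ∃ e : pullback f (Spec.map (CommRingCat.ofHom (algebraMap A (Localization U)))) ≅ Y,
        e.hom ≫ g =
          pullback.snd f (Spec.map (CommRingCat.ofHom (algebraMap A (Localization U)))) := by
  obtain ⟨β, hβ⟩ : ∃ β : Localization U →+* Γ(Y, ⊤),
      Y.toSpecΓ ≫ Spec.map (CommRingCat.ofHom β) = g := by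
    refine ⟨((Scheme.ΓSpecIso (.of (Localization U))).inv ≫ g.appTop).hom, ?_⟩
    change Y.toSpecΓ ≫ Spec.map ((Scheme.ΓSpecIso (.of (Localization U))).inv ≫ g.appTop) = g
    rw [Spec.map_comp, ← Scheme.toSpecΓ_naturality_assoc, toSpecΓ_SpecMap_ΓSpecIso_inv, Category.comp_id]
  subst hβ
  haveI : Y.IsSeparated := by
    refine ⟨?_⟩
    rw [← terminal.comp_from (Y.toSpecΓ ≫ Spec.map (CommRingCat.ofHom β))]
    infer_instance
  haveI : CompactSpace Y := 
    (quasiCompact_iff_compactSpace (f := (Y.toSpecΓ ≫ Spec.map (CommRingCat.ofHom β)))).1 inferInstance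
  have hv : ValuativeCriterion.Existence (Y.toSpecΓ ≫ Spec.map (CommRingCat.ofHom β)) := by
    have h : UniversallyClosed (Y.toSpecΓ ≫ Spec.map (CommRingCat.ofHom β)) := inferInstance
    rw [UniversallyClosed.eq_valuativeCriterion] at h
    exact h.1
  obtain ⟨GG⟩ := nonempty_Fp β hg₂
  obtain ⟨T, hT⟩ := ex_inv (sys U) GG hv
  obtain ⟨n, ⟨eq⟩⟩ := Finite.exists_equiv_fin GG.ι
  obtain ⟨ι, hι, X, hX, hop⟩ := merge_all n (fun i => (eq i : ℕ)) hT (by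
    intro i j h
    have : i = j := eq.injective (Fin.ext h)
    subst this
    exact Op.of_ref (Ref.refl _)) (fun i => (eq i).2.le)
  obtain ⟨G⟩ := nonempty_glue (bdata β ((sys U).ρ T) ((sys U).f T) ((sys U).hf T)) X hop
  obtain ⟨h0, hpb⟩ := glue_pb G hX.cover hop hX.pb
  have hpr : IsProper G.π := 
    haveI : IsNoetherianRing (bdata β ((sys U).ρ T) ((sys U).f T) ((sys U).hf T)).C := (sys U).no T
    G.proper hX hop
  let π : G.Z ⟶ Spec (.of (CT U T)) := G.π
  have hπ : IsProper π := hpr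
  haveI := CT_noeth U T
  have hπ' : LocallyOfFinitePresentation π := 
    LocallyOfFinitePresentation.iff_locallyOfFiniteType.2 inferInstance
  let γ : Spec (CommRingCat.of A) ⟶ Spec (.of (CT U T)) :=
    Spec.map (CommRingCat.ofHom (CT U T).val.toRingHom)
  have hpb' : IsPullback h0 (Y.toSpecΓ ≫ Spec.map (CommRingCat.ofHom β)) π
      (Spec.map (CommRingCat.ofHom (algebraMap A (Localization U))) ≫ γ) := by
    rw [← Spec.map_comp]
    exact hpb
  refine ⟨pullback π γ, pullback.snd π γ, inferInstance, inferInstance, ?_⟩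
  have hQ := (IsPullback.of_hasPullback (pullback.snd π γ)
    (Spec.map (CommRingCat.ofHom (algebraMap A (Localization U))))).paste_horiz
    (IsPullback.of_hasPullback π γ)
  exact ⟨hQ.isoIsPullback _ _ hpb', hQ.isoIsPullback_hom_snd _ _ hpb'⟩

end Ngt

/-- Any proper morphism of finite presentation `g : Y ⟶ Spec (U⁻¹A)` extends to a proper
morphism of finite presentation `f : X ⟶ Spec A`, i.e. the base change of `f` to
`Spec (U⁻¹A)` is isomorphic to `g` over `Spec (U⁻¹A)`. -/
theorem stmt3 {A : Type u} [CommRing A] (U : Submonoid A) {Y : Scheme.{u}}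
    (g : Y ⟶ Spec (CommRingCat.of (Localization U)))
    (hg₁ : IsProper g) (hg₂ : LocallyOfFinitePresentation g) :
    ∃ (X : Scheme.{u}) (f : X ⟶ Spec (CommRingCat.of A)),
      IsProper f ∧ LocallyOfFinitePresentation f ∧
      ∃ e : pullback f (Spec.map (CommRingCat.ofHom (algebraMap A (Localization U)))) ≅ Y,
        e.hom ≫ g =
          pullback.snd f (Spec.map (CommRingCat.ofHom (algebraMap A (Localization U)))) := by
  exact Ngt.main_result U g hg₁ hg₂
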